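/- Let v ≥ 3 and b ≥ 0 be integers such that (v,b) satisfies condition (C1) or condition (C2). Then there exists an NWBTS(v;b), except possibly when (v,b) satisfies (C2) and either v ≡ 4 (mod 24) or v ∈ {50, 74}. -/

import Mathlib

namespace DataPlacement

open Finset

variable {α : Type*} [DecidableEq α]

/-- Number of blocks of the family `F` (with multiplicity) containing `T`. -/
def lamF (F : Multiset (Finset α)) (T : Finset α) : ℕ :=
  Multiset.card (F.filter fun B => T ⊆ B)

/-- Triple system with `b` blocks on a point set `X` of size `v`. -/
def IsTSOn (X : Finset α) (v b : ℕ) (F : Multiset (Finset α)) : Prop :=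
  X.card = v ∧ Multiset.card F = b ∧ ∀ B ∈ F, B.card = 3 ∧ B ⊆ X

/-- `(l, e)` is the pair associated with `(v, b)`:
`3b = l·v(v−1)/2 + e` with `−v/2 < e < v/2`. -/
def AssocPair (v b l : ℕ) (e : ℤ) : Prop :=
  6 * (b : ℤ) = (l : ℤ) * v * ((v : ℤ) - 1) + 2 * e ∧
    -(v : ℤ) < 2 * e ∧ 2 * e < (v : ℤ)

/-- Condition (C1). -/
def CondC1 (v b : ℕ) : Prop :=
  v % 3 = 2 ∧ ∃ l : ℕ, 0 < l ∧
    ((v % 6 = 5 ∧ (l % 3 = 1 ∨ l % 3 = 2)) ∨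
     (v % 6 = 2 ∧ (l % 6 = 2 ∨ l % 6 = 4))) ∧
    (b = l * v * (v - 1) / 6 ∨ b = (l * v * (v - 1) + 5) / 6)

/-- Condition (C2). -/
def CondC2 (v b : ℕ) : Prop :=
  v % 2 = 0 ∧ ∃ l : ℕ, 0 < l ∧ l % 2 = 1 ∧
    (l : ℤ) * v * ((v : ℤ) - 1) - v < 6 * (b : ℤ) ∧
    6 * (b : ℤ) < (l : ℤ) * v * ((v : ℤ) - 1) + v

/-- Pairs of points of `X` whose block count equals `l + i`. -/
def Dlev (X : Finset α) (F : Multiset (Finset α)) (l : ℕ) (i : ℤ) :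
    Finset (Finset α) :=
  (X.powersetCard 2).filter fun p => (lamF F p : ℤ) = (l : ℤ) + i

/-- Every pair of points of `X` lies in `l−1`, `l`, or `l+1` blocks. -/
def PairRangeOn (X : Finset α) (F : Multiset (Finset α)) (l : ℕ) : Prop :=
  ∀ p ∈ X.powersetCard 2,
    (l : ℤ) - 1 ≤ (lamF F p : ℤ) ∧ (lamF F p : ℤ) ≤ (l : ℤ) + 1

def IsTriangle (D : Finset (Finset α)) : Prop :=
  ∃ x y z : α, x ≠ y ∧ x ≠ z ∧ y ≠ z ∧
    D = {({x, y} : Finset α), {y, z}, {x, z}}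

def IsFourCycle (D : Finset (Finset α)) : Prop :=
  ∃ x y z w : α, x ≠ y ∧ x ≠ z ∧ x ≠ w ∧ y ≠ z ∧ y ≠ w ∧ z ≠ w ∧
    D = {({x, y} : Finset α), {y, z}, {z, w}, {x, w}}

/-- `D` is a perfect matching on the point set `X`. -/
def IsPerfectMatchingOn (X : Finset α) (D : Finset (Finset α)) : Prop :=
  (∀ p ∈ D, p.card = 2 ∧ p ⊆ X) ∧ ∀ x ∈ X, ∃! p, p ∈ D ∧ x ∈ p

/-- Defect-graph shape required for nearly 2-balance under (C1). -/
def C1ShapeOn (X : Finset α) (F : Multiset (Finset α)) (l : ℕ) (e : ℤ) : Prop :=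
  (e = 1 ∧ IsTriangle (Dlev X F l 1 ∪ Dlev X F l (-1)) ∧
     (Dlev X F l 1).card = 2 ∧ (Dlev X F l (-1)).card = 1) ∨
  (e = -1 ∧ IsTriangle (Dlev X F l 1 ∪ Dlev X F l (-1)) ∧
     (Dlev X F l 1).card = 1 ∧ (Dlev X F l (-1)).card = 2) ∨
  (e = 2 ∧ IsFourCycle (Dlev X F l 1 ∪ Dlev X F l (-1)) ∧
     (Dlev X F l 1).card = 3 ∧ (Dlev X F l (-1)).card = 1) ∨
  (e = -2 ∧ IsFourCycle (Dlev X F l 1 ∪ Dlev X F l (-1)) ∧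
     (Dlev X F l 1).card = 1 ∧ (Dlev X F l (-1)).card = 3)

/-- Defect-graph shape required for nearly 2-balance under (C2)
(here `v = X.card`). -/
def C2ShapeOn (X : Finset α) (v : ℕ) (F : Multiset (Finset α)) (l : ℕ) (e : ℤ) : Prop :=
  (((v : ℤ) - 2 * e) % 4 = 0 ∧
    IsPerfectMatchingOn X (Dlev X F l 1 ∪ Dlev X F l (-1)) ∧
    4 * ((Dlev X F l 1).card : ℤ) = (v : ℤ) + 2 * e ∧
    4 * ((Dlev X F l (-1)).card : ℤ) = (v : ℤ) - 2 * e) ∨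
  (((v : ℤ) - 2 * e) % 4 ≠ 0 ∧
    ∃ (c a₂ a₃ a₄ : α) (star : Finset (Finset α)),
      c ∈ X ∧ a₂ ∈ X ∧ a₃ ∈ X ∧ a₄ ∈ X ∧
      c ≠ a₂ ∧ c ≠ a₃ ∧ c ≠ a₄ ∧ a₂ ≠ a₃ ∧ a₂ ≠ a₄ ∧ a₃ ≠ a₄ ∧
      star = {({c, a₂} : Finset α), {c, a₃}, {c, a₄}} ∧
      star ⊆ Dlev X F l 1 ∪ Dlev X F l (-1) ∧
      IsPerfectMatchingOn (X \ {c, a₂, a₃, a₄})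
        ((Dlev X F l 1 ∪ Dlev X F l (-1)) \ star) ∧
      (((star ∩ Dlev X F l 1).card = 2 ∧ (star ∩ Dlev X F l (-1)).card = 1 ∧
          4 * (((Dlev X F l 1) \ star).card : ℤ) = (v : ℤ) - 6 + 2 * e ∧
          4 * (((Dlev X F l (-1)) \ star).card : ℤ) = (v : ℤ) - 2 - 2 * e) ∨
        ((star ∩ Dlev X F l 1).card = 1 ∧ (star ∩ Dlev X F l (-1)).card = 2 ∧
          4 * (((Dlev X F l 1) \ star).card : ℤ) = (v : ℤ) - 2 + 2 * e ∧
          4 * (((Dlev X F l (-1)) \ star).card : ℤ) = (v : ℤ) - 6 - 2 * e)))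

/-- `F` is 3-balanced on `X`: the multiplicities of any two triples of `X`
differ by at most one. -/
def ThreeBalancedOn (X : Finset α) (F : Multiset (Finset α)) : Prop :=
  ∀ T₁ ∈ X.powersetCard 3, ∀ T₂ ∈ X.powersetCard 3, F.count T₁ ≤ F.count T₂ + 1

/-- Nearly well-balanced triple system NWBTS(v;b) on the point set `X`. -/
def IsNWBTSOn (X : Finset α) (v b : ℕ) (F : Multiset (Finset α)) : Prop :=
  IsTSOn X v b F ∧ ThreeBalancedOn X F ∧
  ∃ (l : ℕ) (e : ℤ), 0 < l ∧ AssocPair v b l e ∧ PairRangeOn X F l ∧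
    ((CondC1 v b ∧ C1ShapeOn X F l e) ∨ (CondC2 v b ∧ C2ShapeOn X v F l e))

/-- `B` is an S_mu(2,3,·) design on the point set `X`. -/
def IsSDesignOn (X : Finset α) (mu : ℕ) (B : Multiset (Finset α)) : Prop :=
  (∀ A ∈ B, A.card = 3 ∧ A ⊆ X) ∧ ∀ p ∈ X.powersetCard 2, lamF B p = mu

/-- `B` is a GDD_mu(2,3,·) of type `1^{·}u^1` on `X` with long group `U`. -/
def IsGDD1u (X : Finset α) (mu u : ℕ) (U : Finset α) (B : Multiset (Finset α)) : Prop :=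
  U ⊆ X ∧ U.card = u ∧
  (∀ A ∈ B, A.card = 3 ∧ A ⊆ X ∧ (A ∩ U).card ≤ 1) ∧
  ∀ p ∈ X.powersetCard 2, ¬ p ⊆ U → lamF B p = mu

/-- `B` is a GDD_mu(2,3,·) with group family `G`. -/
def IsGDDgroups (mu : ℕ) {n : ℕ} (G : Fin n → Finset α) (B : Multiset (Finset α)) : Prop :=
  (∀ A ∈ B, A.card = 3 ∧ A ⊆ Finset.univ.biUnion G ∧ ∀ i, (A ∩ G i).card ≤ 1) ∧
  ∀ x y : α, x ≠ y → (∃ i j, i ≠ j ∧ x ∈ G i ∧ y ∈ G j) → lamF B {x, y} = mu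

/-- Nearly group divisible design NGDD(2,3,·) of type `2^{(m,n)}u^1` on `X`. -/
def IsNGDD (X : Finset α) (m n u : ℕ) (G : Fin (m + n) → Finset α) (U : Finset α)
    (B : Multiset (Finset α)) : Prop :=
  (∀ i, (G i).card = 2 ∧ G i ⊆ X) ∧ U.card = u ∧ U ⊆ X ∧
  (∀ i j, i ≠ j → Disjoint (G i) (G j)) ∧ (∀ i, Disjoint (G i) U) ∧
  U ∪ Finset.univ.biUnion G = X ∧
  (∀ A ∈ B, A.card = 3 ∧ A ⊆ X) ∧
  (∀ i : Fin (m + n), (i : ℕ) < m → lamF B (G i) = 2) ∧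
  (∀ i : Fin (m + n), m ≤ (i : ℕ) → lamF B (G i) = 0) ∧
  (∀ p ∈ U.powersetCard 2, lamF B p = 0) ∧
  (∀ p ∈ X.powersetCard 2, (∀ i, ¬ p ⊆ G i) → ¬ p ⊆ U → lamF B p = 1)

/-- Candelabra system CS(g^n : s) on `X` with stem `S` and groups `G`. -/
def IsCS (X : Finset α) (g n s : ℕ) (S : Finset α) (G : Fin n → Finset α)
    (A : Multiset (Finset α)) : Prop :=
  S.card = s ∧ S ⊆ X ∧ (∀ i, (G i).card = g ∧ G i ⊆ X) ∧
  (∀ i j, i ≠ j → Disjoint (G i) (G j)) ∧ (∀ i, Disjoint (G i) S) ∧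
  S ∪ Finset.univ.biUnion G = X ∧
  (∀ B ∈ A, B.card = 3 ∧ B ⊆ X) ∧
  (∀ T ∈ X.powersetCard 3, (∀ i, ¬ T ⊆ S ∪ G i) → lamF A T = 1) ∧
  (∀ T ∈ X.powersetCard 3, (∃ i, T ⊆ S ∪ G i) → lamF A T = 0)

/-- Partitionable candelabra system PCS(g^n : s). -/
def IsPCS (X : Finset α) (g n s : ℕ) (S : Finset α) (G : Fin n → Finset α)
    (A : Multiset (Finset α)) : Prop :=
  IsCS X g n s S G A ∧
  ∃ (Ax : α → Multiset (Finset α)) (Ai : Fin (s - 2) → Multiset (Finset α)),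
    A = (∑ p ∈ X \ S, Ax p) + ∑ i, Ai i ∧
    (∀ i : Fin n, ∀ p ∈ G i, IsGDD1u X 1 (g + s) (G i ∪ S) (Ax p)) ∧
    (∀ j, IsGDDgroups 1 G (Ai j))

/-- g-PCS_2((2ag)^n : s). -/
def IsGPCS2 (X : Finset α) (a g n s : ℕ) (S : Finset α) (G : Fin n → Finset α)
    (A : Multiset (Finset α)) : Prop :=
  IsCS X (2 * a * g) n s S G A ∧
  ∃ (P : Fin (g * n) → Multiset (Finset α)) (grp : Fin (g * n) → Fin n),
    (∑ i, P i) ≤ A ∧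
    (∀ j : Fin n, (Finset.univ.filter fun i => grp i = j).card = g) ∧
    (∀ i, IsGDD1u X 2 (2 * a * g + s) (G (grp i) ∪ S) (P i))

/-- g-PCS_2^r((2ag)^n : s). -/
def IsGPCS2r (X : Finset α) (a g n s r : ℕ) (S : Finset α) (G : Fin n → Finset α)
    (A : Multiset (Finset α)) : Prop :=
  IsCS X (2 * a * g) n s S G A ∧
  ∃ (P : Fin (g * n) → Multiset (Finset α)) (grp : Fin (g * n) → Fin n),
    (∑ i, P i) ≤ A ∧
    (∀ j : Fin n, (Finset.univ.filter fun i => grp i = j).card = g) ∧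
    (∀ i, IsGDD1u X 2 (2 * a * g + s) (G (grp i) ∪ S) (P i)) ∧
    ∃ (i : Fin (g * n)) (N : Multiset (Finset α))
      (Gs : Fin (r + (a * g * (n - 1) - r)) → Finset α),
      N ≤ P i ∧ IsNGDD X r (a * g * (n - 1) - r) (2 * a * g + s) Gs (G (grp i) ∪ S) N

/-- GDD(3,3,·) of type `g^k` on `X` with groups `H`. -/
def IsGDD3On (X : Finset α) (g : ℕ) {k : ℕ} (H : Fin k → Finset α)
    (A : Multiset (Finset α)) : Prop :=
  (∀ i, (H i).card = g ∧ H i ⊆ X) ∧ (∀ i j, i ≠ j → Disjoint (H i) (H j)) ∧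
  Finset.univ.biUnion H = X ∧
  (∀ B ∈ A, B.card = 3 ∧ B ⊆ X ∧ ∀ i, (B ∩ H i).card ≤ 1) ∧
  (∀ T ∈ X.powersetCard 3, (∀ i, (T ∩ H i).card ≤ 1) → lamF A T = 1)

/-- `B` is a GDD_mu(2,3,·) on the points not in the omitted group `H o`,
with group set `{H i : i ≠ o}`. -/
def IsGDDOmit (mu : ℕ) {k : ℕ} (H : Fin k → Finset α) (o : Fin k)
    (B : Multiset (Finset α)) : Prop :=
  (∀ A ∈ B, A.card = 3 ∧ Disjoint A (H o) ∧ ∀ i, (A ∩ H i).card ≤ 1) ∧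
  ∀ x y : α, x ≠ y →
    (∃ i j, i ≠ j ∧ i ≠ o ∧ j ≠ o ∧ x ∈ H i ∧ y ∈ H j) → lamF B {x, y} = mu

/-- PGDD_2((2g)^{n+1}). -/
def IsPGDD2 (g n : ℕ) (H : Fin (n + 1) → Finset (Fin (2 * g * (n + 1))))
    (A : Multiset (Finset (Fin (2 * g * (n + 1))))) : Prop :=
  IsGDD3On Finset.univ (2 * g) H A ∧
  ∃ (i0 : Fin (n + 1))
    (P : Fin (g * n + 2 * g) → Multiset (Finset (Fin (2 * g * (n + 1)))))
    (f : Fin (g * n + 2 * g) → Fin (n + 1)),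
    A = ∑ i, P i ∧
    (∀ j, j ≠ i0 → (Finset.univ.filter fun i => f i = j).card = g) ∧
    (∀ i, f i ≠ i0 → IsGDDOmit 2 H (f i) (P i)) ∧
    (∀ i, f i = i0 → IsGDDOmit 1 H i0 (P i))

/-- 1-FG(3,(K1,KT),n) of type 1^n. -/
def Is1FG (n : ℕ) (K1 KT : Set ℕ) (A1 AT : Multiset (Finset (Fin n))) : Prop :=
  (∀ B ∈ A1, B.card ∈ K1) ∧ (∀ B ∈ AT, B.card ∈ KT) ∧
  (∀ p ∈ (Finset.univ : Finset (Fin n)).powersetCard 2, lamF A1 p = 1) ∧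
  (∀ T ∈ (Finset.univ : Finset (Fin n)).powersetCard 3, lamF (A1 + AT) T = 1)

/-- PICS_2^r((2g)^3 : 0). -/
def IsPICS2 (g r : ℕ) (G : Fin 3 → Finset (Fin (6 * g)))
    (A : Multiset (Finset (Fin (6 * g)))) : Prop :=
  IsCS Finset.univ (2 * g) 3 0 (∅ : Finset (Fin (6 * g))) G A ∧
  ∃ P : Fin (4 * g - 2) → Multiset (Finset (Fin (6 * g))),
    A = ∑ i, P i ∧
    (∀ i : Fin (4 * g - 2), (i : ℕ) < 2 * g → IsSDesignOn Finset.univ 2 (P i)) ∧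
    (∃ i : Fin (4 * g - 2), (i : ℕ) < 2 * g ∧
      ∃ (N : Multiset (Finset (Fin (6 * g))))
        (Gs : Fin (r + (3 * g - r)) → Finset (Fin (6 * g))),
        N ≤ P i ∧ IsNGDD Finset.univ r (3 * g - r) 0 Gs ∅ N) ∧
    (∀ i : Fin (4 * g - 2), 2 * g ≤ (i : ℕ) → IsGDDgroups 1 G (P i))

/-- Number of ordered pairs of blocks of `F` whose intersection has exactly
`j` points. -/
def interCount (F : Multiset (Finset α)) (j : ℕ) : ℕ :=
  Multiset.card
    ((F.bind fun A => F.map fun B => (A, B)).filter fun p => (p.1 ∩ p.2).card = j)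

/-- The polynomial `P(F, x) = Σ_{j=0}^{3} v_j x^j`. -/
noncomputable def Pval (F : Multiset (Finset α)) (x : ℝ) : ℝ :=
  ∑ j ∈ Finset.range 4, (interCount F j : ℝ) * x ^ j

/-- Optimal data placement for triple replication. -/
def IsOptimalDP (v b : ℕ) (F : Multiset (Finset (Fin v))) : Prop :=
  IsTSOn Finset.univ v b F ∧
  ∀ F' : Multiset (Finset (Fin v)), IsTSOn Finset.univ v b F' →
    ∀ x : ℝ, 1 ≤ x → Pval F x ≤ Pval F' x


end DataPlacement

namespace DataPlacement
open Finset
set_option linter.unusedVariables false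
set_option linter.unusedSectionVars false
set_option linter.unusedFintypeInType false
set_option linter.unusedDecidableInType false
set_option linter.unusedSimpArgs false
set_option linter.style.whitespace false

open Classical in
/-- integer indicator of a proposition -/
noncomputable def ind (P : Prop) : ℤ := if P then 1 else 0

lemma ind_pos {P : Prop} (h : P) : ind P = 1 := by simp [ind, h]
lemma ind_neg {P : Prop} (h : ¬ P) : ind P = 0 := by simp [ind, h]
lemma ind_zo (P : Prop) : ind P = 0 ∨ ind P = 1 := by
  by_cases h : P
  · right; exact ind_pos h
  · left; exact ind_neg h
lemma ind_congr {P Q : Prop} (h : P ↔ Q) : ind P = ind Q := by rw [propext h]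
lemma ind_eq_ite (P : Prop) [Decidable P] : ind P = if P then 1 else 0 := by
  by_cases h : P <;> simp [ind, h]
lemma ind_true : ind True = 1 := ind_pos trivial
lemma ind_false : ind False = 0 := ind_neg id
lemma ind_not (P : Prop) : ind (¬ P) = 1 - ind P := by
  by_cases h : P <;> simp [ind, h]
lemma ind_or {P Q : Prop} (h : ¬ (P ∧ Q)) : ind (P ∨ Q) = ind P + ind Q := by
  by_cases hp : P <;> by_cases hq : Q <;> simp_all [ind]
lemma ind_and (P Q : Prop) : ind (P ∧ Q) = ind P * ind Q := by
  by_cases hp : P <;> by_cases hq : Q <;> simp_all [ind]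
lemma sum_ind_card {V : Type} [Fintype V] (P : V → Prop) [DecidablePred P] :
    ∑ z, ind (P z) = ((univ.filter P).card : ℤ) := by
  simp [ind_eq_ite]
lemma sum_ind_eq {V : Type} [Fintype V] (a : V) : ∑ z, ind (z = a) = 1 := by
  classical
  simp [ind_eq_ite]
lemma sum_ind_eq' {V : Type} [Fintype V] (a : V) : ∑ z, ind (a = z) = 1 := by
  classical
  simp [ind_eq_ite]

/-- A simple triple system, by the indicator function of its blocks. -/
structure Sys (V : Type) where
  f : V → V → V → ℤ
  zo : ∀ x y z, f x y z = 0 ∨ f x y z = 1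
  s12 : ∀ x y z, f x y z = f y x z
  s23 : ∀ x y z, f x y z = f x z y
  dg : ∀ x z, f x x z = 0

variable {V : Type} [Fintype V]

/-- number of blocks through a pair -/
noncomputable def cnt (S : Sys V) (x y : V) : ℤ := ∑ z, S.f x y z

lemma cnt_comm (S : Sys V) (x y : V) : cnt S x y = cnt S y x := by
  unfold cnt; exact Finset.sum_congr rfl fun z _ => S.s12 x y z

lemma Sys.d23 (S : Sys V) (x y : V) : S.f x y y = 0 := by
  rw [S.s12, S.s23, S.dg]
lemma Sys.d13 (S : Sys V) (x y : V) : S.f x y x = 0 := by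
  rw [S.s23, S.dg]

/-- complement -/
noncomputable def Sys.compl (S : Sys V) : Sys V where
  f x y z := ind (x ≠ y ∧ y ≠ z ∧ x ≠ z) * (1 - S.f x y z)
  zo x y z := by
    rcases ind_zo (x ≠ y ∧ y ≠ z ∧ x ≠ z) with h | h <;> rcases S.zo x y z with h' | h' <;>
      simp [h, h']
  s12 x y z := by
    rw [S.s12 x y z]; congr 1; apply ind_congr; tauto
  s23 x y z := by
    rw [S.s23 x y z]; congr 1; apply ind_congr; tauto
  dg x z := by
    rw [ind_neg (by simp)]; simp

lemma cnt_compl (S : Sys V) {x y : V} (h : x ≠ y) :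
    cnt S.compl x y = (Fintype.card V : ℤ) - 2 - cnt S x y := by
  classical
  unfold cnt
  have : ∀ z, S.compl.f x y z = 1 - ind (z = x) - ind (z = y) - S.f x y z := by
    intro z
    simp only [Sys.compl]
    by_cases hx : z = x
    · subst hx
      rw [ind_neg (by tauto), ind_pos rfl, ind_neg h, S.d13]; simp
    · by_cases hy : z = y
      · subst hy
        rw [ind_neg (by tauto), ind_pos rfl, ind_neg hx, S.d23]; simp
      · rw [ind_pos ⟨h, fun e => hy e.symm, fun e => hx e.symm⟩, ind_neg hx, ind_neg hy]; ring
  simp only [this, Finset.sum_sub_distrib, sum_ind_eq]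
  simp
  ring

/-- transport -/
def Sys.map {V W : Type} (e : W ≃ V) (S : Sys V) : Sys W where
  f x y z := S.f (e x) (e y) (e z)
  zo x y z := S.zo _ _ _
  s12 x y z := S.s12 _ _ _
  s23 x y z := S.s23 _ _ _
  dg x z := S.dg _ _

lemma cnt_map {W : Type} [Fintype W] (e : W ≃ V) (S : Sys V) (x y : W) :
    cnt (S.map e) x y = cnt S (e x) (e y) := by
  unfold cnt Sys.map
  exact Equiv.sum_comp e (fun z => S.f (e x) (e y) z)

/-- indicator of ordered triples with underlying set `{p,q,r}` -/
noncomputable def blk (p q r x y z : V) : ℤ :=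
  ind (x = p ∧ y = q ∧ z = r) + ind (x = q ∧ y = p ∧ z = r) +
  ind (x = p ∧ y = r ∧ z = q) + ind (x = r ∧ y = p ∧ z = q) +
  ind (x = q ∧ y = r ∧ z = p) + ind (x = r ∧ y = q ∧ z = p)

/-- indicator of ordered pairs with underlying set `{p,q}` -/
noncomputable def pr (p q x y : V) : ℤ := ind (x = p ∧ y = q) + ind (x = q ∧ y = p)

lemma blk_cases {p q r : V} (x y z : V) (hpq : p ≠ q) (hpr : p ≠ r) (hqr : q ≠ r) :
    blk p q r x y z = 0 ∨ (blk p q r x y z = 1 ∧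
      ∀ S : Sys V, S.f x y z = S.f p q r) := by
  by_cases h1 : x = p ∧ y = q ∧ z = r
  · obtain ⟨rfl, rfl, rfl⟩ := h1
    right; refine ⟨?_, fun S => rfl⟩
    simp [blk, ind, hpq, hpr, hqr, hpq.symm, hpr.symm, hqr.symm]
  by_cases h2 : x = q ∧ y = p ∧ z = r
  · obtain ⟨rfl, rfl, rfl⟩ := h2
    right; refine ⟨?_, fun S => S.s12 _ _ _⟩
    simp [blk, ind, hpq, hpr, hqr, hpq.symm, hpr.symm, hqr.symm]
  by_cases h3 : x = p ∧ y = r ∧ z = q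
  · obtain ⟨rfl, rfl, rfl⟩ := h3
    right; refine ⟨?_, fun S => S.s23 _ _ _⟩
    simp [blk, ind, hpq, hpr, hqr, hpq.symm, hpr.symm, hqr.symm]
  by_cases h4 : x = r ∧ y = p ∧ z = q
  · obtain ⟨rfl, rfl, rfl⟩ := h4
    right; refine ⟨?_, fun S => by rw [S.s12, S.s23]⟩
    simp [blk, ind, hpq, hpr, hqr, hpq.symm, hpr.symm, hqr.symm]
  by_cases h5 : x = q ∧ y = r ∧ z = p
  · obtain ⟨rfl, rfl, rfl⟩ := h5
    right; refine ⟨?_, fun S => by rw [S.s23, S.s12]⟩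
    simp [blk, ind, hpq, hpr, hqr, hpq.symm, hpr.symm, hqr.symm]
  by_cases h6 : x = r ∧ y = q ∧ z = p
  · obtain ⟨rfl, rfl, rfl⟩ := h6
    right; refine ⟨?_, fun S => by rw [S.s12, S.s23, S.s12]⟩
    simp [blk, ind, hpq, hpr, hqr, hpq.symm, hpr.symm, hqr.symm]
  left
  simp [blk, ind_neg h1, ind_neg h2, ind_neg h3, ind_neg h4, ind_neg h5, ind_neg h6]

lemma blk_s12 (p q r x y z : V) : blk p q r x y z = blk p q r y x z := by
  unfold blk
  rw [ind_congr (show (x = p ∧ y = q ∧ z = r) ↔ (y = q ∧ x = p ∧ z = r) by tauto),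
    ind_congr (show (x = q ∧ y = p ∧ z = r) ↔ (y = p ∧ x = q ∧ z = r) by tauto),
    ind_congr (show (x = p ∧ y = r ∧ z = q) ↔ (y = r ∧ x = p ∧ z = q) by tauto),
    ind_congr (show (x = r ∧ y = p ∧ z = q) ↔ (y = p ∧ x = r ∧ z = q) by tauto),
    ind_congr (show (x = q ∧ y = r ∧ z = p) ↔ (y = r ∧ x = q ∧ z = p) by tauto),
    ind_congr (show (x = r ∧ y = q ∧ z = p) ↔ (y = q ∧ x = r ∧ z = p) by tauto)]
  ring

lemma blk_s23 (p q r x y z : V) : blk p q r x y z = blk p q r x z y := by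
  unfold blk
  rw [ind_congr (show (x = p ∧ y = q ∧ z = r) ↔ (x = p ∧ z = r ∧ y = q) by tauto),
    ind_congr (show (x = q ∧ y = p ∧ z = r) ↔ (x = q ∧ z = r ∧ y = p) by tauto),
    ind_congr (show (x = p ∧ y = r ∧ z = q) ↔ (x = p ∧ z = q ∧ y = r) by tauto),
    ind_congr (show (x = r ∧ y = p ∧ z = q) ↔ (x = r ∧ z = q ∧ y = p) by tauto),
    ind_congr (show (x = q ∧ y = r ∧ z = p) ↔ (x = q ∧ z = p ∧ y = r) by tauto),
    ind_congr (show (x = r ∧ y = q ∧ z = p) ↔ (x = r ∧ z = p ∧ y = q) by tauto)]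
  ring

/-- toggle one block -/
noncomputable def Sys.toggle (S : Sys V) (p q r : V) (hpq : p ≠ q) (hpr : p ≠ r) (hqr : q ≠ r) :
    Sys V where
  f x y z := S.f x y z + (1 - 2 * S.f p q r) * blk p q r x y z
  zo x y z := by
    rcases blk_cases x y z hpq hpr hqr with h | ⟨h, h'⟩
    · rw [h]; simpa using S.zo x y z
    · rw [h, h' S]; rcases S.zo p q r with h | h <;> simp [h]
  s12 x y z := by rw [S.s12, blk_s12]
  s23 x y z := by rw [S.s23, blk_s23]
  dg x z := by
    rcases blk_cases x x z hpq hpr hqr with h | ⟨h, h'⟩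
    · rw [h, S.dg]; simp
    · exfalso
      simp only [blk] at h
      rw [ind_neg, ind_neg, ind_neg, ind_neg, ind_neg, ind_neg] at h
      · simp at h
      all_goals (rintro ⟨rfl, h2, -⟩; first | exact hpq h2 | exact hpr h2 | exact hqr h2 | exact hpq h2.symm | exact hpr h2.symm | exact hqr h2.symm)

lemma cnt_toggle (S : Sys V) {p q r : V} (hpq : p ≠ q) (hpr : p ≠ r) (hqr : q ≠ r) (x y : V) :
    cnt (S.toggle p q r hpq hpr hqr) x y =
      cnt S x y + (1 - 2 * S.f p q r) * (pr p q x y + pr p r x y + pr q r x y) := by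
  classical
  unfold cnt Sys.toggle
  simp only [Finset.sum_add_distrib, ← Finset.mul_sum]
  congr 2
  have key : ∀ (a b c : V), ∑ z, ind (x = a ∧ y = b ∧ z = c) = ind (x = a ∧ y = b) := by
    intro a b c
    by_cases h : x = a ∧ y = b
    · rw [ind_pos h]; simp only [h, true_and, sum_ind_eq]
    · rw [ind_neg h]; apply Finset.sum_eq_zero
      intro z _; apply ind_neg; tauto
  simp only [blk, pr, Finset.sum_add_distrib, key]
  ring

end DataPlacement

namespace DataPlacement
open Finset
set_option linter.unusedVariables false
set_option linter.unusedSimpArgs false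

lemma lamF_add {α : Type} [DecidableEq α] (F G : Multiset (Finset α)) (T : Finset α) :
    lamF (F + G) T = lamF F T + lamF G T := by
  simp [lamF, Multiset.filter_add]

lemma lamF_nsmul {α : Type} [DecidableEq α] (F : Multiset (Finset α)) (n : ℕ) (T : Finset α) :
    lamF (n • F) T = n * lamF F T := by
  induction n with
  | zero => simp [lamF]
  | succ n ih => rw [succ_nsmul, lamF_add, ih]; ring

lemma six_card {v : ℕ} (F : Multiset (Finset (Fin v))) (h : ∀ B ∈ F, B.card = 3) :
    6 * Multiset.card F = ∑ p ∈ (univ : Finset (Fin v)).offDiag, lamF F {p.1, p.2} := by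
  induction F using Multiset.induction_on with
  | empty => simp [lamF]
  | cons a F ih =>
    have h1 := ih fun B hB => h B (Multiset.mem_cons_of_mem hB)
    have h2 := h a (Multiset.mem_cons_self a F)
    have h3 : ∀ T, lamF (a ::ₘ F) T = (if T ⊆ a then 1 else 0) + lamF F T := by
      intro T
      by_cases hT : T ⊆ a
      · simp [lamF, hT]; ring
      · simp [lamF, hT]
    simp only [h3, Finset.sum_add_distrib]
    rw [← h1, Multiset.card_cons]
    have : ∑ p ∈ (univ : Finset (Fin v)).offDiag, (if ({p.1, p.2} : Finset (Fin v)) ⊆ a then 1 else 0)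
        = a.offDiag.card := by
      rw [← Finset.sum_filter, Finset.sum_const, smul_eq_mul, mul_one]
      congr 1
      ext ⟨x, y⟩
      simp [Finset.insert_subset_iff]
      tauto
    rw [this, Finset.offDiag_card, h2]
    omega

/-- blocks of a system as a finset -/
noncomputable def blocksOf {v : ℕ} (S : Sys (Fin v)) : Finset (Finset (Fin v)) :=
  open Classical in
  ((univ : Finset (Fin v)).powersetCard 3).filter
    fun B => ∃ x y z, B = {x, y, z} ∧ S.f x y z = 1

lemma triple_eq {v : ℕ} {S : Sys (Fin v)} {x y z a b c : Fin v}
    (h : ({x, y, z} : Finset (Fin v)) = {a, b, c}) (hxy : x ≠ y) (hxz : x ≠ z) (hyz : y ≠ z) :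
    S.f x y z = S.f a b c := by
  have hx : x ∈ ({a, b, c} : Finset (Fin v)) := h ▸ by simp
  have hy : y ∈ ({a, b, c} : Finset (Fin v)) := h ▸ by simp
  have hz : z ∈ ({a, b, c} : Finset (Fin v)) := h ▸ by simp
  simp only [mem_insert, mem_singleton] at hx hy hz
  rcases hx with rfl | rfl | rfl <;> rcases hy with rfl | rfl | rfl <;>
    rcases hz with rfl | rfl | rfl <;> first | rfl | (exfalso; tauto) | skip
  · exact S.s23 _ _ _
  · exact S.s12 _ _ _
  · rw [S.s23, S.s12]
  · rw [S.s12, S.s23]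
  · rw [S.s12, S.s23, S.s12]

lemma mem_blocksOf {v : ℕ} (S : Sys (Fin v)) {x y z : Fin v} :
    ({x, y, z} : Finset (Fin v)) ∈ blocksOf S ↔ S.f x y z = 1 := by
  unfold blocksOf
  simp only [mem_filter, mem_powersetCard, subset_univ, true_and]
  constructor
  · rintro ⟨hc, a, b, c, he, hf⟩
    rw [Finset.card_eq_three] at hc
    have hd : x ≠ y ∧ x ≠ z ∧ y ≠ z := by
      by_contra hcon
      obtain ⟨p, q, r, h1, h2, h3, h4⟩ := hc
      have : ({x, y, z} : Finset (Fin v)).card = 3 := by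
        rw [h4]; exact Finset.card_eq_three.mpr ⟨p, q, r, h1, h2, h3, rfl⟩
      have h5 : ({x, y, z} : Finset (Fin v)).card ≤ 2 := by
        by_cases h : x = y
        · subst h; simp; exact Finset.card_le_two
        by_cases h : x = z
        · subst h
          rw [Finset.insert_comm]; simp; exact Finset.card_le_two
        by_cases h : y = z
        · subst h; simp; exact Finset.card_le_two
        tauto
      omega
    rw [triple_eq he hd.1 hd.2.1 hd.2.2, hf]
  · intro h
    refine ⟨?_, x, y, z, rfl, h⟩
    rw [Finset.card_eq_three]
    refine ⟨x, y, z, ?_, ?_, ?_, rfl⟩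
    · rintro rfl; rw [S.dg] at h; simp at h
    · rintro rfl; rw [S.d13] at h; simp at h
    · rintro rfl; rw [S.d23] at h; simp at h

lemma lamF_finset {v : ℕ} (A : Finset (Finset (Fin v))) (hA : ∀ B ∈ A, B.card = 3)
    {x y : Fin v} (h : x ≠ y) :
    lamF A.val {x, y} = (univ.filter fun z => z ≠ x ∧ z ≠ y ∧ ({x, y, z} : Finset (Fin v)) ∈ A).card := by
  classical
  unfold lamF
  rw [← Finset.filter_val, Finset.card_val]
  symm
  apply Finset.card_bij (fun z _ => ({x, y, z} : Finset (Fin v)))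
  · intro z hz
    simp only [mem_filter, mem_univ, true_and] at hz
    simp only [mem_filter]
    refine ⟨hz.2.2, ?_⟩
    intro a; simp; tauto
  · intro z hz z' hz' he
    simp only [mem_filter, mem_univ, true_and] at hz hz'
    have : z ∈ ({x, y, z'} : Finset (Fin v)) := he ▸ by simp
    simp only [mem_insert, mem_singleton] at this
    tauto
  · intro B hB
    simp only [mem_filter] at hB
    have hc := hA B hB.1
    have hxB : x ∈ B := hB.2 (by simp)
    have hyB : y ∈ B := hB.2 (by simp)
    have : (B \ {x, y}).card = 1 := by
      rw [Finset.card_sdiff_of_subset hB.2, hc, Finset.card_pair h]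
    obtain ⟨z, hz⟩ := Finset.card_eq_one.mp this
    have hzB : z ∈ B \ {x, y} := hz ▸ by simp
    simp only [mem_sdiff, mem_insert, mem_singleton, not_or] at hzB
    have he : ({x, y, z} : Finset (Fin v)) = B := by
      apply Finset.eq_of_subset_of_card_le
      · intro a; simp; rintro (rfl | rfl | rfl) <;> tauto
      · rw [hc, Finset.card_eq_three.mpr ⟨x, y, z, h, fun e => hzB.2.1 e.symm, fun e => hzB.2.2 e.symm, rfl⟩]
    refine ⟨z, ?_, he⟩
    simp only [mem_filter, mem_univ, true_and]
    exact ⟨hzB.2.1, hzB.2.2, he ▸ hB.1⟩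

/-- the multiset of blocks with `t` extra copies of everything -/
noncomputable def famOf {v : ℕ} (S : Sys (Fin v)) (t : ℕ) : Multiset (Finset (Fin v)) :=
  (blocksOf S).val + t • ((univ : Finset (Fin v)).powersetCard 3).val

lemma famOf_three {v : ℕ} (S : Sys (Fin v)) (t : ℕ) : ∀ B ∈ famOf S t, B.card = 3 := by
  intro B hB
  unfold famOf at hB
  rcases Multiset.mem_add.mp hB with h | h
  · have : B ∈ blocksOf S := h
    unfold blocksOf at this
    simp only [mem_filter, mem_powersetCard] at this
    exact this.1.2
  · have := Multiset.mem_of_mem_nsmul h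
    exact (mem_powersetCard.mp (Finset.mem_val.mp this)).2

lemma famOf_bal {v : ℕ} (S : Sys (Fin v)) (t : ℕ) : ThreeBalancedOn univ (famOf S t) := by
  intro T₁ h1 T₂ h2
  have e : ∀ T ∈ (univ : Finset (Fin v)).powersetCard 3,
      (famOf S t).count T = (blocksOf S).val.count T + t := by
    intro T hT
    unfold famOf
    rw [Multiset.count_add, Multiset.count_nsmul,
      Multiset.count_eq_one_of_mem (Finset.nodup _) (Finset.mem_val.mpr hT), mul_one]
  rw [e _ h1, e _ h2]
  have := Multiset.nodup_iff_count_le_one.mp (blocksOf S).nodup T₁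
  omega

lemma famOf_lam {v : ℕ} (S : Sys (Fin v)) (t : ℕ) {x y : Fin v} (h : x ≠ y) :
    (lamF (famOf S t) {x, y} : ℤ) = cnt S x y + t * ((v : ℤ) - 2) := by
  classical
  unfold famOf
  rw [lamF_add, lamF_nsmul, lamF_finset _ _ h, lamF_finset _ _ h]
  · push_cast
    congr 1
    · unfold cnt
      have : ∀ z, S.f x y z = ind (z ≠ x ∧ z ≠ y ∧ ({x, y, z} : Finset (Fin v)) ∈ blocksOf S) := by
        intro z
        rcases S.zo x y z with h0 | h0
        · rw [h0, ind_neg]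
          rintro ⟨-, -, h3⟩
          rw [mem_blocksOf] at h3; omega
        · rw [h0, ind_pos]
          refine ⟨?_, ?_, (mem_blocksOf S).mpr h0⟩
          · rintro rfl; rw [S.d13] at h0; simp at h0
          · rintro rfl; rw [S.d23] at h0; simp at h0
      simp only [this]
      rw [sum_ind_card]
    · congr 1
      have : (univ.filter fun z => z ≠ x ∧ z ≠ y ∧ ({x, y, z} : Finset (Fin v)) ∈
          (univ : Finset (Fin v)).powersetCard 3) = univ \ {x, y} := by
        ext z
        simp only [mem_filter, mem_univ, true_and, mem_powersetCard, subset_univ, mem_sdiff,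
          mem_insert, mem_singleton, not_or]
        constructor
        · tauto
        · rintro ⟨h1, h2⟩
          exact ⟨h1, h2, Finset.card_eq_three.mpr ⟨x, y, z, h, fun e => h1 e.symm, fun e => h2 e.symm, rfl⟩⟩
      rw [this, Finset.card_sdiff_of_subset (subset_univ _), Finset.card_pair h, Finset.card_univ, Fintype.card_fin]
      have : 2 ≤ v := by
        have := Finset.card_le_univ ({x, y} : Finset (Fin v))
        rw [Finset.card_pair h, Fintype.card_fin] at this; exact this
      push_cast [this]; ring
  · intro B hB; exact (mem_powersetCard.mp hB).2
  · intro B hB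
    unfold blocksOf at hB
    simp only [mem_filter, mem_powersetCard] at hB
    exact hB.1.2

/-- total defect of a system with respect to `l` -/
noncomputable def totDef {V : Type} [Fintype V] (S : Sys V) (l : ℤ) : ℤ :=
  ∑ x, ∑ y, ind (x ≠ y) * (cnt S x y - l)

lemma famOf_card {v : ℕ} (S : Sys (Fin v)) (t : ℕ) (l : ℤ) :
    6 * (Multiset.card (famOf S t) : ℤ) =
      (l + t * ((v : ℤ) - 2)) * v * ((v : ℤ) - 1) + totDef S l := by
  classical
  have h := six_card (famOf S t) (famOf_three S t)
  zify at h
  rw [h]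
  have e1 : ∑ p ∈ (univ : Finset (Fin v)).offDiag, (lamF (famOf S t) {p.1, p.2} : ℤ) =
      ∑ x, ∑ y, ind (x ≠ y) * (cnt S x y - l + (l + t * ((v : ℤ) - 2))) := by
    rw [← Finset.sum_product', ← Finset.univ_product_univ.symm]
    have : (univ : Finset (Fin v)).offDiag = (univ : Finset (Fin v × Fin v)).filter (fun p => p.1 ≠ p.2) := by
      ext ⟨x, y⟩; simp
    rw [this, Finset.sum_filter]
    apply Finset.sum_congr rfl
    rintro ⟨x, y⟩ -
    by_cases hxy : x = y
    · simp [hxy, ind]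
    · rw [if_pos hxy, famOf_lam S t hxy, ind_pos hxy]; ring
  rw [e1]
  unfold totDef
  simp only [mul_add, Finset.sum_add_distrib]
  rw [add_comm]
  congr 1
  have e2 : ∀ x : Fin v, ∑ y, ind (x ≠ y) = (v : ℤ) - 1 := by
    intro x
    simp only [ne_eq, ind_not, Finset.sum_sub_distrib, sum_ind_eq']
    simp
  rw [← Finset.sum_add_distrib]
  simp only [← mul_add, ← Finset.sum_mul, ← Finset.sum_add_distrib]
  simp only [e2]
  simp
  ring

lemma mem_Dlev {v : ℕ} (S : Sys (Fin v)) (t l0 l : ℕ) (hl : (l : ℤ) = l0 + t * ((v : ℤ) - 2)) (i : ℤ)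
    {x y : Fin v} (h : x ≠ y) :
    ({x, y} : Finset (Fin v)) ∈ Dlev univ (famOf S t) l i ↔ cnt S x y = l0 + i := by
  unfold Dlev
  simp only [mem_filter, mem_powersetCard, subset_univ, true_and, Finset.card_pair h]
  rw [famOf_lam S t h, hl]
  constructor <;> intro h <;> linarith

lemma range_of {v : ℕ} (S : Sys (Fin v)) (t l0 l : ℕ) (hl : (l : ℤ) = l0 + t * ((v : ℤ) - 2))
    (h : ∀ x y, x ≠ y → (l0 : ℤ) - 1 ≤ cnt S x y ∧ cnt S x y ≤ l0 + 1) :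
    PairRangeOn univ (famOf S t) l := by
  intro p hp
  obtain ⟨x, y, hxy, rfl⟩ := Finset.card_eq_two.mp (mem_powersetCard.mp hp).2
  rw [famOf_lam S t hxy, hl]
  have := h x y hxy
  constructor <;> linarith [this.1, this.2]

lemma two_card {v : ℕ} (A : Finset (Finset (Fin v))) (hA : ∀ p ∈ A, p.card = 2) :
    (((univ : Finset (Fin v × Fin v)).filter
      (fun p => p.1 ≠ p.2 ∧ ({p.1, p.2} : Finset (Fin v)) ∈ A)).card) = 2 * A.card := by
  classical
  rw [Finset.card_eq_sum_card_fiberwise (f := fun p : Fin v × Fin v => ({p.1, p.2} : Finset (Fin v))) (t := A)]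
  · rw [Finset.sum_const_nat (m := 2), mul_comm]
    intro p hp
    obtain ⟨a, b, hab, rfl⟩ := Finset.card_eq_two.mp (hA p hp)
    rw [show Finset.filter (fun x : Fin v × Fin v => ({x.1, x.2} : Finset (Fin v)) = {a, b})
      (univ.filter fun p => p.1 ≠ p.2 ∧ ({p.1, p.2} : Finset (Fin v)) ∈ A) = {(a, b), (b, a)} from ?_]
    · rw [Finset.card_pair]; simp [hab]
    · ext ⟨x, y⟩
      simp only [mem_filter, mem_univ, true_and, mem_insert, mem_singleton, Prod.mk.injEq]
      constructor
      · rintro ⟨⟨hxy, -⟩, he⟩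
        have hx : x ∈ ({a, b} : Finset (Fin v)) := he ▸ by simp
        have hy : y ∈ ({a, b} : Finset (Fin v)) := he ▸ by simp
        simp only [mem_insert, mem_singleton] at hx hy
        rcases hx with rfl | rfl <;> rcases hy with rfl | rfl <;> simp_all
      · rintro (⟨rfl, rfl⟩ | ⟨rfl, rfl⟩)
        · exact ⟨⟨hab, hp⟩, rfl⟩
        · exact ⟨⟨hab.symm, by rwa [Finset.pair_comm]⟩, Finset.pair_comm _ _⟩
  · intro p hp
    have := (Finset.mem_filter.mp (Finset.mem_coe.mp hp)).2.2
    exact this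

/-- Difference of the number of plus and minus pairs. -/
lemma Dlev_diff {v : ℕ} (S : Sys (Fin v)) (t l0 l : ℕ) (hl : (l : ℤ) = l0 + t * ((v : ℤ) - 2))
    (h : ∀ x y, x ≠ y → (l0 : ℤ) - 1 ≤ cnt S x y ∧ cnt S x y ≤ l0 + 1) :
    2 * ((Dlev univ (famOf S t) l 1).card : ℤ) - 2 * ((Dlev univ (famOf S t) l (-1)).card : ℤ) =
      totDef S l0 := by
  classical
  have key : ∀ i : ℤ, 2 * ((Dlev univ (famOf S t) l i).card : ℤ) =
      ∑ x, ∑ y, ind (x ≠ y ∧ cnt S x y = l0 + i) := by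
    intro i
    have := two_card (Dlev univ (famOf S t) l i)
      (fun p hp => (mem_powersetCard.mp (mem_filter.mp hp).1).2)
    rw [← Finset.sum_product', Finset.univ_product_univ, sum_ind_card]
    rw [← Nat.cast_ofNat (n := 2), ← Nat.cast_mul, ← this]
    congr 2
    ext ⟨x, y⟩
    simp only [mem_filter, mem_univ, true_and]
    constructor
    · rintro ⟨h1, h2⟩; exact ⟨h1, (mem_Dlev S t l0 l hl i h1).mp h2⟩
    · rintro ⟨h1, h2⟩; exact ⟨h1, (mem_Dlev S t l0 l hl i h1).mpr h2⟩
  rw [key, key]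
  unfold totDef
  rw [← Finset.sum_sub_distrib]
  apply Finset.sum_congr rfl; intro x _
  rw [← Finset.sum_sub_distrib]
  apply Finset.sum_congr rfl; intro y _
  by_cases hxy : x = y
  · simp [hxy, ind]
  have h3 := h x y hxy
  rw [ind_and, ind_and, ind_pos hxy]
  rcases (show cnt S x y = l0 - 1 ∨ cnt S x y = l0 ∨ cnt S x y = l0 + 1 by omega) with h | h | h <;>
    rw [h] <;> simp [ind] <;> omega

end DataPlacement

namespace DataPlacement
open Finset
set_option linter.unusedVariables false
set_option linter.unusedSimpArgs false
set_option linter.unusedSectionVars false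
set_option linter.unnecessarySeqFocus false

lemma matching_card {α : Type} [DecidableEq α] (X : Finset α) (D : Finset (Finset α))
    (h : IsPerfectMatchingOn X D) : 2 * D.card = X.card := by
  classical
  have h1 := Finset.sum_card_inter (s := X) (B := D) (n := 1) (by
    intro a ha
    obtain ⟨p, hp, hu⟩ := h.2 a ha
    rw [Finset.card_eq_one]
    refine ⟨p, ?_⟩
    ext q
    simp only [mem_filter, mem_singleton]
    constructor
    · exact fun hq => hu q hq
    · rintro rfl; exact hp)
  rw [mul_one] at h1
  rw [← h1, mul_comm]
  symm
  apply Finset.sum_const_nat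
  intro p hp
  rw [Finset.inter_eq_right.mpr (h.1 p hp).2, (h.1 p hp).1]

variable {V : Type} [Fintype V]

/-- matched design: the pairs with a defect form a perfect matching `τ` with signs `σ` -/
structure IsMD (S : Sys V) (l : ℤ) (τ : V → V) (σ : V → ℤ) : Prop where
  inv : ∀ x, τ (τ x) = x
  ne : ∀ x, τ x ≠ x
  sg : ∀ x, σ (τ x) = σ x
  pm : ∀ x, σ x = 1 ∨ σ x = -1
  ct : ∀ x y, x ≠ y → cnt S x y = l + ind (y = τ x) * σ x

/-- not in the star -/
def nS (c a b d x : V) : Prop := x ≠ c ∧ x ≠ a ∧ x ≠ b ∧ x ≠ d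

structure IsStar (S : Sys V) (l : ℤ) (c a b d : V) (s : ℤ) (τ : V → V) (σ : V → ℤ) : Prop where
  hca : c ≠ a
  hcb : c ≠ b
  hcd : c ≠ d
  hab : a ≠ b
  had : a ≠ d
  hbd : b ≠ d
  hs : s = 1 ∨ s = -1
  st : ∀ x, nS c a b d x → nS c a b d (τ x)
  inv : ∀ x, nS c a b d x → τ (τ x) = x
  ne : ∀ x, nS c a b d x → τ x ≠ x
  sg : ∀ x, nS c a b d x → σ (τ x) = σ x
  pm : ∀ x, nS c a b d x → σ x = 1 ∨ σ x = -1
  ct : ∀ x y, x ≠ y → cnt S x y = l + s * (pr c a x y + pr c b x y - pr c d x y) +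
    ind (nS c a b d x ∧ y = τ x) * σ x

structure IsTri (S : Sys V) (l : ℤ) (a b c : V) (s : ℤ) : Prop where
  hab : a ≠ b
  hac : a ≠ c
  hbc : b ≠ c
  hs : s = 1 ∨ s = -1
  ct : ∀ x y, x ≠ y → cnt S x y = l + s * (pr a b x y + pr a c x y - pr b c x y)

structure IsFour (S : Sys V) (l : ℤ) (a b c d : V) (s : ℤ) : Prop where
  hab : a ≠ b
  hac : a ≠ c
  had : a ≠ d
  hbc : b ≠ c
  hbd : b ≠ d
  hcd : c ≠ d
  hs : s = 1 ∨ s = -1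
  ct : ∀ x y, x ≠ y → cnt S x y = l + s * (pr a b x y + pr b c x y + pr c d x y - pr a d x y)

lemma pr_eq {v : ℕ} (a b x y : Fin v) (h : a ≠ b) :
    pr a b x y = ind (({x, y} : Finset (Fin v)) = {a, b}) := by
  unfold pr
  rw [← ind_or]
  · apply ind_congr
    constructor
    · rintro (⟨rfl, rfl⟩ | ⟨rfl, rfl⟩)
      · rfl
      · exact Finset.pair_comm _ _
    · intro he
      have hx : x ∈ ({a, b} : Finset (Fin v)) := he ▸ by simp
      have hy : y ∈ ({a, b} : Finset (Fin v)) := he ▸ by simp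
      have ha : a ∈ ({x, y} : Finset (Fin v)) := he ▸ by simp
      have hb : b ∈ ({x, y} : Finset (Fin v)) := he ▸ by simp
      simp only [mem_insert, mem_singleton] at hx hy ha hb
      rcases hx with rfl | rfl <;> rcases hy with rfl | rfl <;> simp_all
  · rintro ⟨⟨rfl, rfl⟩, h1, h2⟩; exact h h1

lemma pr_zo {a b : V} (h : a ≠ b) (x y : V) : pr a b x y = 0 ∨ pr a b x y = 1 := by
  unfold pr
  rw [← ind_or]
  · exact ind_zo _
  · rintro ⟨⟨rfl, rfl⟩, h1, h2⟩; exact h h1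

lemma pr_one {a b : V} (h : a ≠ b) {x y : V} : pr a b x y = 1 ↔ (x = a ∧ y = b) ∨ (x = b ∧ y = a) := by
  unfold pr
  rw [← ind_or (by rintro ⟨⟨rfl, rfl⟩, h1, h2⟩; exact h h1)]
  by_cases h' : (x = a ∧ y = b) ∨ (x = b ∧ y = a)
  · rw [ind_pos h']; exact ⟨fun _ => h', fun _ => rfl⟩
  · rw [ind_neg h']; simp only [zero_ne_one, false_iff]; exact h'

/-- the union of the two defect classes -/
lemma mem_D {v : ℕ} (S : Sys (Fin v)) (t l0 l : ℕ) (hl : (l : ℤ) = l0 + t * ((v : ℤ) - 2))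
    (h : ∀ x y, x ≠ y → (l0 : ℤ) - 1 ≤ cnt S x y ∧ cnt S x y ≤ l0 + 1) (p : Finset (Fin v)) :
    p ∈ Dlev univ (famOf S t) l 1 ∪ Dlev univ (famOf S t) l (-1) ↔
      ∃ x y, x ≠ y ∧ p = {x, y} ∧ cnt S x y ≠ l0 := by
  constructor
  · intro hp
    have h2 : p.card = 2 := by
      rcases mem_union.mp hp with hp | hp <;>
      exact (mem_powersetCard.mp (mem_filter.mp hp).1).2
    obtain ⟨x, y, hxy, rfl⟩ := Finset.card_eq_two.mp h2
    refine ⟨x, y, hxy, rfl, ?_⟩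
    rw [mem_union, mem_Dlev S t l0 l hl _ hxy, mem_Dlev S t l0 l hl _ hxy] at hp
    omega
  · rintro ⟨x, y, hxy, rfl, hc⟩
    rw [mem_union, mem_Dlev S t l0 l hl _ hxy, mem_Dlev S t l0 l hl _ hxy]
    have := h x y hxy
    omega

lemma disj_D {v : ℕ} (S : Sys (Fin v)) (t l : ℕ) :
    Disjoint (Dlev univ (famOf S t) l 1) (Dlev univ (famOf S t) l (-1)) := by
  rw [Finset.disjoint_left]
  intro p h1 h2
  have := (mem_filter.mp h1).2
  have := (mem_filter.mp h2).2
  omega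

lemma isTS_of {v b : ℕ} (S : Sys (Fin v)) (t l0 l : ℕ) (e : ℤ)
    (hl : (l : ℤ) = l0 + t * ((v : ℤ) - 2))
    (hb : 6 * (b : ℤ) = (l : ℤ) * v * ((v : ℤ) - 1) + 2 * e) (ht : totDef S l0 = 2 * e) :
    IsTSOn univ v b (famOf S t) := by
  refine ⟨by simp, ?_, fun B hB => ⟨famOf_three S t B hB, subset_univ _⟩⟩
  have := famOf_card S t l0
  rw [← hl, ht] at this
  omega

lemma final_MD {v b : ℕ} (S : Sys (Fin v)) (t l0 l : ℕ) (e : ℤ) (τ : Fin v → Fin v) (σ : Fin v → ℤ)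
    (hl : (l : ℤ) = l0 + t * ((v : ℤ) - 2)) (hl0 : 0 < l)
    (hb : 6 * (b : ℤ) = (l : ℤ) * v * ((v : ℤ) - 1) + 2 * e)
    (he1 : -(v : ℤ) < 2 * e) (he2 : 2 * e < v) (ht : totDef S l0 = 2 * e)
    (hc : CondC2 v b) (hM : IsMD S l0 τ σ) : IsNWBTSOn univ v b (famOf S t) := by
  classical
  have hr : ∀ x y, x ≠ y → (l0 : ℤ) - 1 ≤ cnt S x y ∧ cnt S x y ≤ l0 + 1 := by
    intro x y hxy
    rw [hM.ct x y hxy]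
    rcases hM.pm x with h | h <;> rcases ind_zo (y = τ x) with h' | h' <;> rw [h, h'] <;> omega
  refine ⟨isTS_of S t l0 l e hl hb ht, famOf_bal S t, l, e, hl0, ⟨hb, he1, he2⟩, range_of S t l0 l hl hr,
    Or.inr ⟨hc, Or.inl ?_⟩⟩
  have hD : ∀ x y, x ≠ y → (cnt S x y ≠ l0 ↔ y = τ x) := by
    intro x y hxy
    rw [hM.ct x y hxy]
    by_cases h : y = τ x
    · rw [ind_pos h]; rcases hM.pm x with h' | h' <;> rw [h'] <;> simp [h]
    · rw [ind_neg h]; simp [h]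
  have hm : IsPerfectMatchingOn univ (Dlev univ (famOf S t) l 1 ∪ Dlev univ (famOf S t) l (-1)) := by
    constructor
    · intro p hp
      obtain ⟨x, y, hxy, rfl, -⟩ := (mem_D S t l0 l hl hr p).mp hp
      exact ⟨Finset.card_pair hxy, subset_univ _⟩
    · intro x _
      refine ⟨{x, τ x}, ⟨(mem_D S t l0 l hl hr _).mpr ⟨x, τ x, (hM.ne x).symm, rfl,
        (hD _ _ (hM.ne x).symm).mpr rfl⟩, by simp⟩, ?_⟩
      rintro p ⟨hp, hx⟩
      obtain ⟨a, c, hac, rfl, h⟩ := (mem_D S t l0 l hl hr p).mp hp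
      rw [hD a c hac] at h
      subst h
      simp only [mem_insert, mem_singleton] at hx
      rcases hx with rfl | rfl
      · rfl
      · rw [hM.inv, Finset.pair_comm]
  have h1 := matching_card _ _ hm
  rw [Finset.card_union_of_disjoint (disj_D S t l), Finset.card_univ, Fintype.card_fin] at h1
  have h2 := Dlev_diff S t l0 l hl hr
  rw [ht] at h2
  refine ⟨by omega, hm, by omega, by omega⟩

lemma final_star {v b : ℕ} (S : Sys (Fin v)) (t l0 l : ℕ) (e : ℤ) (τ : Fin v → Fin v) (σ : Fin v → ℤ)
    (c a₂ a₃ a₄ : Fin v) (s : ℤ)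
    (hl : (l : ℤ) = l0 + t * ((v : ℤ) - 2)) (hl0 : 0 < l)
    (hb : 6 * (b : ℤ) = (l : ℤ) * v * ((v : ℤ) - 1) + 2 * e)
    (he1 : -(v : ℤ) < 2 * e) (he2 : 2 * e < v) (ht : totDef S l0 = 2 * e)
    (hc : CondC2 v b) (hM : IsStar S l0 c a₂ a₃ a₄ s τ σ) : IsNWBTSOn univ v b (famOf S t) := by
  classical
  have nSi : ∀ x, nS c a₂ a₃ a₄ x ↔ x ≠ c ∧ x ≠ a₂ ∧ x ≠ a₃ ∧ x ≠ a₄ := fun x => Iff.rfl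
  have hca := hM.hca
  have hcb := hM.hcb
  have hcd := hM.hcd
  have hab := hM.hab
  have had := hM.had
  have hbd := hM.hbd
  have ct2 : cnt S c a₂ = l0 + s := by
    rw [hM.ct _ _ hca, (pr_one hca).mpr (by simp)]
    rw [show pr c a₃ c a₂ = 0 by simp [pr, ind, hab, hca, hca.symm, hca.symm, hcb.symm, hcd.symm], show pr c a₄ c a₂ = 0 by simp [pr, ind, had, hca, hca.symm, hca.symm, hcb.symm, hcd.symm],
      ind_neg (by simp [nS])]; ring
  have ct3 : cnt S c a₃ = l0 + s := by
    rw [hM.ct _ _ hcb, (pr_one hcb).mpr (by simp)]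
    rw [show pr c a₂ c a₃ = 0 by simp [pr, ind, hab.symm, hcb, hcb.symm, hca.symm, hcb.symm, hcd.symm], show pr c a₄ c a₃ = 0 by simp [pr, ind, hbd, hcb, hcb.symm, hca.symm, hcb.symm, hcd.symm],
      ind_neg (by simp [nS])]; ring
  have ct4 : cnt S c a₄ = l0 - s := by
    rw [hM.ct _ _ hcd, (pr_one hcd).mpr (by simp)]
    rw [show pr c a₂ c a₄ = 0 by simp [pr, ind, had.symm, hcd, hcd.symm, hca.symm, hcb.symm, hcd.symm], show pr c a₃ c a₄ = 0 by simp [pr, ind, hbd.symm, hcd, hcd.symm, hca.symm, hcb.symm, hcd.symm],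
      ind_neg (by simp [nS])]; ring
  have ctn : ∀ x y, nS c a₂ a₃ a₄ x → x ≠ y → cnt S x y = l0 + ind (y = τ x) * σ x := by
    intro x y hx hxy
    obtain ⟨h1, h2, h3, h4⟩ := hx
    rw [hM.ct _ _ hxy, show pr c a₂ x y = 0 by simp [pr, ind, h1, h2],
      show pr c a₃ x y = 0 by simp [pr, ind, h1, h3], show pr c a₄ x y = 0 by simp [pr, ind, h1, h4],
      ind_congr (show (nS c a₂ a₃ a₄ x ∧ y = τ x) ↔ y = τ x from ⟨fun h => h.2, fun h => ⟨⟨h1, h2, h3, h4⟩, h⟩⟩)]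
    ring
  have ctc : ∀ x y, ¬ nS c a₂ a₃ a₄ x → ¬ nS c a₂ a₃ a₄ y → x ≠ c → y ≠ c → x ≠ y → cnt S x y = l0 := by
    intro x y hx hy hxc hyc hxy
    rw [hM.ct _ _ hxy, ind_neg (fun h => hx h.1)]
    simp [pr, ind, hxc, hyc]
  have hs := hM.hs
  have hr : ∀ x y, x ≠ y → (l0 : ℤ) - 1 ≤ cnt S x y ∧ cnt S x y ≤ l0 + 1 := by
    have q1 : ∀ x y, nS c a₂ a₃ a₄ x → x ≠ y → (l0 : ℤ) - 1 ≤ cnt S x y ∧ cnt S x y ≤ l0 + 1 := by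
      intro x y hx hxy
      rw [ctn x y hx hxy]
      rcases hM.pm x hx with h | h <;> rcases ind_zo (y = τ x) with h' | h' <;> rw [h, h'] <;> omega
    have q2 : ∀ y, c ≠ y → ¬ nS c a₂ a₃ a₄ y → (l0 : ℤ) - 1 ≤ cnt S c y ∧ cnt S c y ≤ l0 + 1 := by
      intro y hcy hy
      rw [nSi] at hy
      rcases (show y = a₂ ∨ y = a₃ ∨ y = a₄ by tauto) with rfl | rfl | rfl <;> omega
    intro x y hxy
    by_cases hx : nS c a₂ a₃ a₄ x
    · exact q1 x y hx hxy
    by_cases hy : nS c a₂ a₃ a₄ y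
    · rw [cnt_comm]; exact q1 y x hy hxy.symm
    by_cases hxc : x = c
    · subst hxc; exact q2 y hxy hy
    by_cases hyc : y = c
    · subst hyc; rw [cnt_comm]; exact q2 x hxy.symm hx
    rw [ctc x y hx hy hxc hyc hxy]; omega
  refine ⟨isTS_of S t l0 l e hl hb ht, famOf_bal S t, l, e, hl0, ⟨hb, he1, he2⟩, range_of S t l0 l hl hr,
    Or.inr ⟨hc, Or.inr ?_⟩⟩
  set D₁ := Dlev univ (famOf S t) l 1 with hD1
  set D₂ := Dlev univ (famOf S t) l (-1) with hD2
  obtain ⟨star, hstar⟩ : ∃ st : Finset (Finset (Fin v)), st = {({c, a₂} : Finset (Fin v)), {c, a₃}, {c, a₄}} := ⟨_, rfl⟩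
  have m1 : ∀ x y, x ≠ y → (({x, y} : Finset (Fin v)) ∈ D₁ ↔ cnt S x y = l0 + 1) :=
    fun x y h => mem_Dlev S t l0 l hl 1 h
  have m2 : ∀ x y, x ≠ y → (({x, y} : Finset (Fin v)) ∈ D₂ ↔ cnt S x y = l0 + -1) :=
    fun x y h => mem_Dlev S t l0 l hl (-1) h
  have hsub : star ⊆ D₁ ∪ D₂ := by
    intro p hp
    rw [hstar] at hp
    simp only [mem_insert, mem_singleton] at hp
    rw [mem_union]
    rcases hp with rfl | rfl | rfl
    · rw [m1 _ _ hca, m2 _ _ hca]; omega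
    · rw [m1 _ _ hcb, m2 _ _ hcb]; omega
    · rw [m1 _ _ hcd, m2 _ _ hcd]; omega
  have n1 : ({c, a₂} : Finset (Fin v)) ≠ {c, a₃} := by
    intro h; have : a₂ ∈ ({c, a₃} : Finset (Fin v)) := h ▸ by simp
    simp [hab, hca.symm] at this
  have n2 : ({c, a₂} : Finset (Fin v)) ≠ {c, a₄} := by
    intro h; have : a₂ ∈ ({c, a₄} : Finset (Fin v)) := h ▸ by simp
    simp [had, hca.symm] at this
  have n3 : ({c, a₃} : Finset (Fin v)) ≠ {c, a₄} := by
    intro h; have : a₃ ∈ ({c, a₄} : Finset (Fin v)) := h ▸ by simp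
    simp [hbd, hcb.symm] at this
  have hsc : star.card = 3 := by
    rw [hstar]; exact Finset.card_eq_three.mpr ⟨_, _, _, n1, n2, n3, rfl⟩
  have hnS : ∀ p ∈ star, ∀ x ∈ p, ¬ nS c a₂ a₃ a₄ x := by
    intro p hp x hx
    rw [hstar] at hp
    simp only [mem_insert, mem_singleton] at hp
    rw [nSi]
    rcases hp with rfl | rfl | rfl <;> simp only [mem_insert, mem_singleton] at hx <;> tauto
  have hgood : ∀ p ∈ (D₁ ∪ D₂) \ star, ∃ x, nS c a₂ a₃ a₄ x ∧ p = {x, τ x} := by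
    intro p hp
    rw [mem_sdiff] at hp
    obtain ⟨x, y, hxy, rfl, hcn⟩ := (mem_D S t l0 l hl hr p).mp hp.1
    by_cases hx : nS c a₂ a₃ a₄ x
    · refine ⟨x, hx, ?_⟩
      rw [ctn x y hx hxy] at hcn
      by_cases hy : y = τ x
      · rw [hy]
      · rw [ind_neg hy] at hcn; simp at hcn
    by_cases hy : nS c a₂ a₃ a₄ y
    · refine ⟨y, hy, ?_⟩
      rw [cnt_comm, ctn y x hy hxy.symm] at hcn
      by_cases hx' : x = τ y
      · rw [hx', Finset.pair_comm]
      · rw [ind_neg hx'] at hcn; simp at hcn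
    exfalso
    by_cases hxc : x = c
    · subst hxc; apply hp.2; rw [hstar]; rw [nSi] at hy
      rcases (show y = a₂ ∨ y = a₃ ∨ y = a₄ by tauto) with rfl | rfl | rfl <;> simp
    by_cases hyc : y = c
    · subst hyc; apply hp.2; rw [hstar, Finset.pair_comm x y]; rw [nSi] at hx
      rcases (show x = a₂ ∨ x = a₃ ∨ x = a₄ by tauto) with rfl | rfl | rfl <;> simp
    exact hcn (ctc x y hx hy hxc hyc hxy)
  have hm : IsPerfectMatchingOn (univ \ {c, a₂, a₃, a₄}) ((D₁ ∪ D₂) \ star) := by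
    have hX : ∀ x, x ∈ (univ \ {c, a₂, a₃, a₄} : Finset (Fin v)) ↔ nS c a₂ a₃ a₄ x := by
      intro x; simp [nS]
    constructor
    · intro p hp
      obtain ⟨x, hx, rfl⟩ := hgood p hp
      refine ⟨Finset.card_pair (hM.ne x hx).symm, ?_⟩
      intro y hy
      rw [hX]
      simp only [mem_insert, mem_singleton] at hy
      rcases hy with rfl | rfl
      · exact hx
      · exact hM.st x hx
    · intro x hx
      rw [hX] at hx
      refine ⟨{x, τ x}, ⟨?_, by simp⟩, ?_⟩
      · rw [mem_sdiff]
        constructor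
        · apply (mem_D S t l0 l hl hr _).mpr
          refine ⟨x, τ x, (hM.ne x hx).symm, rfl, ?_⟩
          rw [ctn x _ hx (hM.ne x hx).symm, ind_pos rfl]
          rcases hM.pm x hx with h | h <;> rw [h] <;> simp
        · intro h; exact hnS _ h x (by simp) hx
      · rintro p ⟨hp, hxp⟩
        obtain ⟨y, hy, rfl⟩ := hgood p hp
        simp only [mem_insert, mem_singleton] at hxp
        rcases hxp with rfl | rfl
        · rfl
        · rw [hM.inv y hy, Finset.pair_comm]
  have h1 := matching_card _ _ hm
  have hc4 : ({c, a₂, a₃, a₄} : Finset (Fin v)).card = 4 := by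
    rw [Finset.card_insert_of_notMem, Finset.card_eq_three.mpr ⟨a₂, a₃, a₄, hab, had, hbd, rfl⟩]
    simp [hca, hcb, hcd]
  have hv4 : 4 ≤ v := by
    have := Finset.card_le_univ ({c, a₂, a₃, a₄} : Finset (Fin v))
    rw [hc4, Fintype.card_fin] at this; exact this
  rw [Finset.card_sdiff_of_subset hsub, Finset.card_sdiff_of_subset (subset_univ _), hsc, hc4,
    Finset.card_union_of_disjoint (disj_D S t l), Finset.card_univ, Fintype.card_fin] at h1
  have hge : 3 ≤ D₁.card + D₂.card := by
    rw [← hsc, ← Finset.card_union_of_disjoint (disj_D S t l)]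
    exact Finset.card_le_card hsub
  have h2 := Dlev_diff S t l0 l hl hr
  rw [ht] at h2
  have h1' : 2 * (D₁.card + D₂.card - 3) = v - 4 := h1
  have h2' : 2 * (D₁.card : ℤ) - 2 * (D₂.card : ℤ) = 2 * e := h2
  have e1 : (D₁ \ star).card + (star ∩ D₁).card = D₁.card := by
    rw [Finset.inter_comm]; exact Finset.card_sdiff_add_card_inter D₁ star
  have e2 : (D₂ \ star).card + (star ∩ D₂).card = D₂.card := by
    rw [Finset.inter_comm]; exact Finset.card_sdiff_add_card_inter D₂ star
  clear h1 h2
  refine ⟨by omega, c, a₂, a₃, a₄, star, mem_univ _, mem_univ _, mem_univ _, mem_univ _,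
    hca, hcb, hcd, hab, had, hbd, hstar, hsub, hm, ?_⟩
  rcases hs with hs | hs
  · left
    have i1 : star ∩ D₁ = {({c, a₂} : Finset (Fin v)), {c, a₃}} := by
      ext p
      rw [hstar]
      simp only [mem_inter, mem_insert, mem_singleton]
      constructor
      · rintro ⟨rfl | rfl | rfl, h⟩
        · simp
        · simp
        · rw [m1 _ _ hcd] at h; omega
      · rintro (rfl | rfl)
        · rw [m1 _ _ hca]; simp; omega
        · rw [m1 _ _ hcb]; simp; omega
    have i2 : star ∩ D₂ = {({c, a₄} : Finset (Fin v))} := by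
      ext p
      rw [hstar]
      simp only [mem_inter, mem_insert, mem_singleton]
      constructor
      · rintro ⟨rfl | rfl | rfl, h⟩
        · rw [m2 _ _ hca] at h; omega
        · rw [m2 _ _ hcb] at h; omega
        · rfl
      · rintro rfl
        rw [m2 _ _ hcd]; simp; omega
    rw [i1, Finset.card_pair n1] at e1
    rw [i2, Finset.card_singleton] at e2
    rw [i1, i2, Finset.card_pair n1, Finset.card_singleton]
    refine ⟨rfl, rfl, by omega, by omega⟩
  · right
    have i1 : star ∩ D₂ = {({c, a₂} : Finset (Fin v)), {c, a₃}} := by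
      ext p
      rw [hstar]
      simp only [mem_inter, mem_insert, mem_singleton]
      constructor
      · rintro ⟨rfl | rfl | rfl, h⟩
        · simp
        · simp
        · rw [m2 _ _ hcd] at h; omega
      · rintro (rfl | rfl)
        · rw [m2 _ _ hca]; simp; omega
        · rw [m2 _ _ hcb]; simp; omega
    have i2 : star ∩ D₁ = {({c, a₄} : Finset (Fin v))} := by
      ext p
      rw [hstar]
      simp only [mem_inter, mem_insert, mem_singleton]
      constructor
      · rintro ⟨rfl | rfl | rfl, h⟩
        · rw [m1 _ _ hca] at h; omega
        · rw [m1 _ _ hcb] at h; omega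
        · rfl
      · rintro rfl
        rw [m1 _ _ hcd]; simp; omega
    rw [i1, Finset.card_pair n1] at e2
    rw [i2, Finset.card_singleton] at e1
    rw [i1, i2, Finset.card_pair n1, Finset.card_singleton]
    refine ⟨rfl, rfl, by omega, by omega⟩

lemma final_tri {v b : ℕ} (S : Sys (Fin v)) (t l0 l : ℕ) (x y z : Fin v) (s : ℤ)
    (hl : (l : ℤ) = l0 + t * ((v : ℤ) - 2)) (hl0 : 0 < l) (hv : 3 ≤ v)
    (hb : 6 * (b : ℤ) = (l : ℤ) * v * ((v : ℤ) - 1) + 2 * s)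
    (ht : totDef S l0 = 2 * s)
    (hc : CondC1 v b) (hM : IsTri S l0 x y z s) : IsNWBTSOn univ v b (famOf S t) := by
  classical
  have hs := hM.hs
  have e1 : ∀ p q, p ≠ q → (cnt S p q ≠ l0 ↔ ({p, q} : Finset (Fin v)) ∈
      ({({x, y} : Finset (Fin v)), {y, z}, {x, z}} : Finset (Finset (Fin v)))) ∧
      (l0 : ℤ) - 1 ≤ cnt S p q ∧ cnt S p q ≤ l0 + 1 := by
    intro p q hpq
    have n1 := hM.hab
    have n2 := hM.hac
    have n3 := hM.hbc
    rw [hM.ct p q hpq, pr_eq _ _ _ _ n1, pr_eq _ _ _ _ n2, pr_eq _ _ _ _ n3]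
    simp only [mem_insert, mem_singleton]
    have m1 : ({x, y} : Finset (Fin v)) ≠ {y, z} := by
      intro h; have : x ∈ ({y, z} : Finset (Fin v)) := h ▸ by simp
      simp [n1, n2] at this
    have m2 : ({x, y} : Finset (Fin v)) ≠ {x, z} := by
      intro h; have : y ∈ ({x, z} : Finset (Fin v)) := h ▸ by simp
      simp [n1.symm, n3] at this
    have m3 : ({y, z} : Finset (Fin v)) ≠ {x, z} := by
      intro h; have : y ∈ ({x, z} : Finset (Fin v)) := h ▸ by simp
      simp [n1.symm, n3] at this
    by_cases h1 : ({p, q} : Finset (Fin v)) = {x, y}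
    · rw [h1, ind_pos rfl, ind_neg m1, ind_neg m2]; simp; omega
    by_cases h2 : ({p, q} : Finset (Fin v)) = {y, z}
    · rw [h2, ind_pos rfl, ind_neg m1.symm, ind_neg m3]; simp; omega
    by_cases h3 : ({p, q} : Finset (Fin v)) = {x, z}
    · rw [h3, ind_pos rfl, ind_neg m2.symm, ind_neg m3.symm]; simp; omega
    rw [ind_neg h1, ind_neg h2, ind_neg h3]; simp [h1, h2, h3]
  have hr := fun p q h => (e1 p q h).2
  have hD : Dlev univ (famOf S t) l 1 ∪ Dlev univ (famOf S t) l (-1) =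
      {({x, y} : Finset (Fin v)), {y, z}, {x, z}} := by
    ext p
    rw [mem_D S t l0 l hl hr]
    constructor
    · rintro ⟨a, c, hac, rfl, h⟩; exact (e1 a c hac).1.mp h
    · intro h
      have h' := h
      simp only [mem_insert, mem_singleton] at h'
      rcases h' with rfl | rfl | rfl
      · exact ⟨x, y, hM.hab, rfl, (e1 _ _ hM.hab).1.mpr h⟩
      · exact ⟨y, z, hM.hbc, rfl, (e1 _ _ hM.hbc).1.mpr h⟩
      · exact ⟨x, z, hM.hac, rfl, (e1 _ _ hM.hac).1.mpr h⟩
  have hT : IsTriangle (Dlev univ (famOf S t) l 1 ∪ Dlev univ (famOf S t) l (-1)) :=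
    ⟨x, y, z, hM.hab, hM.hac, hM.hbc, hD⟩
  have hcard : (Dlev univ (famOf S t) l 1).card + (Dlev univ (famOf S t) l (-1)).card = 3 := by
    rw [← Finset.card_union_of_disjoint (disj_D S t l), hD]
    have n1 := hM.hab
    have n2 := hM.hac
    have n3 := hM.hbc
    apply Finset.card_eq_three.mpr
    refine ⟨_, _, _, ?_, ?_, ?_, rfl⟩
    · intro h; have : x ∈ ({y, z} : Finset (Fin v)) := h ▸ by simp
      simp [n1, n2] at this
    · intro h; have : y ∈ ({x, z} : Finset (Fin v)) := h ▸ by simp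
      simp [n1.symm, n3] at this
    · intro h; have : y ∈ ({x, z} : Finset (Fin v)) := h ▸ by simp
      simp [n1.symm, n3] at this
  have h2 := Dlev_diff S t l0 l hl hr
  rw [ht] at h2
  refine ⟨isTS_of S t l0 l s hl hb ht, famOf_bal S t, l, s, hl0, ⟨hb, by omega, by omega⟩,
    range_of S t l0 l hl hr, Or.inl ⟨hc, ?_⟩⟩
  rcases hs with h | h
  · left; exact ⟨h, hT, by omega, by omega⟩
  · right; left; exact ⟨h, hT, by omega, by omega⟩

lemma final_four {v b : ℕ} (S : Sys (Fin v)) (t l0 l : ℕ) (x y z w : Fin v) (s : ℤ)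
    (hl : (l : ℤ) = l0 + t * ((v : ℤ) - 2)) (hl0 : 0 < l) (hv : 5 ≤ v)
    (hb : 6 * (b : ℤ) = (l : ℤ) * v * ((v : ℤ) - 1) + 2 * (2 * s))
    (ht : totDef S l0 = 2 * (2 * s))
    (hc : CondC1 v b) (hM : IsFour S l0 x y z w s) : IsNWBTSOn univ v b (famOf S t) := by
  classical
  have hs := hM.hs
  have hxy := hM.hab
  have hxz := hM.hac
  have hxw := hM.had
  have hyz := hM.hbc
  have hyw := hM.hbd
  have hzw := hM.hcd
  have m1 : ({x, y} : Finset (Fin v)) ≠ {y, z} := by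
    intro h; have : x ∈ ({y, z} : Finset (Fin v)) := h ▸ by simp
    simp [hxy, hxz] at this
  have m2 : ({x, y} : Finset (Fin v)) ≠ {z, w} := by
    intro h; have : x ∈ ({z, w} : Finset (Fin v)) := h ▸ by simp
    simp [hxw, hxz] at this
  have m3 : ({x, y} : Finset (Fin v)) ≠ {x, w} := by
    intro h; have : y ∈ ({x, w} : Finset (Fin v)) := h ▸ by simp
    simp [hxy.symm, hyw] at this
  have m4 : ({y, z} : Finset (Fin v)) ≠ {z, w} := by
    intro h; have : y ∈ ({z, w} : Finset (Fin v)) := h ▸ by simp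
    simp [hyz, hyw] at this
  have m5 : ({y, z} : Finset (Fin v)) ≠ {x, w} := by
    intro h; have : y ∈ ({x, w} : Finset (Fin v)) := h ▸ by simp
    simp [hxy.symm, hyw] at this
  have m6 : ({z, w} : Finset (Fin v)) ≠ {x, w} := by
    intro h; have : z ∈ ({x, w} : Finset (Fin v)) := h ▸ by simp
    simp [hxz.symm, hzw] at this
  have e1 : ∀ p q, p ≠ q → (cnt S p q ≠ l0 ↔ ({p, q} : Finset (Fin v)) ∈
      ({({x, y} : Finset (Fin v)), {y, z}, {z, w}, {x, w}} : Finset (Finset (Fin v)))) ∧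
      (l0 : ℤ) - 1 ≤ cnt S p q ∧ cnt S p q ≤ l0 + 1 := by
    intro p q hpq
    rw [hM.ct p q hpq, pr_eq _ _ _ _ hxy, pr_eq _ _ _ _ hyz, pr_eq _ _ _ _ hzw, pr_eq _ _ _ _ hxw]
    simp only [mem_insert, mem_singleton]
    by_cases h1 : ({p, q} : Finset (Fin v)) = {x, y}
    · rw [h1, ind_pos rfl, ind_neg m1, ind_neg m2, ind_neg m3]; simp; omega
    by_cases h2 : ({p, q} : Finset (Fin v)) = {y, z}
    · rw [h2, ind_pos rfl, ind_neg m1.symm, ind_neg m4, ind_neg m5]; simp; omega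
    by_cases h3 : ({p, q} : Finset (Fin v)) = {z, w}
    · rw [h3, ind_pos rfl, ind_neg m2.symm, ind_neg m4.symm, ind_neg m6]; simp; omega
    by_cases h4 : ({p, q} : Finset (Fin v)) = {x, w}
    · rw [h4, ind_pos rfl, ind_neg m3.symm, ind_neg m5.symm, ind_neg m6.symm]; simp; omega
    rw [ind_neg h1, ind_neg h2, ind_neg h3, ind_neg h4]; simp [h1, h2, h3, h4]
  have hr := fun p q h => (e1 p q h).2
  have hD : Dlev univ (famOf S t) l 1 ∪ Dlev univ (famOf S t) l (-1) =
      {({x, y} : Finset (Fin v)), {y, z}, {z, w}, {x, w}} := by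
    ext p
    rw [mem_D S t l0 l hl hr]
    constructor
    · rintro ⟨a, c, hac, rfl, h⟩; exact (e1 a c hac).1.mp h
    · intro h
      have h' := h
      simp only [mem_insert, mem_singleton] at h'
      rcases h' with rfl | rfl | rfl | rfl
      · exact ⟨x, y, hxy, rfl, (e1 _ _ hxy).1.mpr h⟩
      · exact ⟨y, z, hyz, rfl, (e1 _ _ hyz).1.mpr h⟩
      · exact ⟨z, w, hzw, rfl, (e1 _ _ hzw).1.mpr h⟩
      · exact ⟨x, w, hxw, rfl, (e1 _ _ hxw).1.mpr h⟩
  have hT : IsFourCycle (Dlev univ (famOf S t) l 1 ∪ Dlev univ (famOf S t) l (-1)) :=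
    ⟨x, y, z, w, hxy, hxz, hxw, hyz, hyw, hzw, hD⟩
  have hcard : (Dlev univ (famOf S t) l 1).card + (Dlev univ (famOf S t) l (-1)).card = 4 := by
    rw [← Finset.card_union_of_disjoint (disj_D S t l), hD,
      Finset.card_insert_of_notMem, Finset.card_eq_three.mpr ⟨_, _, _, m4, m5, m6, rfl⟩]
    simp [m1, m2, m3]
  have h2 := Dlev_diff S t l0 l hl hr
  rw [ht] at h2
  refine ⟨isTS_of S t l0 l (2 * s) hl hb ht, famOf_bal S t, l, 2 * s, hl0, ⟨hb, by omega, by omega⟩,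
    range_of S t l0 l hl hr, Or.inl ⟨hc, ?_⟩⟩
  rcases hs with h | h
  · right; right; left; exact ⟨by omega, hT, by omega, by omega⟩
  · right; right; right; exact ⟨by omega, hT, by omega, by omega⟩

end DataPlacement

namespace DataPlacement
open Finset
set_option linter.unusedVariables false
set_option linter.unusedSimpArgs false
set_option linter.unusedSectionVars false
set_option linter.unnecessarySeqFocus false

variable {V : Type} [Fintype V]

lemma sum_pr {a b : V} (h : a ≠ b) : ∑ x, ∑ y, ind (x ≠ y) * pr a b x y = 2 := by
  classical
  have key : ∀ p q : V, p ≠ q → ∑ x, ∑ y, ind (x ≠ y) * ind (x = p ∧ y = q) = 1 := by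
    intro p q hpq
    rw [Finset.sum_eq_single p, Finset.sum_eq_single q]
    · rw [ind_pos hpq, ind_pos ⟨rfl, rfl⟩]; rfl
    · intro y _ hy; rw [ind_neg (P := p = p ∧ y = q) (by tauto)]; simp
    · simp
    · intro x _ hx; apply Finset.sum_eq_zero; intro y _
      rw [ind_neg (P := x = p ∧ y = q) (by tauto)]; simp
    · simp
  simp only [pr, mul_add, Finset.sum_add_distrib]
  rw [key a b h, key b a h.symm]; norm_num

lemma totDef_toggle (S : Sys V) (l : ℤ) {p q r : V} (hpq : p ≠ q) (hpr : p ≠ r) (hqr : q ≠ r) :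
    totDef (S.toggle p q r hpq hpr hqr) l = totDef S l + 6 * (1 - 2 * S.f p q r) := by
  unfold totDef
  have : ∀ x y, ind (x ≠ y) * (cnt (S.toggle p q r hpq hpr hqr) x y - l) =
    ind (x ≠ y) * (cnt S x y - l) + (1 - 2 * S.f p q r) * (ind (x ≠ y) * pr p q x y) +
    (1 - 2 * S.f p q r) * (ind (x ≠ y) * pr p r x y) + (1 - 2 * S.f p q r) * (ind (x ≠ y) * pr q r x y) := by
    intro x y; rw [cnt_toggle]; ring
  simp only [this, Finset.sum_add_distrib, ← Finset.mul_sum, sum_pr hpq, sum_pr hpr, sum_pr hqr]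
  ring

lemma totDef_congr (S : Sys V) (l : ℤ) (g : V → V → ℤ) (h : ∀ x y, x ≠ y → cnt S x y = l + g x y) :
    totDef S l = ∑ x, ∑ y, ind (x ≠ y) * g x y := by
  unfold totDef
  refine Finset.sum_congr rfl fun x _ => Finset.sum_congr rfl fun y _ => ?_
  by_cases hxy : x = y
  · rw [ind_neg (by simpa using hxy)]; simp
  · rw [h x y hxy]; ring

lemma IsMD.tot {S : Sys V} {l : ℤ} {τ : V → V} {σ : V → ℤ} (h : IsMD S l τ σ) :
    totDef S l = ∑ x, σ x := by
  classical
  rw [totDef_congr S l _ h.ct]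
  refine Finset.sum_congr rfl fun x _ => ?_
  rw [Finset.sum_eq_single (τ x)]
  · rw [ind_pos (h.ne x).symm, ind_pos rfl]; ring
  · intro y _ hy; rw [ind_neg hy]; simp
  · simp

lemma IsStar.tot {S : Sys V} {l : ℤ} {c a b d : V} {s : ℤ} {τ : V → V} {σ : V → ℤ}
    (h : IsStar S l c a b d s τ σ) :
    totDef S l = 2 * s + ∑ x, ind (nS c a b d x) * σ x := by
  classical
  rw [totDef_congr S l (fun x y => s * (pr c a x y + pr c b x y - pr c d x y) +
    ind (nS c a b d x ∧ y = τ x) * σ x) (fun x y hxy => by rw [h.ct x y hxy]; ring)]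
  have : ∀ x y, ind (x ≠ y) * (s * (pr c a x y + pr c b x y - pr c d x y) +
    ind (nS c a b d x ∧ y = τ x) * σ x) = s * (ind (x ≠ y) * pr c a x y) + s * (ind (x ≠ y) * pr c b x y)
      - s * (ind (x ≠ y) * pr c d x y) + ind (x ≠ y) * (ind (nS c a b d x ∧ y = τ x) * σ x) := by
    intro x y; ring
  simp only [this, Finset.sum_add_distrib, Finset.sum_sub_distrib, ← Finset.mul_sum,
    sum_pr h.hca, sum_pr h.hcb, sum_pr h.hcd]
  have k : ∀ x, ∑ y, ind (x ≠ y) * (ind (nS c a b d x ∧ y = τ x) * σ x) = ind (nS c a b d x) * σ x := by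
    intro x
    by_cases hx : nS c a b d x
    · rw [Finset.sum_eq_single (τ x)]
      · rw [ind_pos (h.ne x hx).symm, ind_pos ⟨hx, rfl⟩, ind_pos hx]; ring
      · intro y _ hy; rw [ind_neg (P := nS c a b d x ∧ y = τ x) (fun h => hy h.2)]; simp
      · simp
    · rw [ind_neg hx]; simp only [zero_mul]
      apply Finset.sum_eq_zero; intro y _; rw [ind_neg (P := nS c a b d x ∧ y = τ x) (fun h => hx h.1)]; simp
  simp only [k]; ring

lemma IsStar.tot_minus {S : Sys V} {l : ℤ} {c a b d : V} {s : ℤ} {τ : V → V} {σ : V → ℤ}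
    (h : IsStar S l c a b d s τ σ) (hσ : ∀ x, σ x = -1) :
    totDef S l = 2 * s - (Fintype.card V - 4) := by
  classical
  rw [h.tot]
  have h1 : ∀ x, ind (nS c a b d x) * σ x = -1 + ind (x = c) + ind (x = a) + ind (x = b) + ind (x = d) := by
    intro x
    rw [hσ]
    have hca := h.hca
    have hcb := h.hcb
    have hcd := h.hcd
    have hab := h.hab
    have had := h.had
    have hbd := h.hbd
    by_cases h1 : x = c
    · subst h1; simp [nS, ind, hca, hcb, hcd]
    by_cases h2 : x = a
    · subst h2; simp [nS, ind, h1, hab, had]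
    by_cases h3 : x = b
    · subst h3; simp [nS, ind, h1, h2, hbd]
    by_cases h4 : x = d
    · subst h4; simp [nS, ind, h1, h2, h3]
    simp [nS, ind, h1, h2, h3, h4]
  simp only [h1, Finset.sum_add_distrib, sum_ind_eq]
  simp
  ring

lemma IsTri.tot {S : Sys V} {l : ℤ} {a b c : V} {s : ℤ} (h : IsTri S l a b c s) :
    totDef S l = 2 * s := by
  rw [totDef_congr S l _ h.ct]
  have : ∀ x y, ind (x ≠ y) * (s * (pr a b x y + pr a c x y - pr b c x y)) =
    s * (ind (x ≠ y) * pr a b x y) + s * (ind (x ≠ y) * pr a c x y)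
      - s * (ind (x ≠ y) * pr b c x y) := by intro x y; ring
  simp only [this, Finset.sum_add_distrib, Finset.sum_sub_distrib, ← Finset.mul_sum,
    sum_pr h.hab, sum_pr h.hac, sum_pr h.hbc]
  ring

lemma IsFour.tot {S : Sys V} {l : ℤ} {a b c d : V} {s : ℤ} (h : IsFour S l a b c d s) :
    totDef S l = 2 * (2 * s) := by
  rw [totDef_congr S l (fun x y => s * (pr a b x y + pr b c x y + pr c d x y - pr a d x y)) h.ct]
  have : ∀ x y, ind (x ≠ y) * (s * (pr a b x y + pr b c x y + pr c d x y - pr a d x y)) =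
    s * (ind (x ≠ y) * pr a b x y) + s * (ind (x ≠ y) * pr b c x y) + s * (ind (x ≠ y) * pr c d x y)
      - s * (ind (x ≠ y) * pr a d x y) := by intro x y; ring
  simp only [this, Finset.sum_add_distrib, Finset.sum_sub_distrib, ← Finset.mul_sum,
    sum_pr h.hab, sum_pr h.had, sum_pr h.hbc, sum_pr h.hcd]
  ring

lemma totDef_compl (S : Sys V) (l : ℤ) :
    totDef S.compl (Fintype.card V - 2 - l) = - totDef S l := by
  unfold totDef
  rw [← Finset.sum_neg_distrib]
  refine Finset.sum_congr rfl fun x _ => ?_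
  rw [← Finset.sum_neg_distrib]
  refine Finset.sum_congr rfl fun y _ => ?_
  by_cases hxy : x = y
  · rw [ind_neg (by simpa using hxy)]; simp
  · rw [cnt_compl S hxy]; ring

lemma totDef_map {W : Type} [Fintype W] (e : W ≃ V) (S : Sys V) (l : ℤ) :
    totDef (S.map e) l = totDef S l := by
  unfold totDef
  rw [← Equiv.sum_comp e]
  refine Finset.sum_congr rfl fun x _ => ?_
  rw [← Equiv.sum_comp e]
  refine Finset.sum_congr rfl fun y _ => ?_
  rw [cnt_map, ind_congr (show x ≠ y ↔ e x ≠ e y by simp)]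

lemma pr_map {W : Type} [Fintype W] (e : W ≃ V) (a b : V) (x y : W) :
    pr a b (e x) (e y) = pr (e.symm a) (e.symm b) x y := by
  unfold pr
  simp only [Equiv.eq_symm_apply]

lemma IsMD.map {W : Type} [Fintype W] (e : W ≃ V) {S : Sys V} {l : ℤ} {τ : V → V} {σ : V → ℤ}
    (h : IsMD S l τ σ) : IsMD (S.map e) l (fun x => e.symm (τ (e x))) (fun x => σ (e x)) where
  inv x := by simp [h.inv]
  ne x := by simp [Equiv.symm_apply_eq, h.ne]
  sg x := by simp [h.sg]
  pm x := h.pm _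
  ct x y hxy := by
    rw [cnt_map, h.ct _ _ (by simpa using hxy),
      ind_congr (show e y = τ (e x) ↔ y = e.symm (τ (e x)) by simp [Equiv.eq_symm_apply])]

lemma nS_map {W : Type} [Fintype W] (e : W ≃ V) (c a b d : V) (x : W) :
    nS (e.symm c) (e.symm a) (e.symm b) (e.symm d) x ↔ nS c a b d (e x) := by
  simp [nS, Equiv.eq_symm_apply]

lemma IsStar.map {W : Type} [Fintype W] (e : W ≃ V) {S : Sys V} {l : ℤ} {c a b d : V} {s : ℤ}
    {τ : V → V} {σ : V → ℤ} (h : IsStar S l c a b d s τ σ) :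
    IsStar (S.map e) l (e.symm c) (e.symm a) (e.symm b) (e.symm d) s
      (fun x => e.symm (τ (e x))) (fun x => σ (e x)) where
  hca := by simpa using h.hca
  hcb := by simpa using h.hcb
  hcd := by simpa using h.hcd
  hab := by simpa using h.hab
  had := by simpa using h.had
  hbd := by simpa using h.hbd
  hs := h.hs
  st x hx := by rw [nS_map] at hx ⊢; simpa using h.st _ hx
  inv x hx := by rw [nS_map] at hx; simp [h.inv _ hx]
  ne x hx := by rw [nS_map] at hx; simp [Equiv.symm_apply_eq, h.ne _ hx]
  sg x hx := by rw [nS_map] at hx; simp [h.sg _ hx]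
  pm x hx := by rw [nS_map] at hx; exact h.pm _ hx
  ct x y hxy := by
    rw [cnt_map, h.ct _ _ (by simpa using hxy), pr_map, pr_map, pr_map]
    congr 2
    apply ind_congr
    rw [nS_map, Equiv.eq_symm_apply]

lemma IsTri.map {W : Type} [Fintype W] (e : W ≃ V) {S : Sys V} {l : ℤ} {a b c : V} {s : ℤ}
    (h : IsTri S l a b c s) : IsTri (S.map e) l (e.symm a) (e.symm b) (e.symm c) s where
  hab := by simpa using h.hab
  hac := by simpa using h.hac
  hbc := by simpa using h.hbc
  hs := h.hs
  ct x y hxy := by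
    rw [cnt_map, h.ct _ _ (by simpa using hxy), pr_map, pr_map, pr_map]

lemma IsFour.map {W : Type} [Fintype W] (e : W ≃ V) {S : Sys V} {l : ℤ} {a b c d : V} {s : ℤ}
    (h : IsFour S l a b c d s) :
    IsFour (S.map e) l (e.symm a) (e.symm b) (e.symm c) (e.symm d) s where
  hab := by simpa using h.hab
  hac := by simpa using h.hac
  had := by simpa using h.had
  hbc := by simpa using h.hbc
  hbd := by simpa using h.hbd
  hcd := by simpa using h.hcd
  hs := h.hs
  ct x y hxy := by
    rw [cnt_map, h.ct _ _ (by simpa using hxy), pr_map, pr_map, pr_map, pr_map]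

lemma IsMD.compl {S : Sys V} {l : ℤ} {τ : V → V} {σ : V → ℤ} (h : IsMD S l τ σ) :
    IsMD S.compl (Fintype.card V - 2 - l) τ (fun x => - σ x) where
  inv := h.inv
  ne := h.ne
  sg x := by rw [h.sg]
  pm x := by have := h.pm x; omega
  ct x y hxy := by rw [cnt_compl S hxy, h.ct x y hxy]; ring

lemma IsStar.compl {S : Sys V} {l : ℤ} {c a b d : V} {s : ℤ} {τ : V → V} {σ : V → ℤ}
    (h : IsStar S l c a b d s τ σ) :
    IsStar S.compl (Fintype.card V - 2 - l) c a b d (-s) τ (fun x => - σ x) where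
  hca := h.hca
  hcb := h.hcb
  hcd := h.hcd
  hab := h.hab
  had := h.had
  hbd := h.hbd
  hs := by have := h.hs; omega
  st := h.st
  inv := h.inv
  ne := h.ne
  sg x hx := by rw [h.sg x hx]
  pm x hx := by have := h.pm x hx; omega
  ct x y hxy := by rw [cnt_compl S hxy, h.ct x y hxy]; ring

lemma IsTri.compl {S : Sys V} {l : ℤ} {a b c : V} {s : ℤ} (h : IsTri S l a b c s) :
    IsTri S.compl (Fintype.card V - 2 - l) a b c (-s) where
  hab := h.hab
  hac := h.hac
  hbc := h.hbc
  hs := by have := h.hs; omega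
  ct x y hxy := by rw [cnt_compl S hxy, h.ct x y hxy]; ring

lemma IsFour.compl {S : Sys V} {l : ℤ} {a b c d : V} {s : ℤ} (h : IsFour S l a b c d s) :
    IsFour S.compl (Fintype.card V - 2 - l) a b c d (-s) where
  hab := h.hab
  hac := h.hac
  had := h.had
  hbc := h.hbc
  hbd := h.hbd
  hcd := h.hcd
  hs := by have := h.hs; omega
  ct x y hxy := by rw [cnt_compl S hxy, h.ct x y hxy]; ring

/-- existence of a matched design -/
def HasMD (v : ℕ) (l E : ℤ) : Prop :=
  ∃ (S : Sys (Fin v)) (τ : Fin v → Fin v) (σ : Fin v → ℤ), IsMD S l τ σ ∧ totDef S l = E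
/-- existence of a star design -/
def HasStar (v : ℕ) (l E : ℤ) : Prop :=
  ∃ (S : Sys (Fin v)) (c a b d : Fin v) (s : ℤ) (τ : Fin v → Fin v) (σ : Fin v → ℤ),
    IsStar S l c a b d s τ σ ∧ totDef S l = E
/-- existence of a triangle design -/
def HasTri (v : ℕ) (l s : ℤ) : Prop :=
  ∃ (S : Sys (Fin v)) (a b c : Fin v), IsTri S l a b c s
/-- existence of a four-cycle design -/
def HasFour (v : ℕ) (l s : ℤ) : Prop :=
  ∃ (S : Sys (Fin v)) (a b c d : Fin v), IsFour S l a b c d s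

lemma IsMD.has {v : ℕ} (hv : Fintype.card V = v) {S : Sys V} {l : ℤ} {τ : V → V} {σ : V → ℤ}
    (h : IsMD S l τ σ) {E : ℤ} (hE : totDef S l = E) : HasMD v l E := by
  obtain ⟨e⟩ : Nonempty (Fin v ≃ V) := ⟨(Fintype.equivFinOfCardEq hv).symm⟩
  exact ⟨S.map e, _, _, h.map e, by rw [totDef_map, hE]⟩

lemma IsStar.has {v : ℕ} (hv : Fintype.card V = v) {S : Sys V} {l : ℤ} {c a b d : V} {s : ℤ}
    {τ : V → V} {σ : V → ℤ}
    (h : IsStar S l c a b d s τ σ) {E : ℤ} (hE : totDef S l = E) : HasStar v l E := by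
  obtain ⟨e⟩ : Nonempty (Fin v ≃ V) := ⟨(Fintype.equivFinOfCardEq hv).symm⟩
  exact ⟨S.map e, _, _, _, _, _, _, _, h.map e, by rw [totDef_map, hE]⟩

lemma IsTri.has {v : ℕ} (hv : Fintype.card V = v) {S : Sys V} {l : ℤ} {a b c : V} {s : ℤ}
    (h : IsTri S l a b c s) : HasTri v l s := by
  obtain ⟨e⟩ : Nonempty (Fin v ≃ V) := ⟨(Fintype.equivFinOfCardEq hv).symm⟩
  exact ⟨S.map e, _, _, _, h.map e⟩

lemma IsFour.has {v : ℕ} (hv : Fintype.card V = v) {S : Sys V} {l : ℤ} {a b c d : V} {s : ℤ}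
    (h : IsFour S l a b c d s) : HasFour v l s := by
  obtain ⟨e⟩ : Nonempty (Fin v ≃ V) := ⟨(Fintype.equivFinOfCardEq hv).symm⟩
  exact ⟨S.map e, _, _, _, _, h.map e⟩

lemma HasMD.compl {v : ℕ} {l E : ℤ} (h : HasMD v l E) : HasMD v (v - 2 - l) (-E) := by
  obtain ⟨S, τ, σ, h, hE⟩ := h
  have h1 := h.compl
  have h2 := totDef_compl S l
  rw [Fintype.card_fin] at h1 h2
  exact ⟨_, _, _, h1, by rw [h2, hE]⟩
lemma HasStar.compl {v : ℕ} {l E : ℤ} (h : HasStar v l E) : HasStar v (v - 2 - l) (-E) := by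
  obtain ⟨S, c, a, b, d, s, τ, σ, h, hE⟩ := h
  have h1 := h.compl
  have h2 := totDef_compl S l
  rw [Fintype.card_fin] at h1 h2
  exact ⟨_, _, _, _, _, _, _, _, h1, by rw [h2, hE]⟩
lemma HasTri.compl {v : ℕ} {l s : ℤ} (h : HasTri v l s) : HasTri v (v - 2 - l) (-s) := by
  obtain ⟨S, a, b, c, h⟩ := h
  have h1 := h.compl
  rw [Fintype.card_fin] at h1
  exact ⟨_, _, _, _, h1⟩
lemma HasFour.compl {v : ℕ} {l s : ℤ} (h : HasFour v l s) : HasFour v (v - 2 - l) (-s) := by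
  obtain ⟨S, a, b, c, d, h⟩ := h
  have h1 := h.compl
  rw [Fintype.card_fin] at h1
  exact ⟨_, _, _, _, _, h1⟩

/-- toggling a block on a defect edge gives a star -/
lemma IsMD.toggle_star {S : Sys V} {l : ℤ} {τ : V → V} {σ : V → ℤ} (h : IsMD S l τ σ)
    {p r : V} {s : ℤ} (hs : s = 1 ∨ s = -1) (hp : σ p = -s) (hr : σ r = -s) (hrp : r ≠ p)
    (hrt : r ≠ τ p) (hf : 2 * S.f p (τ p) r = 1 - s) :
    IsStar (S.toggle p (τ p) r (h.ne p).symm hrp.symm hrt.symm) l r p (τ p) (τ r) s τ σ where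
  hca := hrp
  hcb := hrt
  hcd := (h.ne r).symm
  hab := (h.ne p).symm
  had := by intro e; apply hrt; rw [e, h.inv]
  hbd := by intro e; apply hrp; rw [← h.inv r, ← e, h.inv]
  hs := hs
  st x hx := by
    obtain ⟨h1, h2, h3, h4⟩ := hx
    refine ⟨?_, ?_, ?_, ?_⟩
    · intro e; apply h4; rw [← e, h.inv]
    · intro e; apply h3; rw [← e, h.inv]
    · intro e; apply h2; rw [← h.inv x, e, h.inv]
    · intro e; apply h1; rw [← h.inv x, e, h.inv]
  inv x _ := h.inv x
  ne x _ := h.ne x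
  sg x _ := h.sg x
  pm x _ := h.pm x
  ct x y hxy := by
    rw [cnt_toggle, h.ct x y hxy, show 1 - 2 * S.f p (τ p) r = s by omega]
    have c1 : ∀ a b : V, pr a b x y = pr b a x y := by intro a b; unfold pr; ring
    have hpt : pr p (τ p) x y = ind (y = τ x ∧ (x = p ∨ x = τ p)) := by
      unfold pr
      rw [← ind_or (by rintro ⟨⟨rfl, h2⟩, h3, h4⟩; exact h.ne _ h3.symm)]
      apply ind_congr
      constructor
      · rintro (⟨rfl, rfl⟩ | ⟨rfl, rfl⟩)
        · simp
        · simp [h.inv]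
      · rintro ⟨rfl, rfl | rfl⟩
        · simp
        · simp [h.inv]
    have hrt' : pr r (τ r) x y = ind (y = τ x ∧ (x = r ∨ x = τ r)) := by
      unfold pr
      rw [← ind_or (by rintro ⟨⟨rfl, h2⟩, h3, h4⟩; exact h.ne _ h3.symm)]
      apply ind_congr
      constructor
      · rintro (⟨rfl, rfl⟩ | ⟨rfl, rfl⟩)
        · simp
        · simp [h.inv]
      · rintro ⟨rfl, rfl | rfl⟩
        · simp
        · simp [h.inv]
    have key : ind (y = τ x) * σ x + s * pr p (τ p) x y + s * pr r (τ r) x y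
        = ind (nS r p (τ p) (τ r) x ∧ y = τ x) * σ x := by
      rw [hpt, hrt']
      by_cases hy : y = τ x
      · have d1 : r ≠ τ r := (h.ne r).symm
        have d2 : p ≠ τ p := (h.ne p).symm
        have d3 : p ≠ τ r := by intro e; apply hrt; rw [e, h.inv]
        have d4 : τ p ≠ τ r := by intro e; apply hrp; rw [← h.inv r, ← e, h.inv]
        by_cases h1 : x = r
        · subst h1; simp [ind, hy, nS, hr, hrp, hrt]
        by_cases h2 : x = p
        · subst h2; simp [ind, hy, nS, hp, h1, d3]
        by_cases h3 : x = τ p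
        · subst h3; simp [ind, hy, nS, h.sg, hp, h1, h2, d4]
        by_cases h4 : x = τ r
        · subst h4; simp [ind, hy, nS, h.sg, hr, h1, h2, h3]
        simp [ind, hy, nS, h1, h2, h3, h4]
      · simp [ind, hy]
    rw [c1 p r, c1 (τ p) r]
    linarith

/-- a single defect of size two gives a triangle -/
lemma toggle_tri {S : Sys V} {l : ℤ} {a b x : V} {s : ℤ} (hs : s = 1 ∨ s = -1)
    (hab : a ≠ b) (hax : a ≠ x) (hbx : b ≠ x) (hf : 2 * S.f a b x = 1 - s)
    (h : ∀ x y, x ≠ y → cnt S x y = l - 2 * s * pr a b x y) :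
    IsTri (S.toggle a b x hab hax hbx) l x a b s where
  hab := hax.symm
  hac := hbx.symm
  hbc := hab
  hs := hs
  ct p q hpq := by
    rw [cnt_toggle, h p q hpq, show 1 - 2 * S.f a b x = s by omega]
    have c1 : ∀ a b : V, pr a b p q = pr b a p q := by intro a b; unfold pr; ring
    rw [c1 x a, c1 x b]; ring

lemma IsTri.toggle_four {S : Sys V} {l : ℤ} {a b c p : V} {s : ℤ} (h : IsTri S l a b c s)
    (hpa : p ≠ a) (hpb : p ≠ b) (hpc : p ≠ c) (hf : 2 * S.f p a b = 1 + s) :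
    IsFour (S.toggle p a b hpa hpb h.hab) l a p b c (-s) where
  hab := hpa.symm
  hac := h.hab
  had := h.hac
  hbc := hpb
  hbd := hpc
  hcd := h.hbc
  hs := by have := h.hs; omega
  ct x y hxy := by
    rw [cnt_toggle, h.ct x y hxy, show 1 - 2 * S.f p a b = -s by omega]
    have c1 : ∀ a b : V, pr a b x y = pr b a x y := by intro a b; unfold pr; ring
    rw [c1 p a]; ring

lemma cnt_nonneg (S : Sys V) (x y : V) : 0 ≤ cnt S x y :=
  Finset.sum_nonneg fun z _ => by rcases S.zo x y z with h | h <;> omega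

lemma f_of_cnt_zero {S : Sys V} {x y : V} (h : cnt S x y = 0) (z : V) : S.f x y z = 0 := by
  unfold cnt at h
  rw [Finset.sum_eq_zero_iff_of_nonneg (fun z _ => by rcases S.zo x y z with h | h <;> omega)] at h
  exact h z (mem_univ _)

lemma exists_f_one {S : Sys V} {x y : V} (h : 0 < cnt S x y) : ∃ z, S.f x y z = 1 := by
  by_contra hc
  push Not at hc
  have : cnt S x y = 0 := Finset.sum_eq_zero fun z _ => by
    rcases S.zo x y z with h | h
    · exact h
    · exact absurd h (hc z)
  omega

/-- the general conclusion from a triangle: a four-cycle with twice the sign -/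
lemma HasTri.four {v : ℕ} {l s : ℤ} (h : HasTri v l s) (h1 : 1 ≤ l) (h2 : l + 3 ≤ v) :
    HasFour v l (-s) := by
  obtain ⟨S, a, b, c, h⟩ := h
  have hct := h.ct a b h.hab
  have e1 : pr a b a b = 1 := (pr_one h.hab).mpr (by simp)
  have hab := h.hab
  have hac := h.hac
  have hbc := h.hbc
  have e2 : pr a c a b = 0 := by simp [pr, ind, hab, hac, hbc]
  have e3 : pr b c a b = 0 := by simp [pr, ind, hab, hac, hbc]
  rw [e1, e2, e3] at hct
  have hex : ∃ p, p ≠ a ∧ p ≠ b ∧ p ≠ c ∧ 2 * S.f p a b = 1 + s := by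
    by_contra hcon
    push Not at hcon
    rcases h.hs with hs | hs
    · have hle : cnt S a b ≤ ∑ z : Fin v, ind (z = c) := by
        refine Finset.sum_le_sum fun z _ => ?_
        by_cases hz : z = c
        · rw [ind_pos hz]; rcases S.zo a b z with h | h <;> omega
        · rw [ind_neg hz]
          by_cases hza : z = a
          · rw [hza, S.d13]
          by_cases hzb : z = b
          · rw [hzb, S.d23]
          have := hcon z hza hzb hz
          rw [S.s12, S.s23] at this
          rcases S.zo a b z with h | h
          · omega
          · omega
      rw [sum_ind_eq] at hle; omega
    · have hge : ∑ z : Fin v, (1 - ind (z = a) - ind (z = b) - ind (z = c)) ≤ cnt S a b := by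
        refine Finset.sum_le_sum fun z _ => ?_
        have q1 := ind_zo (z = a)
        have q2 := ind_zo (z = b)
        have q3 := ind_zo (z = c)
        have q4 := S.zo a b z
        by_cases hza : z = a
        · rw [ind_pos hza]; omega
        by_cases hzb : z = b
        · rw [ind_pos hzb]; omega
        by_cases hzc : z = c
        · rw [ind_pos hzc]; omega
        have := hcon z hza hzb hzc
        rw [S.s12, S.s23, S.s12] at this
        rw [S.s12] at q4 ⊢
        omega
      simp only [Finset.sum_sub_distrib, sum_ind_eq] at hge
      simp at hge
      omega
  obtain ⟨p, hpa, hpb, hpc, hf⟩ := hex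
  exact ⟨_, _, _, _, _, h.toggle_four hpa hpb hpc hf⟩

/-- a single defect of size two -/
lemma tri_of_single {v : ℕ} (hv : Fintype.card V = v) {S : Sys V} {l : ℤ} {a b : V} {s : ℤ}
    (hs : s = 1 ∨ s = -1) (hab : a ≠ b)
    (h : ∀ x y, x ≠ y → cnt S x y = l - 2 * s * pr a b x y) (h1 : 0 ≤ l) (h2 : l + 1 ≤ v) :
    HasTri v l s := by
  have hct := h a b hab
  rw [(pr_one hab).mpr (by simp)] at hct
  have hex : ∃ x, a ≠ x ∧ b ≠ x ∧ 2 * S.f a b x = 1 - s := by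
    by_contra hcon
    push Not at hcon
    rcases hs with hs | hs
    · have hge : ∑ z : V, (1 - ind (z = a) - ind (z = b)) ≤ cnt S a b := by
        refine Finset.sum_le_sum fun z _ => ?_
        have q1 := ind_zo (z = a)
        have q2 := ind_zo (z = b)
        have q4 := S.zo a b z
        by_cases hza : z = a
        · rw [ind_pos hza]; omega
        by_cases hzb : z = b
        · rw [ind_pos hzb]; omega
        have := hcon z (Ne.symm hza) (Ne.symm hzb)
        omega
      simp only [Finset.sum_sub_distrib, sum_ind_eq] at hge
      simp [hv] at hge
      omega
    · obtain ⟨z, hz⟩ := exists_f_one (S := S) (x := a) (y := b) (by rw [hct, hs]; omega)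
      have hza : a ≠ z := by rintro rfl; rw [S.d13] at hz; omega
      have hzb : b ≠ z := by rintro rfl; rw [S.d23] at hz; omega
      exact hcon z hza hzb (by rw [hz, hs]; norm_num)
  obtain ⟨x, hx1, hx2, hf⟩ := hex
  exact (toggle_tri hs hab hx1 hx2 hf h).has hv

end DataPlacement

namespace DataPlacement
open Finset
set_option linter.unusedVariables false
set_option linter.unusedSimpArgs false
set_option linter.unusedSectionVars false
set_option linter.unnecessarySeqFocus false

/-- pull back along a map -/
def Sys.pull {V W : Type} (e : W → V) (S : Sys V) : Sys W where
  f x y z := S.f (e x) (e y) (e z)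
  zo x y z := S.zo _ _ _
  s12 x y z := S.s12 _ _ _
  s23 x y z := S.s23 _ _ _
  dg x z := S.dg _ _

/-- the empty system -/
def Sys.nil (V : Type) : Sys V where
  f x y z := 0
  zo x y z := by simp
  s12 x y z := rfl
  s23 x y z := rfl
  dg x z := rfl

/-- ingredients of a three-level construction -/
structure Lv (U ι : Type) where
  Q : U → U → U
  g1 : Fin 3 → U → U → Prop
  g2 : Fin 3 → U → U → Prop
  T : U → U → U → Prop
  W : Fin 3 → Sys U
  I : ι → Fin 3 → U → U → Prop
  J : ι → Fin 3 → U → U → Prop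
  K : ι → ι → Fin 3 → U → Prop
  Qs : ∀ x y, Q x y = Q y x
  Js : ∀ c i x y, J c i x y ↔ J c i y x
  Ks : ∀ c d i x, K c d i x ↔ K d c i x

variable {U ι : Type}

/-- blocks on three finite points -/
noncomputable def Lv.l3 (C : Lv U ι) (i j k : Fin 3) (x y z : U) : ℤ :=
  if i = j then
    if j = k then (C.W i).f x y z
    else if k = i + 1 then ind (x ≠ y ∧ C.g1 i (C.Q x y) z) else ind (x ≠ y ∧ C.g2 i (C.Q x y) z)
  else if i = k then
    if j = i + 1 then ind (x ≠ z ∧ C.g1 i (C.Q x z) y) else ind (x ≠ z ∧ C.g2 i (C.Q x z) y)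
  else if j = k then
    if i = j + 1 then ind (y ≠ z ∧ C.g1 j (C.Q y z) x) else ind (y ≠ z ∧ C.g2 j (C.Q y z) x)
  else if i = 0 then
    if j = 1 then ind (C.T x y z) else ind (C.T x z y)
  else if i = 1 then
    if j = 0 then ind (C.T y x z) else ind (C.T z x y)
  else
    if j = 0 then ind (C.T y z x) else ind (C.T z y x)

/-- blocks on two finite points and an infinite one -/
noncomputable def Lv.l2 (C : Lv U ι) (c : ι) (i j : Fin 3) (x y : U) : ℤ :=
  if i = j then ind (x ≠ y ∧ C.J c i x y)
  else if j = i + 1 then ind (C.I c i x y) else ind (C.I c j y x)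

/-- the block indicator -/
noncomputable def Lv.ff (C : Lv U ι) :
    (Fin 3 × U) ⊕ ι → (Fin 3 × U) ⊕ ι → (Fin 3 × U) ⊕ ι → ℤ
  | .inl (i, x), .inl (j, y), .inl (k, z) => C.l3 i j k x y z
  | .inl (i, x), .inl (j, y), .inr c => C.l2 c i j x y
  | .inl (i, x), .inr c, .inl (j, y) => C.l2 c i j x y
  | .inr c, .inl (i, x), .inl (j, y) => C.l2 c i j x y
  | .inl (i, x), .inr c, .inr d => ind (c ≠ d ∧ C.K c d i x)
  | .inr c, .inl (i, x), .inr d => ind (c ≠ d ∧ C.K c d i x)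
  | .inr c, .inr d, .inl (i, x) => ind (c ≠ d ∧ C.K c d i x)
  | .inr _, .inr _, .inr _ => 0

lemma Lv.l3_zo (C : Lv U ι) (i j k : Fin 3) (x y z : U) : C.l3 i j k x y z = 0 ∨ C.l3 i j k x y z = 1 := by
  unfold Lv.l3
  split_ifs <;> first | exact (C.W i).zo _ _ _ | exact ind_zo _

lemma Lv.l3_s12 (C : Lv U ι) (i j k : Fin 3) (x y z : U) : C.l3 i j k x y z = C.l3 j i k y x z := by
  fin_cases i <;> fin_cases j <;> fin_cases k <;>
    simp [Lv.l3, C.Qs y x, (C.W _).s12 y x, ne_comm (a := y) (b := x)]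

lemma Lv.l3_s23 (C : Lv U ι) (i j k : Fin 3) (x y z : U) : C.l3 i j k x y z = C.l3 i k j x z y := by
  fin_cases i <;> fin_cases j <;> fin_cases k <;>
    simp [Lv.l3, C.Qs z y, (C.W _).s23 x z y, ne_comm (a := z) (b := y)]

lemma Lv.l3_dg (C : Lv U ι) (i k : Fin 3) (x z : U) : C.l3 i i k x x z = 0 := by
  simp [Lv.l3, (C.W i).dg, ind]

lemma Lv.l2_s (C : Lv U ι) (c : ι) (i j : Fin 3) (x y : U) : C.l2 c i j x y = C.l2 c j i y x := by
  fin_cases i <;> fin_cases j <;>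
    simp [Lv.l2, C.Js c _ y x, ne_comm (a := y) (b := x)]

lemma Lv.l2_zo (C : Lv U ι) (c : ι) (i j : Fin 3) (x y : U) : C.l2 c i j x y = 0 ∨ C.l2 c i j x y = 1 := by
  unfold Lv.l2
  split_ifs <;> exact ind_zo _

/-- the resulting system -/
noncomputable def Lv.sys (C : Lv U ι) : Sys ((Fin 3 × U) ⊕ ι) where
  f := C.ff
  zo x y z := by
    rcases x with ⟨i, x⟩ | c <;> rcases y with ⟨j, y⟩ | d <;> rcases z with ⟨k, z⟩ | e <;>
      simp only [Lv.ff] <;>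
      first | exact C.l3_zo _ _ _ _ _ _ | exact C.l2_zo _ _ _ _ _ | exact ind_zo _ | simp
  s12 x y z := by
    rcases x with ⟨i, x⟩ | c <;> rcases y with ⟨j, y⟩ | d <;> rcases z with ⟨k, z⟩ | e <;>
      simp only [Lv.ff] <;>
      first | exact C.l3_s12 _ _ _ _ _ _ | exact C.l2_s _ _ _ _ _ |
        (exact ind_congr (by rw [C.Ks, ne_comm])) | simp
  s23 x y z := by
    rcases x with ⟨i, x⟩ | c <;> rcases y with ⟨j, y⟩ | d <;> rcases z with ⟨k, z⟩ | e <;>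
      simp only [Lv.ff] <;>
      first | exact C.l3_s23 _ _ _ _ _ _ | exact C.l2_s _ _ _ _ _ |
        (exact ind_congr (by rw [C.Ks, ne_comm])) | simp
  dg x z := by
    rcases x with ⟨i, x⟩ | c <;> rcases z with ⟨k, z⟩ | e <;>
      simp only [Lv.ff] <;>
      first | exact C.l3_dg _ _ _ _ | simp [Lv.l2, ind]

variable [Fintype U] [Fintype ι]

lemma Lv.cnt_same (C : Lv U ι) (i : Fin 3) {x y : U} (h : x ≠ y) :
    cnt C.sys (.inl (i, x)) (.inl (i, y)) =
      ∑ z, ind (C.g1 i (C.Q x y) z) + ∑ z, ind (C.g2 i (C.Q x y) z) + ∑ z, (C.W i).f x y z +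
      ∑ c, ind (C.J c i x y) := by
  simp only [cnt, Lv.sys, Fintype.sum_sum_type, Fintype.sum_prod_type, Fin.sum_univ_three, Lv.ff]
  fin_cases i <;> simp [Lv.l3, Lv.l2, h] <;> ring

/-- number of transversal blocks through a cross pair -/
noncomputable def Lv.tc (C : Lv U ι) (i : Fin 3) (x z : U) : ℤ :=
  if i = 0 then ∑ w, ind (C.T x z w) else if i = 1 then ∑ w, ind (C.T w x z) else ∑ w, ind (C.T z w x)

lemma sum_ne_bij {Q : U → U} (hQ : Function.Bijective Q) (x : U) (P : U → Prop) :
    ∑ y, ind (x ≠ y ∧ P (Q y)) = ∑ q, ind (P q) - ind (P (Q x)) := by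
  classical
  rw [← hQ.sum_comp (fun q => ind (P q))]
  have : ∀ y, ind (x ≠ y ∧ P (Q y)) = ind (P (Q y)) - ind (y = x) * ind (P (Q x)) := by
    intro y
    by_cases h : y = x
    · subst h; simp [ind]
    · rw [ind_neg h, ind_congr (show (x ≠ y ∧ P (Q y)) ↔ P (Q y) by
        constructor
        · exact fun h => h.2
        · exact fun h' => ⟨fun e => h e.symm, h'⟩)]; ring
  simp only [this, Finset.sum_sub_distrib, ← Finset.sum_mul, sum_ind_eq]
  ring

lemma Lv.cnt_cross (C : Lv U ι) (hQ : ∀ x, Function.Bijective (C.Q x)) (i : Fin 3) (x z : U) :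
    cnt C.sys (.inl (i, x)) (.inl (i + 1, z)) =
      (∑ q, ind (C.g1 i q z) - ind (C.g1 i (C.Q x x) z)) +
      (∑ q, ind (C.g2 (i + 1) q x) - ind (C.g2 (i + 1) (C.Q z z) x)) + C.tc i x z +
      ∑ c, ind (C.I c i x z) := by
  rw [← sum_ne_bij (hQ x) x (fun q => C.g1 i q z), ← sum_ne_bij (hQ z) z (fun q => C.g2 (i + 1) q x)]
  simp only [cnt, Lv.sys, Fintype.sum_sum_type, Fintype.sum_prod_type, Fin.sum_univ_three, Lv.ff]
  fin_cases i <;> simp [Lv.l3, Lv.l2, Lv.tc] <;> ring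

lemma Lv.cnt_inf (C : Lv U ι) (c : ι) (i : Fin 3) (x : U) :
    cnt C.sys (.inr c) (.inl (i, x)) =
      ∑ z, ind (C.I c i x z) + ∑ z, ind (C.I c (i + 2) z x) + ∑ y, ind (x ≠ y ∧ C.J c i x y) +
      ∑ d, ind (c ≠ d ∧ C.K c d i x) := by
  simp only [cnt, Lv.sys, Fintype.sum_sum_type, Fintype.sum_prod_type, Fin.sum_univ_three, Lv.ff]
  fin_cases i <;> simp [Lv.l3, Lv.l2] <;> ring

lemma Lv.cnt_infs (C : Lv U ι) {c d : ι} (h : c ≠ d) :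
    cnt C.sys (.inr c) (.inr d) = ∑ i, ∑ x, ind (C.K c d i x) := by
  simp only [cnt, Lv.sys, Fintype.sum_sum_type, Fintype.sum_prod_type, Lv.ff]
  simp [h]

end DataPlacement

namespace DataPlacement
open Finset
set_option linter.unusedVariables false
set_option linter.unusedSimpArgs false
set_option linter.unusedSectionVars false
set_option linter.unnecessarySeqFocus false

lemma Lv.all {U ι : Type} [Fintype U] [Fintype ι] (C : Lv U ι)
    (g : (Fin 3 × U) ⊕ ι → (Fin 3 × U) ⊕ ι → ℤ) (gs : ∀ x y, g x y = g y x)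
    (h1 : ∀ i x y, x ≠ y → cnt C.sys (.inl (i, x)) (.inl (i, y)) = g (.inl (i, x)) (.inl (i, y)))
    (h2 : ∀ i x z, cnt C.sys (.inl (i, x)) (.inl (i + 1, z)) = g (.inl (i, x)) (.inl (i + 1, z)))
    (h3 : ∀ c i x, cnt C.sys (.inr c) (.inl (i, x)) = g (.inr c) (.inl (i, x)))
    (h4 : ∀ c d, c ≠ d → cnt C.sys (.inr c) (.inr d) = g (.inr c) (.inr d)) :
    ∀ x y, x ≠ y → cnt C.sys x y = g x y := by
  have key : ∀ i j : Fin 3, i = j ∨ j = i + 1 ∨ i = j + 1 := by decide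
  rintro (⟨i, x⟩ | c) (⟨j, y⟩ | d) hne
  · rcases key i j with rfl | rfl | rfl
    · exact h1 _ _ _ (by rintro rfl; exact hne rfl)
    · exact h2 _ _ _
    · rw [cnt_comm, gs]; exact h2 _ _ _
  · rw [cnt_comm, gs]; exact h3 _ _ _
  · exact h3 _ _ _
  · exact h4 _ _ (by rintro rfl; exact hne rfl)

lemma pr_symm {V : Type} (a b x y : V) : pr a b x y = pr a b y x := by
  unfold pr
  rw [ind_congr (show (x = a ∧ y = b) ↔ (y = b ∧ x = a) by tauto),
    ind_congr (show (x = b ∧ y = a) ↔ (y = a ∧ x = b) by tauto)]; ring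

lemma md_symm {V : Type} {τ : V → V} {σ : V → ℤ} (inv : ∀ x, τ (τ x) = x) (sg : ∀ x, σ (τ x) = σ x)
    (x y : V) : ind (y = τ x) * σ x = ind (x = τ y) * σ y := by
  by_cases h : y = τ x
  · subst h; rw [inv, ind_pos rfl, ind_pos rfl, sg]
  · rw [ind_neg h, ind_neg]
    · simp
    · rintro rfl; exact h (inv y).symm

lemma sum_pick {V : Type} [Fintype V] (a : V) (F : V → ℤ) : ∑ z, ind (z = a) * F z = F a := by
  classical
  rw [Finset.sum_eq_single a]
  · rw [ind_pos rfl]; ring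
  · intro b _ hb; rw [ind_neg hb]; ring
  · simp

section grp
variable {G : Type} [AddCommGroup G] [Fintype G]

lemma sum_mem (D : Finset G) : ∑ z, ind (z ∈ D) = (D.card : ℤ) := by
  classical
  rw [sum_ind_card]; simp

lemma sum_sub_l (D : Finset G) (q : G) : ∑ z, ind (z - q ∈ D) = (D.card : ℤ) := by
  rw [← sum_mem D]
  exact Equiv.sum_comp (Equiv.subRight q) (fun z => ind (z ∈ D))

lemma sum_sub_r (D : Finset G) (q : G) : ∑ z, ind (q - z ∈ D) = (D.card : ℤ) := by
  rw [← sum_mem D]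
  exact Equiv.sum_comp (Equiv.subLeft q) (fun z => ind (z ∈ D))

lemma sum_sub_eq_l (s q : G) : ∑ z, ind (z - q = s) = 1 := by
  rw [← sum_ind_eq (s : G)]
  exact Equiv.sum_comp (Equiv.subRight q) (fun z => ind (z = s))

lemma sum_sub_eq_r (s q : G) : ∑ z, ind (q - z = s) = 1 := by
  rw [← sum_ind_eq (s : G)]
  exact Equiv.sum_comp (Equiv.subLeft q) (fun z => ind (z = s))
end grp

lemma exists_half (u : ℕ) (hu : u % 2 = 1) : ∃ h : ZMod u, h * 2 = 1 := by
  refine ⟨((u + 1) / 2 : ℕ), ?_⟩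
  have : ((u + 1) / 2) * 2 = u + 1 := by omega
  have h := congrArg (Nat.cast : ℕ → ZMod u) this
  push_cast at h
  simpa using h

lemma half_bij {u : ℕ} {h : ZMod u} (hh : h * 2 = 1) (x : ZMod u) :
    Function.Bijective (fun y => (x + y) * h) := by
  constructor
  · intro a b hab
    have h1 : (x + a) * h * 2 = (x + b) * h * 2 := by rw [show (x + a) * h = (x + b) * h from hab]
    rw [mul_assoc, mul_assoc, hh, mul_one, mul_one] at h1
    exact add_left_cancel h1
  · intro z
    refine ⟨2 * z - x, ?_⟩
    show (x + (2 * z - x)) * h = z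
    have : (x + (2 * z - x)) * h = z * (h * 2) := by ring
    rw [this, hh, mul_one]

section caseC
variable (u : ℕ) [NeZero u] (hf : ZMod u) (od : Prop) (D D' : Finset (ZMod u)) (j : ℕ)

/-- shifts -/
def shC (u : ℕ) : Fin 3 → ZMod u := ![2, 2, -3]

/-- colours -/
def colC (u : ℕ) (i : Fin 3) (x : ZMod u) : Prop :=
  if i = 0 then x.val % 2 = 0 else if i = 1 then ¬ (x - 2).val % 2 = 0 else (x - 4).val % 2 = 0

/-- the starting points -/
def PC {u : ℕ} (j : ℕ) (x : ZMod u) : Prop := x.val < 2 * j ∧ x.val % 2 = 0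

/-- ingredients, case C -/
noncomputable def LvC : Lv (ZMod u) (Fin 2) where
  Q x y := (x + y) * hf
  g1 i q z := z - q ∈ D ∨ (od ∧ z - q = shC u i)
  g2 i q z := z - q ∈ D'
  T x y z := x = y ∧ y = z ∧ x.val < 2 * j
  W _ := Sys.nil _
  I c i x z := if c = 0 then
      (x - z ∈ D' ∧ ¬ (x = z ∧ x.val < 2 * j)) ∨ (z = x + 1 ∧ PC j x) ∨ (od ∧ z - x = shC u i ∧ colC u i x)
    else (z - x ∈ D ∧ ¬ (z = x + 1 ∧ PC j x)) ∨ (od ∧ z - x = shC u i ∧ ¬ colC u i x)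
  J _ _ _ _ := False
  K _ _ _ x := x.val < 2 * j
  Qs x y := by rw [add_comm]
  Js c i x y := Iff.rfl
  Ks c d i x := Iff.rfl

/-- side conditions, case C -/
structure HypC : Prop where
  hf2 : hf * 2 = 1
  hu : u % 2 = 1
  cardEq : D.card = D'.card
  hj : 2 * j < u
  one : 0 < j → (1 : ZMod u) ∈ D
  zer : 0 < j → (0 : ZMod u) ∈ D'
  neg1 : 0 < j → (-1 : ZMod u) ∉ D'
  shD : od → ∀ i, shC u i ∉ D
  shD' : od → ∀ i, - shC u i ∉ D'
  sh1 : 0 < j → od → ∀ i, shC u i ≠ 1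

variable {u hf od D D' j}

lemma HypC.g1 (H : HypC u hf od D D' j) (i : Fin 3) (q z : ZMod u) :
    ind ((LvC u hf od D D' j).g1 i q z) = ind (z - q ∈ D) + ind od * ind (z - q = shC u i) := by
  show ind (_ ∨ _) = _
  rw [ind_or, ind_and]
  rintro ⟨h1, h2, h3⟩
  rw [h3] at h1; exact H.shD h2 i h1

lemma HypC.I0 (H : HypC u hf od D D' j) (i : Fin 3) (x z : ZMod u) :
    ind ((LvC u hf od D D' j).I 0 i x z) = ind (x - z ∈ D') - ind (z = x) * ind (x.val < 2 * j)
      + ind (z = x + 1) * ind (PC j x) + ind od * (ind (z - x = shC u i) * ind (colC u i x)) := by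
  have h0 : (LvC u hf od D D' j).I 0 i x z = ((x - z ∈ D' ∧ ¬ (x = z ∧ x.val < 2 * j)) ∨ (z = x + 1 ∧ PC j x) ∨
    (od ∧ z - x = shC u i ∧ colC u i x)) := by simp [LvC]
  rw [h0, ind_or, ind_or, ← ind_and, ← ind_and, ← ind_and, ← ind_and]
  · have : ind (x - z ∈ D' ∧ ¬ (x = z ∧ x.val < 2 * j)) = ind (x - z ∈ D') - ind (z = x ∧ x.val < 2 * j) := by
      by_cases h : x = z ∧ x.val < 2 * j
      · have h0 : x - z ∈ D' := by rw [h.1, sub_self]; exact H.zer (by omega)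
        rw [ind_neg (by tauto), ind_pos h0, ind_pos ⟨h.1.symm, h.2⟩]; rfl
      · rw [ind_neg (P := z = x ∧ x.val < 2 * j) (by rintro ⟨e, h'⟩; exact h ⟨e.symm, h'⟩),
          ind_congr (show (x - z ∈ D' ∧ ¬ (x = z ∧ x.val < 2 * j)) ↔ x - z ∈ D' by tauto)]; ring
    rw [this]; ring
  · rintro ⟨⟨h1, h1'⟩, h2, h3, -⟩
    have := H.sh1 (by have := h1'.1; omega) h2 i
    apply this; rw [← h3, h1]; ring
  · rintro ⟨⟨h1, -⟩, ⟨h2, h2'⟩ | ⟨h2, h3, -⟩⟩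
    · apply H.neg1 (by have := h2'.1; omega); rw [h2] at h1; convert h1 using 1; ring
    · apply H.shD' h2 i; rw [← h3]; convert h1 using 1; ring

lemma HypC.I1 (H : HypC u hf od D D' j) (i : Fin 3) (x z : ZMod u) :
    ind ((LvC u hf od D D' j).I 1 i x z) = ind (z - x ∈ D)
      - ind (z = x + 1) * ind (PC j x) + ind od * (ind (z - x = shC u i) * (1 - ind (colC u i x))) := by
  have h0 : (LvC u hf od D D' j).I 1 i x z = ((z - x ∈ D ∧ ¬ (z = x + 1 ∧ PC j x)) ∨
    (od ∧ z - x = shC u i ∧ ¬ colC u i x)) := by simp [LvC]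
  rw [h0, ind_or, ← ind_not, ← ind_and, ← ind_and, ← ind_and]
  · have : ind (z - x ∈ D ∧ ¬ (z = x + 1 ∧ PC j x)) = ind (z - x ∈ D) - ind (z = x + 1 ∧ PC j x) := by
      by_cases h : z = x + 1 ∧ PC j x
      · have h0 : z - x ∈ D := by
          rw [h.1, add_sub_cancel_left]; exact H.one (by have := h.2.1; omega)
        rw [ind_neg (by tauto), ind_pos h0, ind_pos h]; rfl
      · rw [ind_neg h, ind_congr (show (z - x ∈ D ∧ ¬ (z = x + 1 ∧ PC j x)) ↔ z - x ∈ D by tauto)]; ring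
    rw [this]
  · rintro ⟨⟨h1, -⟩, h2, h3, -⟩
    rw [h3] at h1; exact H.shD h2 i h1

lemma HypC.PJ (H : HypC u hf od D D' j) (x : ZMod u) :
    ind (PC j x) + ind (PC j (x - 1)) = ind (x.val < 2 * j) := by
  have hj := H.hj
  have hu := H.hu
  have hlt := ZMod.val_lt x
  by_cases hx : x = 0
  · subst hx
    have h2 : ((0 : ZMod u) - 1).val = u - 1 := by
      rw [zero_sub]
      obtain ⟨n, rfl⟩ : ∃ n, u = n + 1 := ⟨u - 1, by omega⟩
      exact ZMod.val_neg_one n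
    rw [ind_neg (P := PC j (0 - 1)) (by rintro ⟨h, -⟩; omega), add_zero]
    apply ind_congr
    rw [PC, ZMod.val_zero]; omega
  · have hx' : x.val ≠ 0 := by rwa [Ne, ZMod.val_eq_zero]
    have h1 : (x - 1).val = x.val - 1 := by
      by_cases hu1 : u = 1
      · subst hu1; exact absurd (Subsingleton.elim _ _) hx
      · have : Fact (1 < u) := ⟨by omega⟩
        rw [ZMod.val_sub (by rw [ZMod.val_one]; omega), ZMod.val_one]
    rw [← ind_or]
    · apply ind_congr; simp only [PC]; rw [h1]; omega
    · simp only [PC]; rw [h1]; omega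

lemma HypC.col (H : HypC u hf od D D' j) (i : Fin 3) (x : ZMod u) :
    ind (colC u i x) + ind (colC u (i + 2) (x - shC u (i + 2))) = 1 + ind (i = 0 ∧ x = 0) := by
  have hu := H.hu
  fin_cases i
  · have e : x - shC u 2 - 4 = x - 1 := by simp [shC]; ring
    show ind (colC u 0 x) + ind (colC u 2 (x - shC u 2)) = 1 + ind ((0 : Fin 3) = 0 ∧ x = 0)
    simp only [colC, e, if_true]
    rw [if_neg (by decide), if_neg (by decide)]
    by_cases hx : x = 0
    · subst hx
      have h2 : ((0 : ZMod u) - 1).val = u - 1 := by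
        rw [zero_sub]
        obtain ⟨n, rfl⟩ : ∃ n, u = n + 1 := ⟨u - 1, by omega⟩
        exact ZMod.val_neg_one n
      rw [h2, ZMod.val_zero, ind_pos (by omega), ind_pos (by omega), ind_pos (by simp)]
    · have hx' : x.val ≠ 0 := by rwa [Ne, ZMod.val_eq_zero]
      have h1 : (x - 1).val = x.val - 1 := by
        by_cases hu1 : u = 1
        · subst hu1; exact absurd (Subsingleton.elim _ _) hx
        · have : Fact (1 < u) := ⟨by omega⟩
          rw [ZMod.val_sub (by rw [ZMod.val_one]; omega), ZMod.val_one]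
      rw [h1, ← ind_or (by omega), ind_pos (by omega), ind_neg (by tauto)]; ring
  · show ind (colC u 1 x) + ind (colC u 0 (x - shC u 0)) = 1 + ind ((1 : Fin 3) = 0 ∧ x = 0)
    rw [ind_neg (P := (1 : Fin 3) = 0 ∧ x = 0) (by simp)]
    have e : x - shC u 0 = x - 2 := by simp [shC]
    simp only [colC, e, if_true]
    rw [if_neg (by decide), ind_not]; ring
  · show ind (colC u 2 x) + ind (colC u 1 (x - shC u 1)) = 1 + ind ((2 : Fin 3) = 0 ∧ x = 0)
    rw [ind_neg (P := (2 : Fin 3) = 0 ∧ x = 0) (by simp)]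
    have e : x - shC u 1 - 2 = x - 4 := by simp [shC]; ring
    simp only [colC, e]
    rw [if_neg (by decide), if_neg (by decide), if_neg (by decide), if_true, ind_not]; ring

lemma val_count (u : ℕ) [NeZero u] (n : ℕ) (h : n ≤ u) : ∑ x : ZMod u, ind (x.val < n) = n := by
  classical
  rw [sum_ind_card]
  have : (univ.filter fun x : ZMod u => x.val < n).card = (Finset.range n).card := by
    apply Finset.card_bij (fun x _ => x.val)
    · intro x hx; simpa using hx
    · intro x _ y _ h; exact ZMod.val_injective u h
    · intro m hm
      rw [Finset.mem_range] at hm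
      refine ⟨(m : ZMod u), ?_, ?_⟩
      · rw [mem_filter, ZMod.val_natCast, Nat.mod_eq_of_lt (by omega)]; exact ⟨mem_univ _, hm⟩
      · rw [ZMod.val_natCast, Nat.mod_eq_of_lt (by omega)]
  rw [this, Finset.card_range]

/-- counts for case C -/
lemma HypC.main (H : HypC u hf od D D' j) : ∀ x y, x ≠ y →
    cnt (LvC u hf od D D' j).sys x y = (2 * D.card + ind od) +
      ((6 * j - (2 * D.card + ind od)) * pr (.inr 0) (.inr 1) x y +
       ind od * (pr (.inl (0, 0)) (.inr 0) x y - pr (.inl (0, 0)) (.inr 1) x y)) := by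
  have hQ : ∀ x, Function.Bijective ((LvC u hf od D D' j).Q x) := fun x => half_bij H.hf2 x
  have hQx : ∀ x, (LvC u hf od D D' j).Q x x = x := by
    intro x
    show (x + x) * hf = x
    rw [show (x + x) * hf = x * (hf * 2) by ring, H.hf2, mul_one]
  have hg2 : ∀ i q z, (LvC u hf od D D' j).g2 i q z = (z - q ∈ D') := fun _ _ _ => rfl
  have hJ : ∀ c i x y, (LvC u hf od D D' j).J c i x y = False := fun _ _ _ _ => rfl
  have hK : ∀ c d i x, (LvC u hf od D D' j).K c d i x = (x.val < 2 * j) := fun _ _ _ _ => rfl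
  have hT : ∀ x y z, (LvC u hf od D D' j).T x y z = (x = y ∧ y = z ∧ x.val < 2 * j) := fun _ _ _ => rfl
  have hW : ∀ i x y z, ((LvC u hf od D D' j).W i).f x y z = 0 := fun _ _ _ _ => rfl
  have hcd : (D'.card : ℤ) = D.card := by exact_mod_cast H.cardEq.symm
  have htc : ∀ i x z, (LvC u hf od D D' j).tc i x z = ind (z = x) * ind (x.val < 2 * j) := by
    intro i x z
    rw [← ind_and]
    simp only [Lv.tc, hT]
    by_cases h : z = x ∧ x.val < 2 * j
    · obtain ⟨rfl, h⟩ := h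
      rw [ind_pos ⟨rfl, h⟩]
      split_ifs
      · rw [← sum_ind_eq' z]; exact Finset.sum_congr rfl fun w _ => ind_congr (by tauto)
      · rw [← sum_ind_eq z]
        exact Finset.sum_congr rfl fun w _ => ind_congr ⟨fun h => h.1, fun h' => by subst h'; exact ⟨rfl, rfl, h⟩⟩
      · rw [← sum_ind_eq z]
        exact Finset.sum_congr rfl fun w _ => ind_congr ⟨fun h => h.1.symm, fun h' => by subst h'; exact ⟨rfl, rfl, h⟩⟩
    · rw [ind_neg h]
      split_ifs
      · exact Finset.sum_eq_zero fun w _ => ind_neg (by rintro ⟨rfl, h1, h2⟩; exact h ⟨rfl, h2⟩)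
      · exact Finset.sum_eq_zero fun w _ => ind_neg (by rintro ⟨rfl, h1, h2⟩; exact h ⟨h1.symm, h2⟩)
      · exact Finset.sum_eq_zero fun w _ => ind_neg (by rintro ⟨rfl, rfl, h2⟩; exact h ⟨rfl, h2⟩)
  apply Lv.all
  · intro x y; simp only [pr_symm _ _ x y]
  · intro i x y hxy
    rw [Lv.cnt_same _ _ hxy]
    simp only [H.g1, hg2, hW, hJ, ind_false, Finset.sum_add_distrib, ← Finset.mul_sum, sum_sub_l, sum_sub_eq_l,
      Finset.sum_const_zero, hcd]
    simp [pr, ind]; ring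
  · intro i x z
    rw [Lv.cnt_cross _ hQ]
    simp only [H.g1, hg2, htc, hQx, Fin.sum_univ_two, H.I0, H.I1, Finset.sum_add_distrib, ← Finset.mul_sum,
      sum_sub_r, sum_sub_eq_r, hcd]
    have : ∀ a b c : (Fin 3 × ZMod u), ∀ d, pr (.inl a) (.inr d) (.inl b : (Fin 3 × ZMod u) ⊕ Fin 2) (.inl c) = 0 := by
      intro a b c d; simp [pr, ind]
    rw [this, this]
    have : ∀ b c : (Fin 3 × ZMod u), pr (.inr 0) (.inr 1) (.inl b : (Fin 3 × ZMod u) ⊕ Fin 2) (.inl c) = 0 := by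
      intro b c; simp [pr, ind]
    rw [this]
    ring
  · intro c i x
    rw [Lv.cnt_inf]
    simp only [hJ, hK, and_false, ind_false, Finset.sum_const_zero, Fin.sum_univ_two]
    have hPJ := H.PJ x
    have hcol := H.col i x
    have e1 : ∀ z : ZMod u, ind (x = z) = ind (z = x) := fun z => ind_congr eq_comm
    have e2 : ∀ z : ZMod u, ind (x = z + 1) = ind (z = x - 1) := fun z => ind_congr (by
      constructor
      · rintro rfl; ring
      · rintro rfl; ring)
    have e2' : ∀ z : ZMod u, ind (z + 1 = x) = ind (z = x - 1) := fun z => by rw [← e2 z]; exact ind_congr eq_comm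
    have e3 : ∀ z : ZMod u, ind (x - z = shC u (i + 2)) = ind (z = x - shC u (i + 2)) := fun z => ind_congr (by
      constructor
      · intro h; rw [← h]; ring
      · rintro rfl; ring)
    fin_cases c
    · simp only [H.I0, Fin.zero_eta, Finset.sum_add_distrib, Finset.sum_sub_distrib, ← Finset.mul_sum, e1, e2', e3,
        ← Finset.sum_mul, sum_pick, sum_sub_l, sum_sub_r, sum_sub_eq_l, sum_ind_eq, hcd]
      rw [ind_neg (P := (0 : Fin 2) ≠ 0 ∧ x.val < 2 * j) (by simp), ind_congr (show ((0 : Fin 2) ≠ 1 ∧ x.val < 2 * j) ↔ x.val < 2 * j by simp)]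
      have p1 : pr (.inl (0, 0)) (.inr 0) (.inr 0 : (Fin 3 × ZMod u) ⊕ Fin 2) (.inl (i, x)) = ind (i = 0 ∧ x = 0) := by
        simp [pr, ind]
      have p2 : pr (.inl (0, 0)) (.inr 1) (.inr 0 : (Fin 3 × ZMod u) ⊕ Fin 2) (.inl (i, x)) = 0 := by
        simp [pr, ind]
      have p3 : pr (.inr 0) (.inr 1) (.inr 0 : (Fin 3 × ZMod u) ⊕ Fin 2) (.inl (i, x)) = 0 := by
        simp [pr, ind]
      rw [p1, p2, p3]
      linear_combination hPJ + ind od * hcol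
    · simp only [H.I1, Fin.mk_one, Finset.sum_add_distrib, Finset.sum_sub_distrib, ← Finset.mul_sum, e1, e2', e3,
        ← Finset.sum_mul, sum_pick, sum_sub_l, sum_sub_r, sum_sub_eq_l, sum_ind_eq, hcd]
      rw [ind_neg (P := (1 : Fin 2) ≠ 1 ∧ x.val < 2 * j) (by simp), ind_congr (show ((1 : Fin 2) ≠ 0 ∧ x.val < 2 * j) ↔ x.val < 2 * j by simp)]
      have p1 : pr (.inl (0, 0)) (.inr 1) (.inr 1 : (Fin 3 × ZMod u) ⊕ Fin 2) (.inl (i, x)) = ind (i = 0 ∧ x = 0) := by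
        simp [pr, ind]
      have p2 : pr (.inl (0, 0)) (.inr 0) (.inr 1 : (Fin 3 × ZMod u) ⊕ Fin 2) (.inl (i, x)) = 0 := by
        simp [pr, ind]
      have p3 : pr (.inr 0) (.inr 1) (.inr 1 : (Fin 3 × ZMod u) ⊕ Fin 2) (.inl (i, x)) = 0 := by
        simp [pr, ind]
      rw [p1, p2, p3]
      linear_combination -hPJ - ind od * hcol
  · have hc := val_count u (2 * j) (by have := H.hj; omega)
    intro c d h
    rw [Lv.cnt_infs _ h]
    simp only [hK, hc]
    have p1 : ∀ d', pr (.inl (0, 0)) (.inr d') (.inr c : (Fin 3 × ZMod u) ⊕ Fin 2) (.inr d) = 0 := by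
      intro d'; simp [pr, ind]
    have p2 : pr (.inr 0) (.inr 1) (.inr c : (Fin 3 × ZMod u) ⊕ Fin 2) (.inr d) = 1 := by
      fin_cases c <;> fin_cases d <;> simp [pr, ind] at h ⊢
    rw [p1, p1, p2]
    simp; ring

end caseC
end DataPlacement

namespace DataPlacement
open Finset
set_option linter.unusedVariables false
set_option linter.unusedSimpArgs false
set_option linter.unusedSectionVars false
set_option linter.unnecessarySeqFocus false

lemma pick_set {G : Type} [Fintype G] [DecidableEq G] (h : ℕ) (p : G) (N : Finset G)
    (hp : 0 < h → p ∉ N) (hc : 0 < h → h + N.card ≤ Fintype.card G) :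
    ∃ D : Finset G, D.card = h ∧ (0 < h → p ∈ D) ∧ ∀ n ∈ N, n ∉ D := by
  rcases Nat.eq_zero_or_pos h with rfl | h0
  · exact ⟨∅, by simp⟩
  · obtain ⟨D, h1, h2, h3⟩ := Finset.exists_subsuperset_card_eq (s := {p}) (t := Nᶜ) (n := h)
      (by simpa using hp h0) (by rw [card_singleton]; exact h0) (by
        rw [Finset.card_compl]; have := hc h0; omega)
    refine ⟨D, h3, fun _ => h1 (by simp), fun n hn hD => ?_⟩
    have := h2 hD
    rw [mem_compl] at this; exact this hn

lemma zmod_ne {u : ℕ} (n : ℕ) (h0 : 0 < n) (h1 : n < u) : (n : ZMod u) ≠ 0 := by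
  rw [Ne, ZMod.natCast_eq_zero_iff]
  intro h; have := Nat.le_of_dvd h0 h; omega

lemma pr_swap {V : Type} (a b x y : V) : pr a b x y = pr b a x y := by
  unfold pr; ring

lemma card_lv (u r : ℕ) [NeZero u] : Fintype.card ((Fin 3 × ZMod u) ⊕ Fin r) = 3 * u + r := by
  simp [ZMod.card]

lemma caseC_even {u h : ℕ} (hu : u % 2 = 1) (h1 : h + 1 ≤ u) (j : ℕ) (s : ℤ) (hs : s = 1 ∨ s = -1)
    (hj : (6 * j : ℤ) = 2 * h - 2 * s) (h0 : 0 < h) : HasTri (3 * u + 2) (2 * h) s := by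
  classical
  have : NeZero u := ⟨by omega⟩
  obtain ⟨hf, hf2⟩ := exists_half u hu
  obtain ⟨D, hD, hD1, -⟩ := pick_set (G := ZMod u) h 1 ∅ (by simp) (by simp [ZMod.card]; omega)
  obtain ⟨D', hD', hD'1, hD'2⟩ := pick_set (G := ZMod u) h 0 {-1} (by
      intro _ h; rw [mem_singleton] at h
      have := zmod_ne (u := u) 1 (by omega) (by omega)
      apply this; push_cast; linear_combination h) (by simp [ZMod.card]; omega)
  have H : HypC u hf False D D' j :=
    { hf2 := hf2, hu := hu, cardEq := by rw [hD, hD'], hj := by omega, one := fun _ => hD1 h0,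
      zer := fun _ => hD'1 h0, neg1 := fun _ => hD'2 _ (by simp), shD := fun h => h.elim,
      shD' := fun h => h.elim, sh1 := fun _ h => h.elim }
  have hm := H.main
  refine tri_of_single (card_lv u 2) (S := (LvC u hf False D D' j).sys) (a := .inr 0) (b := .inr 1) hs (by simp)
    (fun x y hxy => ?_) (by omega) (by push_cast; omega)
  rw [hm x y hxy, hD, ind_false]
  linear_combination (pr (Sum.inr 0) (Sum.inr 1) x y) * hj

lemma caseC_odd {u h : ℕ} (hu : u % 2 = 1) (h1 : 2 * h + 1 ≤ u) (j : ℕ) (s : ℤ) (hs : s = 1 ∨ s = -1)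
    (hj : (6 * j : ℤ) = 2 * h + 1 + s) : HasTri (3 * u + 2) (2 * h + 1) s := by
  classical
  have : NeZero u := ⟨by omega⟩
  obtain ⟨hf, hf2⟩ := exists_half u hu
  have z1 : 0 < h → (1 : ZMod u) ≠ 0 := fun h0 => by
    have := zmod_ne (u := u) 1 (by omega) (by omega); simpa using this
  have z2 : 0 < h → (2 : ZMod u) ≠ 0 := fun h0 => by
    have := zmod_ne (u := u) 2 (by omega) (by omega); simpa using this
  have z3 : 0 < h → (3 : ZMod u) ≠ 0 := fun h0 => by
    have := zmod_ne (u := u) 3 (by omega) (by omega); simpa using this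
  have z4 : 0 < h → (4 : ZMod u) ≠ 0 := fun h0 => by
    have := zmod_ne (u := u) 4 (by omega) (by omega); simpa using this
  obtain ⟨D, hD, hD1, hD2⟩ := pick_set (G := ZMod u) h 1 {2, -3} (by
      intro h0 h; rw [mem_insert, mem_singleton] at h
      rcases h with h | h
      · exact z1 h0 (by linear_combination -h)
      · exact z4 h0 (by linear_combination h))
    (by intro h0; have := Finset.card_le_two (a := (2 : ZMod u)) (b := -3); rw [ZMod.card]; omega)
  obtain ⟨D', hD', hD'1, hD'2⟩ := pick_set (G := ZMod u) h 0 {-2, 3, -1} (by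
      intro h0 h; rw [mem_insert, mem_insert, mem_singleton] at h
      rcases h with h | h | h
      · exact z2 h0 (by linear_combination h)
      · exact z3 h0 (by linear_combination -h)
      · exact z1 h0 (by linear_combination h))
    (by intro h0; have := Finset.card_le_three (a := (-2 : ZMod u)) (b := 3) (c := -1); rw [ZMod.card]; omega)
  have H : HypC u hf True D D' j :=
    { hf2 := hf2, hu := hu, cardEq := by rw [hD, hD'], hj := by omega,
      one := fun h0 => hD1 (by omega),
      zer := fun h0 => hD'1 (by omega), neg1 := fun _ => hD'2 _ (by simp)
      shD := fun _ i => hD2 _ (by fin_cases i <;> simp [shC])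
      shD' := fun _ i => hD'2 _ (by fin_cases i <;> simp [shC])
      sh1 := fun h0 _ i h' => by
        have h0' : 0 < h := by omega
        fin_cases i
        · exact z1 h0' (by simp [shC] at h'; linear_combination h')
        · exact z1 h0' (by simp [shC] at h'; linear_combination h')
        · exact z4 h0' (by simp [shC] at h'; linear_combination -h') }
  have hm := H.main
  rcases hs with rfl | rfl
  · have : IsTri (LvC u hf True D D' j).sys (2 * h + 1) (.inr 0) (.inr 1) (.inl (0, 0)) 1 :=
      ⟨by simp, by simp, by simp, by simp, fun x y hxy => by
        rw [hm x y hxy, hD, ind_true, pr_swap (.inr 0) (.inl (0, 0)) x y, pr_swap (.inr 1) (.inl (0, 0)) x y]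
        linear_combination (pr (Sum.inr 0) (Sum.inr 1) x y) * hj⟩
    exact this.has (card_lv u 2)
  · have : IsTri (LvC u hf True D D' j).sys (2 * h + 1) (.inr 1) (.inr 0) (.inl (0, 0)) (-1) :=
      ⟨by simp, by simp, by simp, by simp, fun x y hxy => by
        rw [hm x y hxy, hD, ind_true, pr_swap (.inr 0) (.inl (0, 0)) x y, pr_swap (.inr 1) (.inl (0, 0)) x y,
          pr_swap (.inr 1) (.inr 0) x y]
        linear_combination (pr (Sum.inr 0) (Sum.inr 1) x y) * hj⟩
    exact this.has (card_lv u 2)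

/-- sign for condition C1 -/
lemma caseC_low {u l : ℕ} (hu : u % 2 = 1) (s : ℤ) (hl0 : 0 < l)
    (hl : (l % 2 = 0 ∧ l + 2 ≤ 2 * u) ∨ (l % 2 = 1 ∧ l ≤ u))
    (hs : (l % 3 = 1 ∧ s = -1) ∨ (l % 3 = 2 ∧ s = 1)) : HasTri (3 * u + 2) l s := by
  rcases hl with ⟨h2, hl⟩ | ⟨h2, hl⟩
  · obtain ⟨h, rfl⟩ : ∃ h, l = 2 * h := ⟨l / 2, by omega⟩
    have := caseC_even (h := h) hu (by omega) ((2 * (h : ℤ) - 2 * s) / 6).toNat s (by omega) (by omega) (by omega)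
    simpa using this
  · obtain ⟨h, rfl⟩ : ∃ h, l = 2 * h + 1 := ⟨l / 2, by omega⟩
    have := caseC_odd (h := h) hu (by omega) ((2 * (h : ℤ) + 1 + s) / 6).toNat s (by omega) (by omega)
    simpa using this

lemma claimC {u l : ℕ} (hu : u % 2 = 1) (s : ℤ) (hl0 : 0 < l) (hl : l + 1 ≤ 3 * u)
    (hs : (l % 3 = 1 ∧ s = -1) ∨ (l % 3 = 2 ∧ s = 1)) : HasTri (3 * u + 2) l s := by
  by_cases h : (l % 2 = 0 ∧ l + 2 ≤ 2 * u) ∨ (l % 2 = 1 ∧ l ≤ u)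
  · exact caseC_low hu s hl0 h hs
  · have := (caseC_low (u := u) (l := 3 * u - l) hu (-s) (by omega) (by omega) (by omega)).compl
    rw [neg_neg] at this
    convert this using 1
    push_cast [show l ≤ 3 * u by omega]; ring
end DataPlacement

namespace DataPlacement
open Finset
set_option linter.unusedVariables false
set_option linter.unusedSimpArgs false
set_option linter.unusedSectionVars false
set_option linter.unnecessarySeqFocus false

section caseB
/-- twisting -/
def phB {u : ℕ} (i : Fin 3) (z : ZMod u) : ZMod u := if i = 2 then -z else z
/-- differences of the second kind -/
def eB {u : ℕ} (i : Fin 3) (d : ZMod u) : ZMod u := if i = 0 then d * 2 else -d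
/-- diagonal choice -/
def chB (i : Fin 3) (t : Fin 4) : Prop := (t = 3 ∧ i = 1) ∨ (t = 1 ∧ i = 2) ∨ ((t = 0 ∨ t = 2) ∧ i ≠ 1)

variable (u : ℕ) [NeZero u] (hf : ZMod u) (D : Finset (ZMod u)) (kd : ZMod u → Fin 4)

/-- ingredients, case B -/
noncomputable def LvB : Lv (ZMod u) (Fin 1) where
  Q x y := (x + y) * hf
  g1 i q z := phB i z - q ∈ D ∨ phB i z = q
  g2 i q z := ∃ d ∈ D, z - q = eB i d
  T x y z := (y - x ∈ D ∧ z - y = y - x) ∨ (x = y ∧ y = z ∧ kd x = 1)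
  W _ := Sys.nil _
  I c i x z := phB i z - x ∈ D ∨ (phB i z = x ∧ chB i (kd x))
  J c i x y := i = 1 ∧ y = -x ∧ kd x = 1 ∧ kd y = 1
  K _ _ _ x := False
  Qs x y := by rw [add_comm]
  Js c i x y := by
    constructor
    · rintro ⟨h1, rfl, h3, h4⟩; exact ⟨h1, by ring, h4, h3⟩
    · rintro ⟨h1, rfl, h3, h4⟩; exact ⟨h1, by ring, h4, h3⟩
  Ks c d i x := Iff.rfl

/-- side conditions, case B -/
structure HypB : Prop where
  hf2 : hf * 2 = 1
  hD : (0 : ZMod u) ∉ D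
  k0 : ∀ x, kd x = 0 ↔ x = 0
  kn : ∀ x, kd (-x) = ![0, 1, 3, 2] (kd x)

variable {u hf D kd}

/-- partner -/
noncomputable def tauB (kd : ZMod u → Fin 4) : (Fin 3 × ZMod u) ⊕ Fin 1 → (Fin 3 × ZMod u) ⊕ Fin 1
  | .inr _ => .inl (0, 0)
  | .inl (i, x) => if kd x = 0 ∧ i = 0 then .inr 0 else
      .inl (![![0, 2, 1], ![2, 1, 0], ![2, 2, 1], ![1, 0, 0]] (kd x) i,
        if (kd x = 1 ∧ i = 1) ∨ (kd x = 2 ∧ i = 0) ∨ (kd x = 3 ∧ i = 2) then -x else x)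
/-- sign -/
noncomputable def sgB (kd : ZMod u → Fin 4) : (Fin 3 × ZMod u) ⊕ Fin 1 → ℤ
  | .inr _ => 1
  | .inl (i, x) => if (kd x = 0 ∧ i = 0) ∨ kd x = 1 then 1 else -1

lemma phB_inj {i : Fin 3} {x z : ZMod u} : phB i z = x ↔ z = phB i x := by
  unfold phB
  split_ifs
  · constructor
    · rintro rfl; ring
    · rintro rfl; ring
  · exact Iff.rfl

lemma HypB.sumph (H : HypB u hf D kd) (i : Fin 3) (q : ZMod u) : ∑ z, ind (phB i z - q ∈ D) = (D.card : ℤ) := by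
  unfold phB
  split_ifs
  · rw [← sum_sub_l D q]
    exact Equiv.sum_comp (Equiv.neg (ZMod u)) (fun z => ind (z - q ∈ D))
  · exact sum_sub_l D q

lemma HypB.sumpe (H : HypB u hf D kd) (i : Fin 3) (q : ZMod u) : ∑ z, ind (phB i z = q) = (1 : ℤ) := by
  simp only [phB_inj, sum_ind_eq]

lemma HypB.g2e (H : HypB u hf D kd) (i : Fin 3) (z q : ZMod u) : ((LvB u hf D kd).g2 i q z) ↔ 
    ((z - q) * (if i = 0 then hf else -1) ∈ D) := by
  show (∃ d ∈ D, z - q = eB i d) ↔ _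
  unfold eB
  have := H.hf2
  split_ifs
  · constructor
    · rintro ⟨d, hd, h⟩; rw [h, mul_assoc, mul_comm 2, this, mul_one]; exact hd
    · intro h; exact ⟨_, h, by linear_combination (- (z - q)) * this⟩
  · constructor
    · rintro ⟨d, hd, h⟩; rw [h]; simpa using hd
    · intro h; exact ⟨_, h, by ring⟩

lemma sum_bij_mem {G : Type} [Fintype G] (D : Finset G) (F : G → G) (hF : Function.Bijective F) :
    ∑ z, ind (F z ∈ D) = (D.card : ℤ) := by
  classical
  have : ∑ z, ind (z ∈ D) = (D.card : ℤ) := by rw [sum_ind_card]; simp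
  rw [← this]
  exact Equiv.sum_comp (Equiv.ofBijective F hF) (fun z => ind (z ∈ D))

lemma HypB.unit (H : HypB u hf D kd) (i : Fin 3) : Function.Bijective (fun x : ZMod u => x * (if i = 0 then hf else -1)) := by
  have := H.hf2
  rw [Function.bijective_iff_has_inverse]
  refine ⟨fun x => x * (if i = 0 then 2 else -1), ?_, ?_⟩
  · intro x; dsimp only; split_ifs
    · rw [mul_assoc, this, mul_one]
    · ring
  · intro x; dsimp only; split_ifs
    · rw [mul_assoc, mul_comm 2, this, mul_one]
    · ring

lemma HypB.sg2 (H : HypB u hf D kd) (i : Fin 3) (q : ZMod u) :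
    ∑ z, ind ((LvB u hf D kd).g2 i q z) = (D.card : ℤ) := by
  simp only [H.g2e]
  exact sum_bij_mem D (fun z => (z - q) * (if i = 0 then hf else -1)) ((H.unit i).comp (Equiv.subRight q).bijective)

lemma HypB.sg2' (H : HypB u hf D kd) (i : Fin 3) (z : ZMod u) :
    ∑ q, ind ((LvB u hf D kd).g2 i q z) = (D.card : ℤ) := by
  simp only [H.g2e]
  exact sum_bij_mem D (fun q => (z - q) * (if i = 0 then hf else -1)) ((H.unit i).comp (Equiv.subLeft z).bijective)

lemma HypB.g1e (H : HypB u hf D kd) (i : Fin 3) (q z : ZMod u) :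
    ind ((LvB u hf D kd).g1 i q z) = ind (phB i z - q ∈ D) + ind (phB i z = q) := by
  show ind (_ ∨ _) = _
  rw [ind_or]
  rintro ⟨h1, h2⟩
  rw [h2, sub_self] at h1; exact H.hD h1

lemma HypB.Ie (H : HypB u hf D kd) (c i) (x z : ZMod u) :
    ind ((LvB u hf D kd).I c i x z) = ind (phB i z - x ∈ D) + ind (phB i z = x) * ind (chB i (kd x)) := by
  show ind (_ ∨ _) = _
  rw [ind_or, ind_and]
  rintro ⟨h1, h2, -⟩
  rw [h2, sub_self] at h1; exact H.hD h1

lemma HypB.Te (H : HypB u hf D kd) (x y z : ZMod u) :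
    ind ((LvB u hf D kd).T x y z) = ind (y - x ∈ D ∧ z - y = y - x) + ind (x = y ∧ y = z ∧ kd x = 1) := by
  show ind (_ ∨ _) = _
  rw [ind_or]
  rintro ⟨⟨h1, -⟩, h2, -⟩
  rw [h2, sub_self] at h1; exact H.hD h1

lemma HypB.tce (H : HypB u hf D kd) (i : Fin 3) (x z : ZMod u) :
    (LvB u hf D kd).tc i x z = ind ((LvB u hf D kd).g2 (i + 1) z x) + ind (z = x) * ind (kd x = 1) := by
  have hf2 := H.hf2
  simp only [Lv.tc, H.Te, Finset.sum_add_distrib, H.g2e]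
  fin_cases i
  · simp only [Fin.zero_eta, if_true]
    congr 1
    · rw [← sum_pick (z + (z - x)) (fun _ => ind ((x - z) * (if (0 + 1 : Fin 3) = 0 then hf else -1) ∈ D))]
      refine Finset.sum_congr rfl fun w _ => ?_
      rw [← ind_and]; apply ind_congr
      rw [if_neg (by decide), show (x - z) * -1 = z - x by ring, and_comm, sub_eq_iff_eq_add']
    · rw [← sum_pick x (fun _ => ind (z = x) * ind (kd x = 1))]
      refine Finset.sum_congr rfl fun w _ => ?_
      rw [← ind_and, ← ind_and]; apply ind_congr
      constructor
      · rintro ⟨rfl, rfl, h⟩; exact ⟨rfl, rfl, h⟩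
      · rintro ⟨rfl, rfl, h⟩; exact ⟨rfl, rfl, h⟩
  · simp only [Fin.mk_one, if_neg (show ¬ (1 : Fin 3) = 0 by decide), if_true]
    congr 1
    · rw [← sum_pick (x - (z - x)) (fun _ => ind ((x - z) * (if (1 + 1 : Fin 3) = 0 then hf else -1) ∈ D))]
      refine Finset.sum_congr rfl fun w _ => ?_
      rw [← ind_and]; apply ind_congr
      rw [if_neg (by decide), show (x - z) * -1 = z - x by ring]
      constructor
      · rintro ⟨h1, h2⟩; exact ⟨by rw [h2]; ring, by rwa [h2]⟩
      · rintro ⟨rfl, h⟩; have : x - (x - (z - x)) = z - x := by ring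
        rw [this]; exact ⟨h, rfl⟩
    · rw [← sum_pick x (fun _ => ind (z = x) * ind (kd x = 1))]
      refine Finset.sum_congr rfl fun w _ => ?_
      rw [← ind_and, ← ind_and]; apply ind_congr
      constructor
      · rintro ⟨rfl, rfl, h⟩; exact ⟨rfl, rfl, h⟩
      · rintro ⟨rfl, rfl, h⟩; exact ⟨rfl, rfl, h⟩
  · have e : (⟨2, by omega⟩ : Fin 3) = 2 := rfl
    simp only [e, if_neg (show ¬ (2 : Fin 3) = 0 by decide), if_neg (show ¬ (2 : Fin 3) = 1 by decide)]
    congr 1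
    · rw [← sum_pick ((x + z) * hf) (fun _ => ind ((x - z) * (if (2 + 1 : Fin 3) = 0 then hf else -1) ∈ D))]
      refine Finset.sum_congr rfl fun w _ => ?_
      rw [← ind_and]; apply ind_congr
      rw [if_pos (by decide)]
      have e1 : (x + z) * hf - z = (x - z) * hf := by linear_combination z * hf2
      constructor
      · rintro ⟨h1, h2⟩
        have : w = (x + z) * hf := by linear_combination (-w) * hf2 - hf * h2
        refine ⟨this, ?_⟩; rw [← e1, ← this]; exact h1
      · rintro ⟨rfl, h⟩
        rw [e1]; refine ⟨h, ?_⟩; linear_combination (-x) * hf2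
    · rw [← sum_pick x (fun _ => ind (z = x) * ind (kd x = 1))]
      refine Finset.sum_congr rfl fun w _ => ?_
      rw [← ind_and, ← ind_and]; apply ind_congr
      constructor
      · rintro ⟨rfl, rfl, h⟩; exact ⟨rfl, rfl, h⟩
      · rintro ⟨rfl, rfl, h⟩; exact ⟨rfl, rfl, h⟩

lemma HypB.neg_ne (H : HypB u hf D kd) (x : ZMod u) (hx : kd x = 1) : -x ≠ x := by
  intro h
  have : x = 0 := by linear_combination (-x) * H.hf2 - hf * h
  rw [← H.k0, hx] at this; exact absurd this (by decide)

lemma HypB.md (H : HypB u hf D kd) : IsMD (LvB u hf D kd).sys (2 * D.card + 1) (tauB kd) (sgB kd) := by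
  have hQ : ∀ x, Function.Bijective ((LvB u hf D kd).Q x) := fun x => half_bij H.hf2 x
  have hQx : ∀ x, (LvB u hf D kd).Q x x = x := by
    intro x
    show (x + x) * hf = x
    rw [show (x + x) * hf = x * (hf * 2) by ring, H.hf2, mul_one]
  have hJ : ∀ c i x y, (LvB u hf D kd).J c i x y = (i = 1 ∧ y = -x ∧ kd x = 1 ∧ kd y = 1) := fun _ _ _ _ => rfl
  have hK : ∀ c d i x, (LvB u hf D kd).K c d i x = False := fun _ _ _ _ => rfl
  have hW : ∀ i x y z, ((LvB u hf D kd).W i).f x y z = 0 := fun _ _ _ _ => rfl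
  have inv : ∀ x, tauB kd (tauB kd x) = x := by
    rintro (⟨i, x⟩ | c)
    · have hkn := H.kn x
      have h0 := H.k0 x
      generalize hk : kd x = t at *
      fin_cases t <;> fin_cases i <;> simp [tauB, hk, hkn, eq_comm] at h0 ⊢ <;> exact h0
    · have : kd 0 = 0 := by rw [H.k0]
      simp [tauB, this]; omega
  have sg : ∀ x, sgB kd (tauB kd x) = sgB kd x := by
    rintro (⟨i, x⟩ | c)
    · have hkn := H.kn x
      generalize hk : kd x = t at *
      fin_cases t <;> fin_cases i <;> simp [tauB, sgB, hk, hkn]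
    · have : kd 0 = 0 := by rw [H.k0]
      simp [tauB, sgB, this]
  refine ⟨inv, ?_, sg, ?_, ?_⟩
  · rintro (⟨i, x⟩ | c)
    · have hkn := H.kn x
      have hne := H.neg_ne x
      generalize hk : kd x = t at *
      fin_cases t <;> fin_cases i <;> simp [tauB, hk] at hne ⊢ <;> exact hne
    · simp [tauB]
  · rintro (⟨i, x⟩ | c)
    · simp only [sgB]; split_ifs <;> simp
    · simp [sgB]
  · apply Lv.all
    · intro x y; rw [md_symm inv sg]
    · intro i x y hxy
      rw [Lv.cnt_same _ _ hxy]
      simp only [H.g1e, H.sg2, hW, hJ, Finset.sum_add_distrib, H.sumph, H.sumpe, Finset.sum_const_zero, Fin.sum_univ_one]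
      have hkn := H.kn x
      have hk0 := H.k0 x
      generalize hk : kd x = t at *
      fin_cases t <;> fin_cases i <;> simp [tauB, sgB, hk, ind] 
      all_goals first
        | ring1
        | (by_cases h : y = -x
           · simp [h, hkn]; ring
           · simp [h]; ring)
    · intro i x z
      rw [Lv.cnt_cross _ hQ]
      simp only [H.g1e, H.sg2', H.tce, hQx, Fin.sum_univ_one, H.Ie, Finset.sum_add_distrib, sum_sub_r, sum_ind_eq']
      simp only [phB_inj]
      have hkn := H.kn x
      have hk0 := H.k0 x
      have : ind (z = phB i x) * ind (chB i (kd x)) + ind (z = x) * ind (kd x = 1) - ind (z = phB i x) = 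
         ind ((Sum.inl (i + 1, z) : (Fin 3 × ZMod u) ⊕ Fin 1) = tauB kd (.inl (i, x))) * sgB kd (.inl (i, x)) := by
        generalize hk : kd x = t at *
        fin_cases t <;> fin_cases i <;> simp [tauB, sgB, hk, ind, phB, chB] at hk0 ⊢
        all_goals ring_nf
      rw [← this]; ring
    · intro c i x
      rw [Lv.cnt_inf]
      have e : ∀ z, ind (phB (i + 2) x = z) = ind (z = phB (i + 2) x) := fun z => ind_congr eq_comm
      have eJ : ∑ y, ind (x ≠ y ∧ (LvB u hf D kd).J c i x y) = ind (i = 1 ∧ kd x = 1) := by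
        rw [← sum_pick (-x) (fun _ => ind (i = 1 ∧ kd x = 1))]
        refine Finset.sum_congr rfl fun y _ => ?_
        rw [← ind_and, hJ]; apply ind_congr
        constructor
        · rintro ⟨-, h1, h2, h3, -⟩; exact ⟨h2, h1, h3⟩
        · rintro ⟨rfl, h1, h3⟩
          exact ⟨(H.neg_ne x h3).symm, h1, rfl, h3, by rw [H.kn, h3]; rfl⟩
      rw [eJ]
      simp only [hK, and_false, ind_false, Finset.sum_const_zero, H.Ie, Finset.sum_add_distrib, H.sumph, sum_sub_r, e,
        sum_pick]
      simp only [phB_inj, sum_pick]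
      have hkn := H.kn x
      have hk0 := H.k0 x
      obtain rfl : c = 0 := Subsingleton.elim _ _
      generalize hk : kd x = t at *
      fin_cases t <;> fin_cases i <;> simp [tauB, sgB, hk, ind, phB, chB, hkn] at hk0 ⊢
      all_goals try simp [hk0]
      all_goals ring
    · intro c d h; exact absurd (Subsingleton.elim c d) h

lemma HypB.tot (H : HypB u hf D kd) (j : ℕ) (hj : ∑ x, ind (kd x = 1) = 2 * j) :
    totDef (LvB u hf D kd).sys (2 * D.card + 1) = 12 * j - 3 * u + 3 := by
  rw [H.md.tot]
  have h0 : ∑ x, ind (kd x = 0) = 1 := by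
    simp only [H.k0]; exact sum_ind_eq 0
  have h1 : ∀ i x, sgB kd (.inl (i, x)) = -1 + 2 * ind (kd x = 1) + 2 * (ind (i = 0) * ind (kd x = 0)) := by
    intro i x
    generalize hk : kd x = t at *
    fin_cases t <;> fin_cases i <;> simp [sgB, hk, ind]
  have h2 : ∀ c, sgB kd (.inr c) = 1 := fun _ => rfl
  simp only [Fintype.sum_sum_type, Fintype.sum_prod_type, h1, h2, Finset.sum_add_distrib, ← Finset.mul_sum, hj, h0,
    Fin.sum_univ_three]
  simp [ind, ZMod.card]
  ring

lemma HypB.star (H : HypB u hf D kd) (x : ZMod u) (hx : kd x = 2) {v : ℕ} (hv : v = 3 * u + 1) :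
    HasStar v (2 * D.card + 1) (totDef (LvB u hf D kd).sys (2 * D.card + 1) + 6) := by
  have ht : tauB kd (.inl (1, x)) = .inl (2, x) := by simp [tauB, hx]
  have hf0 : (LvB u hf D kd).sys.f (.inl (1, x)) (tauB kd (.inl (1, x))) (.inl (0, x)) = 0 := by
    rw [ht]
    show ind ((x - x ∈ D ∧ x - x = x - x) ∨ (x = x ∧ x = x ∧ kd x = 1)) = 0
    rw [ind_neg]
    rw [sub_self, hx]
    rintro (⟨h, -⟩ | ⟨-, -, h⟩)
    · exact H.hD h
    · exact absurd h (by decide)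
  have := H.md.toggle_star (p := .inl (1, x)) (r := .inl (0, x)) (s := 1) (Or.inl rfl)
    (by simp [sgB, hx]) (by simp [sgB, hx]) (by simp) (by rw [ht]; simp) (by rw [hf0]; ring)
  refine this.has (by rw [hv, ← card_lv]) ?_
  rw [totDef_toggle, hf0]; ring

/-- kinds -/
def kdB (k j : ℕ) (x : ZMod (2 * k + 1)) : Fin 4 :=
  if x.val = 0 then 0 else if x.val ≤ j ∨ 2 * k + 1 ≤ x.val + j then 1 else if x.val ≤ k then 2 else 3

lemma kdB_sum (k j : ℕ) (h : j ≤ k) : ∑ x, ind (kdB k j x = 1) = 2 * (j : ℤ) := by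
  have h1 : ∀ x, ind (kdB k j x = 1) = ind (x.val < j + 1) - ind (x.val < 1) + 1 - ind (x.val < 2 * k + 1 - j) := by
    intro x
    unfold kdB ind
    split_ifs <;> omega
  simp only [h1, Finset.sum_add_distrib, Finset.sum_sub_distrib]
  rw [val_count _ _ (by omega), val_count _ _ (by omega), val_count _ _ (by omega)]
  simp [ZMod.card]
  omega

lemma kdB_hyp (k j : ℕ) (h : j ≤ k) (hf : ZMod (2 * k + 1)) (hf2 : hf * 2 = 1) (D : Finset (ZMod (2 * k + 1)))
    (hD : 0 ∉ D) : HypB (2 * k + 1) hf D (kdB k j) where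
  hf2 := hf2
  hD := hD
  k0 x := by
    rw [← ZMod.val_eq_zero]
    unfold kdB
    split_ifs <;> simp [*]
  kn x := by
    have hx := ZMod.val_lt x
    have hn : (-x).val = if x = 0 then 0 else 2 * k + 1 - x.val := ZMod.neg_val x
    unfold kdB
    rw [hn]
    simp only [← ZMod.val_eq_zero]
    split_ifs <;> first | rfl | omega

lemma claimB_aux (k μ j : ℕ) (hj : j ≤ k) (hμ : μ ≤ 2 * k) :
    HasMD (6 * k + 4) (2 * μ + 1) (12 * j - 6 * k) ∧
    (j < k → HasStar (6 * k + 4) (2 * μ + 1) (12 * j - 6 * k + 6)) := by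
  classical
  obtain ⟨hf, hf2⟩ := exists_half (2 * k + 1) (by omega)
  obtain ⟨D, hD, -, hD0⟩ := pick_set (G := ZMod (2 * k + 1)) μ 1 {0} (by
      intro h0 h; rw [mem_singleton] at h
      have := zmod_ne (u := 2 * k + 1) 1 (by omega) (by omega)
      apply this; push_cast; exact h) (by simp [ZMod.card]; omega)
  have H := kdB_hyp k j hj hf hf2 D (hD0 0 (by simp))
  have ht := H.tot j (kdB_sum k j hj)
  rw [← hD]
  refine ⟨H.md.has (by rw [card_lv]; ring) (by rw [ht]; push_cast; ring), fun h => ?_⟩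
  have := H.star ((j + 1 : ℕ) : ZMod (2 * k + 1)) (by
    unfold kdB
    rw [ZMod.val_natCast, Nat.mod_eq_of_lt (by omega)]
    rw [if_neg (by omega), if_neg (by omega), if_pos (by omega)]) (v := 6 * k + 4) (by ring)
  rw [ht] at this
  convert this using 1; push_cast; ring
end caseB
end DataPlacement

namespace DataPlacement
open Finset
set_option linter.unusedVariables false
set_option linter.unusedSimpArgs false
set_option linter.unusedSectionVars false
set_option linter.unnecessarySeqFocus false

section sts
variable {V : Type} [Fintype V] [DecidableEq V]

lemma md_of_sts (S : Sys V) (hS : ∀ x y, x ≠ y → cnt S x y = 1) (p : V) {v : ℕ} (hv : Fintype.card V = v + 1) :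
    HasMD v 1 (-v) := by
  have hex : ∀ x : {x // x ≠ p}, ∃ y : {y // y ≠ p}, S.f x p y = 1 := by
    rintro ⟨x, hx⟩
    have h1 : ∑ y, S.f x p y = 1 := hS x p hx
    by_contra! hc
    have : ∑ y, S.f x p y = 0 := Finset.sum_eq_zero fun y _ => by
      by_cases hy : y = p
      · subst hy; exact S.d23 _ _
      · exact (S.zo x p y).resolve_right (hc ⟨y, hy⟩)
    omega
  choose τ hτ using hex
  have hu : ∀ (x y y' : V), x ≠ p → S.f x p y = 1 → S.f x p y' = 1 → y = y' := by
    intro x y y' hx h1 h2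
    by_contra hne
    have h3 : ∑ y, S.f x p y = 1 := hS x p hx
    have h4 : ∑ z ∈ {y, y'}, S.f x p z ≤ ∑ z, S.f x p z :=
      Finset.sum_le_sum_of_subset_of_nonneg (Finset.subset_univ _) fun z _ _ => by
        rcases S.zo x p z with h | h <;> omega
    rw [Finset.sum_pair hne] at h4; omega
  have hsy : ∀ x y, S.f x p y = S.f y p x := fun x y => by
    rw [S.s12 x p y, S.s23 p x y, S.s12 p y x]
  have inv : ∀ x, τ (τ x) = x := fun x => by
    apply Subtype.ext
    apply hu (τ x) _ _ (τ x).2 (hτ _)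
    rw [hsy]; exact hτ x
  have hM : IsMD (S.pull (Subtype.val : {x // x ≠ p} → V)) 1 τ (fun _ => -1) := by
    refine ⟨inv, ?_, fun _ => rfl, fun _ => Or.inr rfl, ?_⟩
    · intro x h
      have := hτ x
      rw [h, S.d13] at this; omega
    · intro x y hxy
      have h1 : ∑ z, S.f x y z = 1 := hS x y (fun h => hxy (Subtype.ext h))
      have h2 : cnt (S.pull (Subtype.val : {x // x ≠ p} → V)) x y = ∑ z : {x // x ≠ p}, S.f x y z := rfl
      rw [← Fintype.sum_subtype_add_sum_subtype (fun z => z ≠ p)] at h1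
      have h3 : ∑ z : {z // ¬ z ≠ p}, S.f x y z = S.f x y p := by
        rw [Finset.sum_eq_single ⟨p, by simp⟩]
        · rintro ⟨z, hz⟩ _ h; simp at hz; subst hz; simp at h
        · simp
      rw [h2]
      have h4 : S.f x y p = ind (y = τ x) := by
        rw [S.s23]
        by_cases h : y = τ x
        · rw [ind_pos h, h]; exact hτ x
        · rw [ind_neg h]
          refine (S.zo x p y).resolve_right fun h' => h ?_
          exact Subtype.ext (hu x _ _ x.2 h' (hτ x))
      rw [h3, h4] at h1; linarith
  have hc : Fintype.card {x // x ≠ p} = v := by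
    rw [Fintype.card_subtype_compl, Fintype.card_subtype_eq, hv]; rfl
  refine hM.has hc ?_
  rw [hM.tot]
  simp [hc]
end sts

/-- a Steiner triple system -/
noncomputable def LvS (u : ℕ) (hf : ZMod u) : Lv (ZMod u) (Fin 0) where
  Q x y := (x + y) * hf
  g1 i q z := z = q
  g2 i q z := False
  T x y z := x = y ∧ y = z
  W _ := Sys.nil _
  I c i x z := False
  J c i x y := False
  K _ _ _ x := False
  Qs x y := by rw [add_comm]
  Js c i x y := Iff.rfl
  Ks c d i x := Iff.rfl

lemma sts_md (k : ℕ) : HasMD (6 * k + 2) 1 (-(6 * k + 2)) := by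
  obtain ⟨hf, hf2⟩ := exists_half (2 * k + 1) (by omega)
  have hQ : ∀ x, Function.Bijective ((LvS (2 * k + 1) hf).Q x) := fun x => half_bij hf2 x
  have hQx : ∀ x, (LvS (2 * k + 1) hf).Q x x = x := by
    intro x
    show (x + x) * hf = x
    rw [show (x + x) * hf = x * (hf * 2) by ring, hf2, mul_one]
  have hg1 : ∀ i q z, (LvS (2 * k + 1) hf).g1 i q z = (z = q) := fun _ _ _ => rfl
  have hg2 : ∀ i q z, (LvS (2 * k + 1) hf).g2 i q z = False := fun _ _ _ => rfl
  have hT : ∀ x y z, (LvS (2 * k + 1) hf).T x y z = (x = y ∧ y = z) := fun _ _ _ => rfl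
  have hW : ∀ i x y z, ((LvS (2 * k + 1) hf).W i).f x y z = 0 := fun _ _ _ _ => rfl
  have := md_of_sts (LvS (2 * k + 1) hf).sys (Lv.all _ (fun _ _ => 1) (fun _ _ => rfl) (fun i x y hxy => by
      rw [Lv.cnt_same _ _ hxy]
      simp [hg1, hg2, hW, ind_false, sum_ind_eq]) (fun i x z => by
      rw [Lv.cnt_cross _ hQ]
      simp only [hg1, hg2, hQx, ind_false, sum_ind_eq', Finset.sum_const_zero, Finset.univ_eq_empty, Finset.sum_empty]
      have : (LvS (2 * k + 1) hf).tc i x z = ind (z = x) := by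
        simp only [Lv.tc, hT]
        have e : ∀ a b c : ZMod (2 * k + 1), ind (a = b ∧ b = c) = ind (b = c) * ind (a = b) := fun a b c => by
          rw [ind_and]; ring
        have e' : ∀ a b : ZMod (2 * k + 1), ind (a = b) = ind (b = a) := fun a b => ind_congr eq_comm
        split_ifs
        · simp only [e, ← Finset.sum_mul, sum_ind_eq']; rw [e' x z]; ring
        · simp only [e, ← Finset.mul_sum, sum_ind_eq]; rw [e' x z]; ring
        · rw [← sum_pick x (fun w => ind (z = w))]
          exact Finset.sum_congr rfl fun w _ => by rw [e]
      rw [this]; ring) (fun c => c.elim0) (fun c => c.elim0)) (.inl (0, 0)) (v := 6 * k + 2) (by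
        rw [card_lv]; ring)
  convert this using 1; push_cast; ring
end DataPlacement

namespace DataPlacement
open Finset
set_option linter.unusedVariables false
set_option linter.unusedSimpArgs false
set_option linter.unusedSectionVars false
set_option linter.unnecessarySeqFocus false

lemma exists_Q (k : ℕ) [NeZero k] : ∃ Q : ZMod k × Bool → ZMod k × Bool → ZMod k × Bool,
    (∀ x y, Q x y = Q y x) ∧ (∀ x, Function.Bijective (Q x)) ∧ ∀ x, Q x x = (x.1, false) := by
  have hk : 0 < k := Nat.pos_of_ne_zero (NeZero.ne k)
  have : NeZero (2 * k) := ⟨by omega⟩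
  let e : ZMod k × Bool → ZMod (2 * k) := fun x => ((x.1.val + k * x.2.toNat : ℕ) : ZMod (2 * k))
  let r : ZMod (2 * k) → ZMod k × Bool := fun t => (((t.val / 2 : ℕ) : ZMod k), decide (t.val % 2 = 1))
  have he0 : ∀ x, (e x).val = x.1.val + k * x.2.toNat := by
    intro x
    show ((x.1.val + k * x.2.toNat : ℕ) : ZMod (2 * k)).val = _
    rw [ZMod.val_natCast, Nat.mod_eq_of_lt]
    have := ZMod.val_lt x.1
    cases x.2 <;> simp <;> omega
  have he : Function.Bijective e := by
    rw [Fintype.bijective_iff_injective_and_card]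
    refine ⟨fun x y h => ?_, by simp [ZMod.card]; ring⟩
    have h' := congrArg ZMod.val h
    rw [he0, he0] at h'
    obtain ⟨a, g⟩ := x
    obtain ⟨b, g'⟩ := y
    have h1 := ZMod.val_lt a
    have h2 := ZMod.val_lt b
    cases g <;> cases g' <;> simp at h' ⊢
    · exact ZMod.val_injective k h'
    · omega
    · omega
    · exact ZMod.val_injective k h'
  have hr : Function.Bijective r := by
    rw [Fintype.bijective_iff_injective_and_card]
    refine ⟨fun x y h => ?_, by simp [ZMod.card]; ring⟩
    have h1 := congrArg (fun z => ZMod.val z.1) h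
    have h2 := congrArg Prod.snd h
    have h3 := ZMod.val_lt x
    have h4 := ZMod.val_lt y
    simp only [r, ZMod.val_natCast] at h1 h2
    rw [Nat.mod_eq_of_lt (by omega), Nat.mod_eq_of_lt (by omega)] at h1
    rw [decide_eq_decide] at h2
    apply ZMod.val_injective
    omega
  refine ⟨fun x y => r (e x + e y), fun x y => by show r (e x + e y) = r (e y + e x); rw [add_comm], fun x => ?_, fun x => ?_⟩
  · exact hr.comp ((Equiv.addLeft (e x)).bijective.comp he)
  · have h1 := ZMod.val_lt x.1
    have h2 : (e x + e x).val = 2 * x.1.val := by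
      rw [ZMod.val_add, he0]
      cases x.2
      · simp; rw [Nat.mod_eq_of_lt (by omega)]; omega
      · simp
        rw [show x.1.val + k + (x.1.val + k) = 2 * x.1.val + 2 * k by ring, Nat.add_mod_right, Nat.mod_eq_of_lt (by omega)]
    show ((((e x + e x).val / 2 : ℕ) : ZMod k), decide ((e x + e x).val % 2 = 1)) = _
    rw [h2]
    simp

lemma sum_unique {W : Type} [Fintype W] (P : W → Prop) (h : ∀ w w', P w → P w' → w = w') :
    ∑ w, ind (P w) = ind (∃ w, P w) := by
  classical
  by_cases he : ∃ w, P w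
  · obtain ⟨a, ha⟩ := he
    rw [ind_pos ⟨a, ha⟩, ← sum_ind_eq a]
    exact Finset.sum_congr rfl fun w _ => ind_congr ⟨fun hw => h _ _ hw ha, fun hw => by rw [hw]; exact ha⟩
  · rw [ind_neg he]
    exact Finset.sum_eq_zero fun w _ => ind_neg fun hw => he ⟨w, hw⟩

section caseA
variable (k : ℕ) [NeZero k] (Q : ZMod k × Bool → ZMod k × Bool → ZMod k × Bool) (Qs : ∀ x y, Q x y = Q y x)
  (M1 M2 : Finset (ZMod k × ZMod k)) (pl : ZMod k → Prop)

/-- projections of the first kind -/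
def pA {k : ℕ} (i : Fin 3) (m : ZMod k × ZMod k) : ZMod k := ![m.1, m.2, -(m.1 + m.2)] i
/-- projections of the second kind -/
def pA' {k : ℕ} (i : Fin 3) (m : ZMod k × ZMod k) : ZMod k := ![m.1 + m.2, -m.1, -m.2] i

/-- the blocks inside a fibre -/
def fbA (p : Prop) (a b c : Bool) : Prop :=
  (p ∧ ((a = true ∧ b = false ∧ c = false) ∨ (a = false ∧ b = true ∧ c = false) ∨ (a = false ∧ b = false ∧ c = true))) ∨
  (¬ p ∧ a = false ∧ b = false ∧ c = false)

/-- transversal blocks from difference pairs -/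
def trA {k : ℕ} (M : Finset (ZMod k × ZMod k)) (s : Bool) (x y z : ZMod k × Bool) : Prop :=
  (y.1 - x.1, z.1 - y.1) ∈ M ∧ xor (xor x.2 y.2) z.2 = s

/-- ingredients, case A -/
noncomputable def LvA : Lv (ZMod k × Bool) (Fin 0) where
  Q := Q
  g1 i q z := z.1 - q.1 ∈ M1.image (pA i) ∨ z = q
  g2 i q z := z.1 - q.1 ∈ M2.image (pA' i)
  T x y z := trA M1 false x y z ∨ trA M2 true x y z ∨ (x.1 = y.1 ∧ y.1 = z.1 ∧ fbA (pl x.1) x.2 y.2 z.2)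
  W _ := Sys.nil _
  I c i x z := False
  J c i x y := False
  K _ _ _ x := False
  Qs := Qs
  Js c i x y := Iff.rfl
  Ks c d i x := Iff.rfl

/-- side conditions on a set of difference pairs -/
def PT {k : ℕ} (M : Finset (ZMod k × ZMod k)) : Prop :=
  ∀ m ∈ M, ∀ m' ∈ M, (m.1 = m'.1 ∨ m.2 = m'.2 ∨ m.1 + m.2 = m'.1 + m'.2) → m = m'

/-- side conditions, case A -/
structure HypA : Prop where
  hQ : ∀ x, Function.Bijective (Q x)
  hQx : ∀ x, Q x x = (x.1, false)
  pt1 : PT M1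
  pt2 : PT M2
  nz : ∀ m ∈ M1, m.1 ≠ 0 ∧ m.2 ≠ 0 ∧ m.1 + m.2 ≠ 0
  nz2 : (0, 0) ∉ M2

variable {k Q Qs M1 M2 pl}

/-- partner -/
noncomputable def tauA (pl : ZMod k → Prop) [DecidablePred pl] : (Fin 3 × ZMod k × Bool) ⊕ Fin 0 → (Fin 3 × ZMod k × Bool) ⊕ Fin 0
  | .inr c => c.elim0
  | .inl (i, a, g) => .inl (if (pl a ↔ g = false) then i + 1 else i + 2, a, !g)
/-- sign -/
noncomputable def sgA (pl : ZMod k → Prop) [DecidablePred pl] : (Fin 3 × ZMod k × Bool) ⊕ Fin 0 → ℤ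
  | .inr _ => 1
  | .inl (i, a, g) => if pl a then 1 else -1

lemma PT.card {M : Finset (ZMod k × ZMod k)} (h : PT M) (i : Fin 3) : (M.image (pA i)).card = M.card := by
  apply Finset.card_image_of_injOn
  intro m hm m' hm' e
  apply h m hm m' hm'
  fin_cases i
  · exact Or.inl e
  · exact Or.inr (Or.inl e)
  · exact Or.inr (Or.inr (neg_injective e))

lemma PT.card' {M : Finset (ZMod k × ZMod k)} (h : PT M) (i : Fin 3) : (M.image (pA' i)).card = M.card := by
  apply Finset.card_image_of_injOn
  intro m hm m' hm' e
  apply h m hm m' hm'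
  fin_cases i
  · exact Or.inr (Or.inr e)
  · exact Or.inl (neg_injective e)
  · exact Or.inr (Or.inl (neg_injective e))

lemma sumU_l {k : ℕ} [NeZero k] (D : Finset (ZMod k)) (a : ZMod k) : ∑ z : ZMod k × Bool, ind (z.1 - a ∈ D) = 2 * (D.card : ℤ) := by
  simp only [Fintype.sum_prod_type, Finset.sum_const, card_univ, Fintype.card_bool, ← Finset.smul_sum, sum_sub_l]
  simp

lemma sumU_r {k : ℕ} [NeZero k] (D : Finset (ZMod k)) (a : ZMod k) : ∑ z : ZMod k × Bool, ind (a - z.1 ∈ D) = 2 * (D.card : ℤ) := by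
  simp only [Fintype.sum_prod_type, Finset.sum_const, card_univ, Fintype.card_bool, ← Finset.smul_sum, sum_sub_r]
  simp

/-- number of transversals of one kind -/
noncomputable def tcA {U : Type} [Fintype U] (T : U → U → U → Prop) (i : Fin 3) (x z : U) : ℤ :=
  if i = 0 then ∑ w, ind (T x z w) else if i = 1 then ∑ w, ind (T w x z) else ∑ w, ind (T z w x)

lemma PT.tc {M : Finset (ZMod k × ZMod k)} (h : PT M) (s : Bool) (i : Fin 3) (x z : ZMod k × Bool) :
    tcA (trA M s) i x z = ind (z.1 - x.1 ∈ M.image (pA i)) := by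
  obtain ⟨x, a⟩ := x
  obtain ⟨z, b⟩ := z
  unfold tcA
  fin_cases i
  · simp only [Fin.zero_eta, if_true]
    rw [sum_unique]
    · apply ind_congr
      rw [mem_image]
      constructor
      · rintro ⟨⟨w, c⟩, h1, -⟩; exact ⟨_, h1, rfl⟩
      · rintro ⟨⟨d, e⟩, h1, rfl : d = z - x⟩
        exact ⟨(z + e, xor (xor a b) s), by simpa using h1, by cases a <;> cases b <;> cases s <;> rfl⟩
    · rintro ⟨w, c⟩ ⟨w', c'⟩ ⟨h1, h2⟩ ⟨h3, h4⟩
      have := h _ h1 _ h3 (Or.inl rfl)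
      simp only [Prod.mk.injEq, true_and, sub_left_inj] at this
      rw [this]
      revert h2 h4; cases a <;> cases b <;> cases s <;> cases c <;> cases c' <;> simp
  · simp only [Fin.mk_one, if_neg (show ¬ (1 : Fin 3) = 0 by decide), if_true]
    rw [sum_unique]
    · apply ind_congr
      rw [mem_image]
      constructor
      · rintro ⟨⟨w, c⟩, h1, -⟩; exact ⟨_, h1, rfl⟩
      · rintro ⟨⟨d, e⟩, h1, rfl : e = z - x⟩
        exact ⟨(x - d, xor (xor a b) s), by simpa using h1, by cases a <;> cases b <;> cases s <;> rfl⟩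
    · rintro ⟨w, c⟩ ⟨w', c'⟩ ⟨h1, h2⟩ ⟨h3, h4⟩
      have := h _ h1 _ h3 (Or.inr (Or.inl rfl))
      simp only [Prod.mk.injEq, and_true, sub_right_inj] at this
      rw [this]
      revert h2 h4; cases a <;> cases b <;> cases s <;> cases c <;> cases c' <;> simp
  · have e : (⟨2, by omega⟩ : Fin 3) = 2 := rfl
    simp only [e, if_neg (show ¬ (2 : Fin 3) = 0 by decide), if_neg (show ¬ (2 : Fin 3) = 1 by decide)]
    rw [sum_unique]
    · apply ind_congr
      rw [mem_image]
      constructor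
      · rintro ⟨⟨w, c⟩, h1, -⟩; exact ⟨_, h1, by show -((w - z) + (x - w)) = z - x; ring⟩
      · rintro ⟨⟨d, e⟩, h1, h2 : -(d + e) = z - x⟩
        have h2' : x - (z + d) = e := by linear_combination h2
        refine ⟨(z + d, xor (xor a b) s), ?_, by cases a <;> cases b <;> cases s <;> rfl⟩
        show (z + d - z, x - (z + d)) ∈ M
        rw [h2', add_sub_cancel_left]; exact h1
    · rintro ⟨w, c⟩ ⟨w', c'⟩ ⟨h1, h2⟩ ⟨h3, h4⟩
      have := h _ h1 _ h3 (Or.inr (Or.inr (by ring)))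
      simp only [Prod.mk.injEq, sub_left_inj] at this
      rw [this.1]
      revert h2 h4; cases a <;> cases b <;> cases s <;> cases c <;> cases c' <;> simp

lemma imA' (M : Finset (ZMod k × ZMod k)) (i : Fin 3) (d : ZMod k) :
    -d ∈ M.image (pA' (i + 1)) ↔ d ∈ M.image (pA i) := by
  simp only [mem_image]
  refine exists_congr fun m => and_congr_right fun _ => ?_
  fin_cases i
  · show - m.1 = - d ↔ m.1 = d
    rw [neg_inj]
  · show - m.2 = - d ↔ m.2 = d
    rw [neg_inj]
  · show m.1 + m.2 = -d ↔ -(m.1 + m.2) = d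
    constructor
    · intro h; rw [h, neg_neg]
    · intro h; rw [← h, neg_neg]

lemma HypA.nz1 (H : HypA k Q M1 M2) (i : Fin 3) : 0 ∉ M1.image (pA i) := by
  rw [mem_image]
  rintro ⟨m, hm, h⟩
  have := H.nz m hm
  fin_cases i
  · exact this.1 h
  · exact this.2.1 h
  · exact this.2.2 (neg_eq_zero.mp h)

lemma HypA.g1e (H : HypA k Q M1 M2) (i : Fin 3) (q z : ZMod k × Bool) :
    ind ((LvA k Q Qs M1 M2 pl).g1 i q z) = ind (z.1 - q.1 ∈ M1.image (pA i)) + ind (z = q) := by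
  show ind (_ ∨ _) = _
  rw [ind_or]
  rintro ⟨h1, rfl⟩
  rw [sub_self] at h1; exact H.nz1 i h1

lemma HypA.Te (H : HypA k Q M1 M2) (x y z : ZMod k × Bool) :
    ind ((LvA k Q Qs M1 M2 pl).T x y z) = ind (trA M1 false x y z) + (ind (trA M2 true x y z) +
      ind (x.1 = y.1 ∧ y.1 = z.1 ∧ fbA (pl x.1) x.2 y.2 z.2)) := by
  show ind (_ ∨ _ ∨ _) = _
  rw [ind_or, ind_or]
  · rintro ⟨⟨h1, h2⟩, h3, h4, -⟩
    rw [h3, h4, sub_self] at h1; exact H.nz2 h1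
  · rintro ⟨⟨h1, h2⟩, ⟨-, h5⟩ | ⟨h3, h4, -⟩⟩
    · rw [h2] at h5; exact absurd h5 (by decide)
    · rw [h3, h4, sub_self] at h1; exact (H.nz _ h1).1 rfl

lemma sum_fib {k : ℕ} [NeZero k] (a : ZMod k) (F : Bool → Prop) :
    ∑ w : ZMod k × Bool, ind (w.1 = a ∧ F w.2) = ind (F true) + ind (F false) := by
  rw [Fintype.sum_prod_type, Finset.sum_eq_single a]
  · simp
  · intro w _ hw
    simp [hw, ind]
  · simp

lemma tcF [DecidablePred pl] (i : Fin 3) (x z : ZMod k × Bool) : tcA (fun x y z : ZMod k × Bool => x.1 = y.1 ∧ y.1 = z.1 ∧ fbA (pl x.1) x.2 y.2 z.2) i x z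
    = ind (z = (x.1, false)) + ind ((Sum.inl (i + 1, z) : (Fin 3 × ZMod k × Bool) ⊕ Fin 0) = tauA pl (.inl (i, x))) * sgA pl (.inl (i, x)) := by
  obtain ⟨x, a⟩ := x
  obtain ⟨z, b⟩ := z
  unfold tcA
  by_cases hx : z = x
  · subst hx
    have h0 : ∑ w : ZMod k × Bool, ind (z = z ∧ z = w.1 ∧ fbA (pl z) a b w.2) = ind (fbA (pl z) a b true) + ind (fbA (pl z) a b false) := by
      rw [← sum_fib z]; exact Finset.sum_congr rfl fun w _ => ind_congr (by rw [eq_comm (a := z) (b := w.1)]; tauto)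
    have h1 : ∑ w : ZMod k × Bool, ind (w.1 = z ∧ z = z ∧ fbA (pl w.1) w.2 a b) = ind (fbA (pl z) true a b) + ind (fbA (pl z) false a b) := by
      rw [← sum_fib z (fun c => fbA (pl z) c a b)]; exact Finset.sum_congr rfl fun w _ => ind_congr (by
        constructor
        · rintro ⟨h, -, h'⟩; rw [h] at h'; exact ⟨h, h'⟩
        · rintro ⟨h, h'⟩; rw [h]; exact ⟨rfl, rfl, h'⟩)
    have h2 : ∑ w : ZMod k × Bool, ind (z = w.1 ∧ w.1 = z ∧ fbA (pl z) b w.2 a) = ind (fbA (pl z) b true a) + ind (fbA (pl z) b false a) := by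
      rw [← sum_fib z (fun c => fbA (pl z) b c a)]; exact Finset.sum_congr rfl fun w _ => ind_congr (by rw [eq_comm (a := z) (b := w.1)]; tauto)
    have key : ∀ A B C A' B' C' : ℤ, A = A' → B = B' → C = C' → (if i = 0 then A else if i = 1 then B else C) = if i = 0 then A' else if i = 1 then B' else C' := by
      rintro A B C A' B' C' rfl rfl rfl; rfl
    rw [key _ _ _ _ _ _ h0 h1 h2]
    clear h0 h1 h2 key
    by_cases hp : pl z
    · fin_cases i <;> cases a <;> cases b <;> simp [tauA, sgA, hp, fbA, ind]
    · fin_cases i <;> cases a <;> cases b <;> simp [tauA, sgA, hp, fbA, ind]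
  · have hx' : ¬ x = z := fun h => hx h.symm
    have h0 : ∀ w : ZMod k × Bool, ¬ (x = z ∧ z = w.1 ∧ fbA (pl x) a b w.2) := fun w h => hx' h.1
    have h1 : ∀ w : ZMod k × Bool, ¬ (w.1 = x ∧ x = z ∧ fbA (pl w.1) w.2 a b) := fun w h => hx' h.2.1
    have h2 : ∀ w : ZMod k × Bool, ¬ (z = w.1 ∧ w.1 = x ∧ fbA (pl z) b w.2 a) := fun w h => hx (h.1.trans h.2.1)
    have h3 : ¬ ((z, b) = (x, false)) := fun h => hx (Prod.ext_iff.mp h).1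
    have h4 : ¬ ((Sum.inl (i + 1, z, b) : (Fin 3 × ZMod k × Bool) ⊕ Fin 0) = tauA pl (.inl (i, x, a))) := by
      simp only [tauA]; intro h; simp at h; exact hx h.2.1
    simp only [ind_neg (h0 _), ind_neg (h1 _), ind_neg (h2 _), ind_neg h3, ind_neg h4]
    simp

lemma HypA.md [DecidablePred pl] (H : HypA k Q M1 M2) : IsMD (LvA k Q Qs M1 M2 pl).sys (2 * (M1.card + M2.card) + 1) (tauA pl) (sgA pl) := by
  have hg2 : ∀ i q z, (LvA k Q Qs M1 M2 pl).g2 i q z = (z.1 - q.1 ∈ M2.image (pA' i)) := fun _ _ _ => rfl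
  have hW : ∀ i x y z, ((LvA k Q Qs M1 M2 pl).W i).f x y z = 0 := fun _ _ _ _ => rfl
  have inv : ∀ x, tauA pl (tauA pl x) = x := by
    rintro (⟨i, x, g⟩ | c)
    · by_cases hp : pl x <;> cases g <;> simp [tauA, hp] <;> fin_cases i <;> rfl
    · exact c.elim0
  have sg : ∀ x, sgA pl (tauA pl x) = sgA pl x := by
    rintro (⟨i, x, g⟩ | c)
    · rfl
    · exact c.elim0
  refine ⟨inv, ?_, sg, ?_, ?_⟩
  · rintro (⟨i, x, g⟩ | c)
    · simp [tauA]
    · exact c.elim0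
  · rintro (⟨i, x⟩ | c)
    · simp only [sgA]; split_ifs <;> simp
    · exact c.elim0
  · apply Lv.all
    · intro x y; rw [md_symm inv sg]
    · rintro i ⟨x, a⟩ ⟨y, b⟩ hxy
      rw [Lv.cnt_same _ _ hxy]
      have : ¬ ((Sum.inl (i, y, b) : (Fin 3 × ZMod k × Bool) ⊕ Fin 0) = tauA pl (.inl (i, x, a))) := by
        simp only [tauA]; split_ifs <;> simp
      simp only [H.g1e, hg2, hW, Finset.sum_add_distrib, sumU_l, sum_ind_eq, H.pt1.card, H.pt2.card', Finset.sum_const_zero, ind_neg this]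
      simp; ring
    · intro i x z
      rw [Lv.cnt_cross _ H.hQ]
      have htc : (LvA k Q Qs M1 M2 pl).tc i x z = tcA (LvA k Q Qs M1 M2 pl).T i x z := rfl
      have htc2 : tcA (LvA k Q Qs M1 M2 pl).T i x z = tcA (trA M1 false) i x z + (tcA (trA M2 true) i x z +
        tcA (fun x y z : ZMod k × Bool => x.1 = y.1 ∧ y.1 = z.1 ∧ fbA (pl x.1) x.2 y.2 z.2) i x z) := by
        simp only [tcA, H.Te, Finset.sum_add_distrib]
        split_ifs <;> rfl
      have hq : (LvA k Q Qs M1 M2 pl).Q = Q := rfl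
      rw [htc, htc2, H.pt1.tc, H.pt2.tc, tcF]
      simp only [H.g1e, hg2, hq, H.hQx, Finset.sum_add_distrib, sumU_r, sum_ind_eq', H.pt1.card, H.pt2.card']
      rw [← imA' M2 i, neg_sub]
      simp; ring
    · intro c; exact c.elim0
    · intro c; exact c.elim0


lemma HypA.tot [DecidablePred pl] (H : HypA k Q M1 M2) (j : ℕ) (hj : ∑ x, ind (pl x) = j) :
    totDef (LvA k Q Qs M1 M2 pl).sys (2 * (M1.card + M2.card) + 1) = 12 * j - 6 * k := by
  rw [H.md.tot]
  have : ∀ x : ZMod k, (if pl x then (1 : ℤ) else -1) = 2 * ind (pl x) - 1 := by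
    intro x; unfold ind; split_ifs <;> ring
  simp only [Fintype.sum_sum_type, Fintype.sum_prod_type, Fin.sum_univ_three, sgA, this]
  simp only [Finset.sum_const, Finset.sum_sub_distrib, ← Finset.mul_sum, hj, card_univ, Fintype.card_bool, ← Finset.smul_sum, ZMod.card]
  simp; ring

lemma HypA.star [DecidablePred pl] (H : HypA k Q M1 M2) (x : ZMod k) (hx : ¬ pl x) {v : ℕ} (hv : v = 6 * k) :
    HasStar v (2 * (M1.card + M2.card) + 1) (totDef (LvA k Q Qs M1 M2 pl).sys (2 * (M1.card + M2.card) + 1) + 6) := by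
  have ht : tauA pl (.inl (0, x, true)) = .inl (1, x, false) := by simp [tauA, hx]
  have hf0 : (LvA k Q Qs M1 M2 pl).sys.f (.inl (0, x, true)) (tauA pl (.inl (0, x, true))) (.inl (2, x, false)) = 0 := by
    rw [ht]
    show (LvA k Q Qs M1 M2 pl).l3 0 1 2 (x, true) (x, false) (x, false) = 0
    simp only [Lv.l3]
    simp only [if_neg (show ¬ (0 : Fin 3) = 1 by decide), if_neg (show ¬ (0 : Fin 3) = 2 by decide),
      if_neg (show ¬ (1 : Fin 3) = 2 by decide), if_true]
    rw [H.Te]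
    rw [ind_neg, ind_neg, ind_neg]
    · rfl
    · simp [fbA, hx]
    · rintro ⟨h, -⟩; simp only [sub_self] at h; exact H.nz2 h
    · rintro ⟨h, -⟩; simp only [sub_self] at h; exact (H.nz _ h).1 rfl
  have := (H.md (Qs := Qs) (pl := pl)).toggle_star (p := .inl (0, x, true)) (r := .inl (2, x, false)) (s := 1) (Or.inl rfl)
    (by simp [sgA, hx]) (by simp [sgA, hx]) (by simp) (by rw [ht]; simp) (by rw [hf0]; ring)
  refine this.has (by rw [hv]; simp [ZMod.card]; ring) ?_
  rw [totDef_toggle, hf0]; ring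

/-- a (near) transversal -/
def sA (k i : ℕ) : ℕ := if k % 2 = 1 ∨ 2 * i < k then i else i + 1
/-- its size -/
def nA (k : ℕ) : ℕ := if k % 2 = 1 then k else k - 1

lemma cast_lt {n n' : ℕ} (h : (n : ZMod k) = n') (h1 : n < 2 * k) (h2 : n' < 2 * k) : n = n' ∨ n = n' + k ∨ n' = n + k := by
  rw [ZMod.natCast_eq_natCast_iff'] at h
  have h3 := Nat.div_add_mod n k
  have h4 := Nat.div_add_mod n' k
  have h5 : n / k < 2 := Nat.div_lt_of_lt_mul (by omega)
  have h6 : n' / k < 2 := Nat.div_lt_of_lt_mul (by omega)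
  rw [h] at h3
  interval_cases n / k <;> interval_cases n' / k <;> omega

/-- set of difference pairs -/
def MA (k : ℕ) (A : Finset ℕ) (c : ZMod k) : Finset (ZMod k × ZMod k) :=
  A.image fun i : ℕ => ((i : ZMod k), (sA k i : ZMod k) + c)

lemma MA_inj {i j : ℕ} (hi : i < nA k) (hj : j < nA k) (h : (i : ZMod k) = j ∨ (sA k i : ZMod k) = sA k j ∨ ((i + sA k i : ℕ) : ZMod k) = ((j + sA k j : ℕ) : ZMod k)) :
    i = j := by
  have hk : 0 < k := Nat.pos_of_ne_zero (NeZero.ne k)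
  unfold nA at hi hj
  rcases h with h | h | h
  · have := cast_lt h (by split_ifs at hi <;> omega) (by split_ifs at hj <;> omega)
    split_ifs at hi hj <;> omega
  · have := cast_lt h (by unfold sA; split_ifs at hi ⊢ <;> omega) (by unfold sA; split_ifs at hj ⊢ <;> omega)
    unfold sA at this
    split_ifs at hi hj this <;> omega
  · have := cast_lt h (by unfold sA; split_ifs at hi ⊢ <;> omega) (by unfold sA; split_ifs at hj ⊢ <;> omega)
    unfold sA at this
    split_ifs at hi hj this <;> omega

lemma MA_PT (A : Finset ℕ) (hA : ∀ i ∈ A, i < nA k) (c : ZMod k) : PT (MA k A c) := by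
  intro m hm m' hm' h
  obtain ⟨i, hi, rfl⟩ := mem_image.mp hm
  obtain ⟨j, hj, rfl⟩ := mem_image.mp hm'
  rw [MA_inj (hA i hi) (hA j hj)]
  simp only [add_left_inj] at h
  rcases h with h | h | h
  · exact Or.inl h
  · exact Or.inr (Or.inl h)
  · refine Or.inr (Or.inr ?_)
    push_cast; linear_combination h

lemma MA_card (A : Finset ℕ) (hA : ∀ i ∈ A, i < nA k) (c : ZMod k) : (MA k A c).card = A.card := by
  apply Finset.card_image_of_injOn
  intro i hi j hj h
  exact MA_inj (hA i hi) (hA j hj) (Or.inl (Prod.ext_iff.mp h).1)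

lemma MA_nz {i : ℕ} (hi : i < nA k) (h : (i : ZMod k) = 0 ∨ (sA k i : ZMod k) = 0 ∨ ((i + sA k i : ℕ) : ZMod k) = 0) : i = 0 := by
  have hk : 0 < k := Nat.pos_of_ne_zero (NeZero.ne k)
  apply MA_inj hi (j := 0) (by unfold nA at *; split_ifs at * <;> omega)
  have : sA k 0 = 0 := by unfold sA; rw [if_pos]; omega
  rw [this]
  simpa using h

lemma claimA_aux (k μ j : ℕ) (hk : 0 < k) (hj : j ≤ k) (hμ : 2 * μ + 2 ≤ 3 * k) (hex : ¬ (k = 2 ∧ μ = 2)) :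
    HasMD (6 * k) (2 * μ + 1) (12 * j - 6 * k) ∧
    (j < k → HasStar (6 * k) (2 * μ + 1) (12 * j - 6 * k + 6)) := by
  classical
  have : NeZero k := ⟨by omega⟩
  obtain ⟨Q, Qs, hQ, hQx⟩ := exists_Q k
  obtain ⟨m1, m2, h1, h2, h3, h4⟩ : ∃ m1 m2, m1 + m2 = μ ∧ 1 + m1 ≤ nA k ∧ m2 ≤ nA k ∧ (m2 = 0 ∨ 2 ≤ k) := by
    have : 1 ≤ nA k := by unfold nA; split_ifs <;> omega
    refine ⟨min μ (nA k - 1), μ - min μ (nA k - 1), by omega, by omega, ?_, ?_⟩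
    · unfold nA; split_ifs <;> omega
    · unfold nA; split_ifs <;> omega
  have hA1 : ∀ i ∈ Finset.Ico 1 (1 + m1), i < nA k := by intro i hi; rw [mem_Ico] at hi; omega
  have hA2 : ∀ i ∈ Finset.range m2, i < nA k := by intro i hi; rw [mem_range] at hi; omega
  have H : HypA k Q (MA k (Finset.Ico 1 (1 + m1)) 0) (MA k (Finset.range m2) 1) := by
    refine ⟨hQ, hQx, MA_PT _ hA1 _, MA_PT _ hA2 _, ?_, ?_⟩
    · intro m hm
      obtain ⟨i, hi, rfl⟩ := mem_image.mp hm
      have h5 := MA_nz (hA1 i hi)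
      rw [mem_Ico] at hi
      simp only [add_zero]
      refine ⟨fun h => ?_, fun h => ?_, fun h => ?_⟩
      · have := h5 (Or.inl h); omega
      · have := h5 (Or.inr (Or.inl h)); omega
      · have := h5 (Or.inr (Or.inr (by push_cast; exact h))); omega
    · intro hm
      obtain ⟨i, hi, he⟩ := mem_image.mp hm
      rw [Prod.mk.injEq] at he
      have h5 := MA_nz (hA2 i hi) (Or.inl he.1)
      subst h5
      rw [mem_range] at hi
      have h6 : sA k 0 = 0 := by unfold sA; rw [if_pos]; omega
      have h7 := he.2
      rw [h6] at h7
      simp at h7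
      have := zmod_ne (u := k) 1 (by omega) (by omega)
      apply this; push_cast; exact h7
  have hc : (2 * ((MA k (Finset.Ico 1 (1 + m1)) 0).card + (MA k (Finset.range m2) 1).card : ℤ) + 1) = 2 * μ + 1 := by
    rw [MA_card _ hA1, MA_card _ hA2, ← h1]; simp
  have ht := H.tot (Qs := Qs) (pl := fun x => x.val < j) j (val_count _ _ hj)
  have hmd := H.md (Qs := Qs) (pl := fun x => x.val < j)
  rw [hc] at ht hmd
  refine ⟨hmd.has (by simp [ZMod.card]; ring) ht, fun h => ?_⟩
  have := H.star (Qs := Qs) (pl := fun x => x.val < j) (j : ZMod k) (by rw [ZMod.val_natCast, Nat.mod_eq_of_lt h]; omega) (v := 6 * k) rfl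
  rw [hc, ht] at this
  exact this
end caseA
end DataPlacement

namespace DataPlacement
open Finset
set_option linter.unusedVariables false
set_option linter.unusedSimpArgs false
set_option linter.unusedSectionVars false
set_option linter.unnecessarySeqFocus false

/-- code of an explicit system on twelve points -/
def code12 : ℕ :=
  77894081334563378764508707451908598634363875792546106220991280972045090113143756247350828053674522774404165906274379945792494917548310681231562832274404459498927895137198261546582847335273109988912256200994195288162445603454078385625550571346673603346156659468140914106766538662558127481787703396923829439550341360542180297576352403623074440158082449669831373247160383491022070005689800863761088001040480174918477232703382163869379387904561319055875502109998956954670114862778839836460973291797224563700931479520396655675094913776280218749065306471509050341105275687881437268751745066370236357775971808869108126584261095882673779746478660761558981504626364248462648702400483804375141740579315626009878775683593398770608488277164993999075563621550087186855132247068645834959771619393459366357387073785771556518359864299814949394419831865781455822809958383140861895273068311229927774956511992841196802460771977823263115547843706265996690444044802540858981276463027511351056611601259170894729222215198181928355431422875716635252352701536000892544324481942896469641809096615059800192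

/-- an explicit system on twelve points -/
def sys12 : Sys (Fin 12) where
  f x y z := if x ≠ y ∧ x ≠ z ∧ y ≠ z ∧ code12.testBit (2 ^ x.val + 2 ^ y.val + 2 ^ z.val) = true then 1 else 0
  zo x y z := by split_ifs <;> simp
  s12 x y z := by
    rw [add_comm (2 ^ x.val) (2 ^ y.val)]
    refine if_congr ?_ rfl rfl
    rw [ne_comm]; tauto
  s23 x y z := by
    rw [add_assoc, add_comm (2 ^ y.val) (2 ^ z.val), ← add_assoc]
    refine if_congr ?_ rfl rfl
    rw [ne_comm (a := y)]; tauto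
  dg x z := by simp

/-- partner -/
def tau12 (x : Fin 12) : Fin 12 := ![3, 4, 5, 0, 1, 2, 9, 10, 11, 6, 7, 8] x
/-- sign -/
def sg12 (x : Fin 12) : ℤ := if x.val < 6 then 1 else -1

lemma md12 : IsMD sys12 5 tau12 sg12 := by
  refine ⟨by decide, by decide, by decide, by decide, ?_⟩
  have h : ∀ x y, x ≠ y → cnt sys12 x y = 5 + (if y = tau12 x then 1 else 0) * sg12 x := by
    unfold cnt
    decide +kernel
  intro x y hxy
  rw [h x y hxy, ind_eq_ite]

lemma has12 : HasMD 12 5 0 ∧ HasStar 12 5 6 := by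
  have ht : totDef sys12 5 = 0 := by
    rw [md12.tot]; decide
  refine ⟨md12.has (by simp) ht, ?_⟩
  have hf0 : sys12.f 6 (tau12 6) 8 = 0 := by decide +kernel
  have := md12.toggle_star (p := 6) (r := 8) (s := 1) (Or.inl rfl)
    (by decide) (by decide) (by decide) (by decide) (by rw [hf0]; ring)
  refine this.has (by simp) ?_
  rw [totDef_toggle, hf0, ht]; ring
end DataPlacement

namespace DataPlacement
open Finset
set_option linter.unusedVariables false
set_option linter.unusedSimpArgs false
set_option linter.unusedSectionVars false
set_option linter.unnecessarySeqFocus false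

lemma ind_zo1 {V : Type} (S : Sys V) (x y z : V) : ind (S.f x y z = 1) = S.f x y z := by
  rcases S.zo x y z with h | h <;> rw [h] <;> simp [ind]

section glue
variable (k : ℕ) [NeZero k] (Q : ZMod k × Bool → ZMod k × Bool → ZMod k × Bool) (Qs : ∀ x y, Q x y = Q y x)
  (D D' Jf : Finset (ZMod k)) (td : Prop) (L : Fin 3 → Sys ((ZMod k × Bool) ⊕ Fin 2))

/-- cross blocks through infinite points -/
def ID {k : ℕ} (D D' Jf : Finset (ZMod k)) (c : Fin 2) (x z : ZMod k × Bool) : Prop :=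
  (x.1 = z.1 ∧ x.1 ∈ Jf ∧ x.2 ≠ z.2 ∧ (x.2 = true ↔ c = 1)) ∨
  (¬ (x.1 = z.1 ∧ x.1 ∈ Jf) ∧ ((z.1 - x.1 ∈ D ∧ (xor x.2 z.2 = true ↔ c = 1)) ∨
    (x.1 - z.1 ∈ D' ∧ ¬ (xor x.2 z.2 = true ↔ c = 1))))

/-- ingredients, gluing -/
noncomputable def LvD : Lv (ZMod k × Bool) (Fin 2) where
  Q := Q
  g1 i q z := z.1 - q.1 ∈ D
  g2 i q z := z.1 - q.1 ∈ D'
  T x y z := (x.1 = y.1 ∧ y.1 = z.1 ∧ x.1 ∈ Jf ∧ x.2 = y.2 ∧ y.2 = z.2) ∨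
    (td ∧ z.1 = x.1 + y.1 ∧ z.2 = xor x.2 y.2)
  W i := (L i).pull Sum.inl
  I c i x z := ID D D' Jf c x z
  J c i x y := (L i).f (.inl x) (.inl y) (.inr c) = 1
  K c d i x := x.1 ∈ Jf ∨ (L i).f (.inr c) (.inr d) (.inl x) = 1
  Qs := Qs
  Js c i x y := by rw [(L i).s12]
  Ks c d i x := by rw [(L i).s12]

/-- side conditions, gluing -/
structure HypD : Prop where
  hQ : ∀ x, Function.Bijective (Q x)
  hQx : ∀ x, Q x x = (x.1, false)
  j1 : ∀ x ∈ Jf, 0 ∈ D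
  j2 : 0 ∉ D'
  jt : td → 0 ∉ Jf
  jl : ∀ i x, (L i).f (.inr 0) (.inr 1) (.inl x) = 1 → x.1 ∉ Jf

variable {k Q Qs D D' Jf td L}

lemma ID_out (h1 : ∀ x ∈ Jf, 0 ∈ D) (h2 : 0 ∉ D') (c : Fin 2) (x : ZMod k × Bool) :
    ∑ z, ind (ID D D' Jf c x z) = D.card + D'.card - ind (x.1 ∈ Jf) * ind (¬ (x.2 = true ↔ c = 1)) := by
  obtain ⟨x, a⟩ := x
  have key : ∀ z, ind (ID D D' Jf c (x, a) (z, true)) + ind (ID D D' Jf c (x, a) (z, false)) =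
      ind (z - x ∈ D) + ind (x - z ∈ D') - ind (z = x) * (ind (x ∈ Jf) * ind (¬ (a = true ↔ c = 1))) := by
    intro z
    by_cases hz : z = x
    · subst hz
      by_cases hj : z ∈ Jf
      · have := h1 _ hj
        fin_cases c <;> cases a <;> simp [ID, ind, hj, this, h2]
      · fin_cases c <;> cases a <;> simp [ID, ind, hj, h2]
    · have hz' : ¬ x = z := fun h => hz h.symm
      by_cases g1 : z - x ∈ D <;> by_cases g2 : x - z ∈ D' <;> fin_cases c <;> cases a <;> simp [ID, ind, hz, hz', g1, g2]
  rw [Fintype.sum_prod_type]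
  simp only [Fintype.sum_bool, key]
  rw [Finset.sum_sub_distrib, Finset.sum_add_distrib, sum_sub_l, sum_sub_r, ← Finset.sum_mul, sum_ind_eq, one_mul]

lemma ID_in (h1 : ∀ x ∈ Jf, 0 ∈ D) (h2 : 0 ∉ D') (c : Fin 2) (x : ZMod k × Bool) :
    ∑ z, ind (ID D D' Jf c z x) = D.card + D'.card - ind (x.1 ∈ Jf) * ind ((x.2 = true ↔ c = 1)) := by
  obtain ⟨x, a⟩ := x
  have key : ∀ z, ind (ID D D' Jf c (z, true) (x, a)) + ind (ID D D' Jf c (z, false) (x, a)) =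
      ind (x - z ∈ D) + ind (z - x ∈ D') - ind (z = x) * (ind (x ∈ Jf) * ind ((a = true ↔ c = 1))) := by
    intro z
    by_cases hz : z = x
    · subst hz
      by_cases hj : z ∈ Jf
      · have := h1 _ hj
        fin_cases c <;> cases a <;> simp [ID, ind, hj, this, h2]
      · fin_cases c <;> cases a <;> simp [ID, ind, hj, h2]
    · have hz' : ¬ x = z := fun h => hz h.symm
      by_cases g1 : x - z ∈ D <;> by_cases g2 : z - x ∈ D' <;> fin_cases c <;> cases a <;> simp [ID, ind, hz, hz', g1, g2]
  rw [Fintype.sum_prod_type]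
  simp only [Fintype.sum_bool, key]
  rw [Finset.sum_sub_distrib, Finset.sum_add_distrib, sum_sub_l, sum_sub_r, ← Finset.sum_mul, sum_ind_eq, one_mul]

lemma ID_cross (h1 : ∀ x ∈ Jf, 0 ∈ D) (h2 : 0 ∉ D') (x z : ZMod k × Bool) :
    ∑ c, ind (ID D D' Jf c x z) = ind (z.1 - x.1 ∈ D) + ind (x.1 - z.1 ∈ D') - ind (z.1 = x.1 ∧ x.1 ∈ Jf ∧ x.2 = z.2) := by
  obtain ⟨x, a⟩ := x
  obtain ⟨z, b⟩ := z
  rw [Fin.sum_univ_two]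
  by_cases hz : z = x
  · subst hz
    by_cases hj : z ∈ Jf
    · have := h1 _ hj
      cases a <;> cases b <;> simp [ID, ind, hj, this, h2]
    · by_cases h0 : 0 ∈ D <;> cases a <;> cases b <;> simp [ID, ind, hj, h2, h0]
  · have hz' : ¬ x = z := fun h => hz h.symm
    by_cases g1 : z - x ∈ D <;> by_cases g2 : x - z ∈ D' <;> cases a <;> cases b <;> simp [ID, ind, hz, hz', g1, g2]

lemma HypD.Te (H : HypD k Q D D' Jf td L) (x y z : ZMod k × Bool) :
    ind ((LvD k Q Qs D D' Jf td L).T x y z) = ind (x.1 = y.1 ∧ y.1 = z.1 ∧ x.1 ∈ Jf ∧ x.2 = y.2 ∧ y.2 = z.2) +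
      ind (td ∧ z.1 = x.1 + y.1 ∧ z.2 = xor x.2 y.2) := by
  show ind (_ ∨ _) = _
  rw [ind_or]
  rintro ⟨⟨h1, h2, h3, -, -⟩, h6, h7, -⟩
  rw [← h2, ← h1] at h7
  have : x.1 = 0 := by linear_combination -h7
  rw [this] at h3
  exact H.jt h6 h3

lemma HypD.tce (H : HypD k Q D D' Jf td L) (i : Fin 3) (x z : ZMod k × Bool) :
    (LvD k Q Qs D D' Jf td L).tc i x z = ind (z.1 = x.1 ∧ x.1 ∈ Jf ∧ x.2 = z.2) + ind td := by
  have hu1 : tcA (fun x y z : ZMod k × Bool => x.1 = y.1 ∧ y.1 = z.1 ∧ x.1 ∈ Jf ∧ x.2 = y.2 ∧ y.2 = z.2) i x z =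
      ind (z.1 = x.1 ∧ x.1 ∈ Jf ∧ x.2 = z.2) := by
    unfold tcA
    split_ifs
    · rw [sum_unique]
      · apply ind_congr
        constructor
        · rintro ⟨w, h1, h2, h3, h4, h5⟩; exact ⟨h1.symm, h3, h4⟩
        · rintro ⟨h1, h2, h3⟩; exact ⟨z, h1.symm, rfl, h2, h3, rfl⟩
      · rintro w w' ⟨h1, h2, h3, h4, h5⟩ ⟨h1', h2', h3', h4', h5'⟩
        exact Prod.ext (h2.symm.trans h2') (h5.symm.trans h5')
    · rw [sum_unique]
      · apply ind_congr
        constructor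
        · rintro ⟨w, h1, h2, h3, h4, h5⟩; exact ⟨h2.symm, h1 ▸ h3, h5⟩
        · rintro ⟨h1, h2, h3⟩; exact ⟨x, rfl, h1.symm, h2, rfl, h3⟩
      · rintro w w' ⟨h1, h2, h3, h4, h5⟩ ⟨h1', h2', h3', h4', h5'⟩
        exact Prod.ext (h1.trans h1'.symm) (h4.trans h4'.symm)
    · rw [sum_unique]
      · apply ind_congr
        constructor
        · rintro ⟨w, h1, h2, h3, h4, h5⟩; exact ⟨h1.trans h2, (h1.trans h2) ▸ h3, (h4.trans h5).symm⟩
        · rintro ⟨h1, h2, h3⟩; exact ⟨x, h1, rfl, h1 ▸ h2, h3.symm, rfl⟩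
      · rintro w w' ⟨h1, h2, h3, h4, h5⟩ ⟨h1', h2', h3', h4', h5'⟩
        exact Prod.ext (h2.trans h2'.symm) (h5.trans h5'.symm)
  have hu2 : tcA (fun x y z : ZMod k × Bool => td ∧ z.1 = x.1 + y.1 ∧ z.2 = xor x.2 y.2) i x z = ind td := by
    unfold tcA
    split_ifs
    · rw [sum_unique]
      · apply ind_congr
        constructor
        · rintro ⟨w, h1, -⟩; exact h1
        · intro h; exact ⟨(x.1 + z.1, xor x.2 z.2), h, rfl, rfl⟩
      · rintro w w' ⟨-, h1, h2⟩ ⟨-, h3, h4⟩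
        exact Prod.ext (h1.trans h3.symm) (h2.trans h4.symm)
    · rw [sum_unique]
      · apply ind_congr
        constructor
        · rintro ⟨w, h1, -⟩; exact h1
        · intro h; exact ⟨(z.1 - x.1, xor x.2 z.2), h, by ring, by cases x.2 <;> cases z.2 <;> rfl⟩
      · rintro ⟨w, c⟩ ⟨w', c'⟩ ⟨-, h1, h2⟩ ⟨-, h3, h4⟩
        refine Prod.ext ?_ ?_
        · exact add_right_cancel (h1.symm.trans h3)
        · simp only at h2 h4; rw [h2] at h4; revert h4; cases x.2 <;> cases c <;> cases c' <;> simp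
    · rw [sum_unique]
      · apply ind_congr
        constructor
        · rintro ⟨w, h1, -⟩; exact h1
        · intro h; exact ⟨(x.1 - z.1, xor x.2 z.2), h, by ring, by cases x.2 <;> cases z.2 <;> rfl⟩
      · rintro ⟨w, c⟩ ⟨w', c'⟩ ⟨-, h1, h2⟩ ⟨-, h3, h4⟩
        refine Prod.ext ?_ ?_
        · exact add_left_cancel (h1.symm.trans h3)
        · simp only at h2 h4; rw [h2] at h4; revert h4; cases z.2 <;> cases c <;> cases c' <;> simp
  rw [← hu1, ← hu2]
  show tcA (LvD k Q Qs D D' Jf td L).T i x z = _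
  simp only [tcA, H.Te, Finset.sum_add_distrib]
  split_ifs <;> rfl

lemma HypD.same (H : HypD k Q D D' Jf td L) (i : Fin 3) {x y : ZMod k × Bool} (h : x ≠ y) :
    cnt (LvD k Q Qs D D' Jf td L).sys (.inl (i, x)) (.inl (i, y)) = 2 * (D.card + D'.card) + cnt (L i) (.inl x) (.inl y) := by
  rw [Lv.cnt_same _ _ h]
  have h1 : ∑ z, ind ((LvD k Q Qs D D' Jf td L).g1 i (Q x y) z) = 2 * (D.card : ℤ) := sumU_l _ _
  have h2 : ∑ z, ind ((LvD k Q Qs D D' Jf td L).g2 i (Q x y) z) = 2 * (D'.card : ℤ) := sumU_l _ _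
  have h3 : ∀ c, ind ((LvD k Q Qs D D' Jf td L).J c i x y) = (L i).f (.inl x) (.inl y) (.inr c) := fun c => ind_zo1 _ _ _ _
  have h4 : ∀ z, ((LvD k Q Qs D D' Jf td L).W i).f x y z = (L i).f (.inl x) (.inl y) (.inl z) := fun _ => rfl
  have h5 : (LvD k Q Qs D D' Jf td L).Q = Q := rfl
  rw [h5, h1, h2]
  simp only [h3, h4, cnt, Fintype.sum_sum_type]
  ring

lemma HypD.cross (H : HypD k Q D D' Jf td L) (i : Fin 3) (x z : ZMod k × Bool) :
    cnt (LvD k Q Qs D D' Jf td L).sys (.inl (i, x)) (.inl (i + 1, z)) = 2 * (D.card + D'.card) + ind td := by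
  rw [Lv.cnt_cross _ H.hQ, H.tce]
  have h1 : ∑ q, ind ((LvD k Q Qs D D' Jf td L).g1 i q z) = 2 * (D.card : ℤ) := sumU_r _ _
  have h2 : ∑ q, ind ((LvD k Q Qs D D' Jf td L).g2 (i + 1) q x) = 2 * (D'.card : ℤ) := sumU_r _ _
  have h3 : ind ((LvD k Q Qs D D' Jf td L).g1 i (Q x x) z) = ind (z.1 - x.1 ∈ D) := by
    show ind (z.1 - (Q x x).1 ∈ D) = _
    rw [H.hQx]
  have h4 : ind ((LvD k Q Qs D D' Jf td L).g2 (i + 1) (Q z z) x) = ind (x.1 - z.1 ∈ D') := by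
    show ind (x.1 - (Q z z).1 ∈ D') = _
    rw [H.hQx]
  have h5 : (LvD k Q Qs D D' Jf td L).Q = Q := rfl
  have h6 : ∑ c, ind ((LvD k Q Qs D D' Jf td L).I c i x z) = _ := ID_cross H.j1 H.j2 x z
  rw [h5, h1, h2, h3, h4, h6]
  ring

lemma HypD.inf (H : HypD k Q D D' Jf td L) (c : Fin 2) (i : Fin 3) (x : ZMod k × Bool) :
    cnt (LvD k Q Qs D D' Jf td L).sys (.inr c) (.inl (i, x)) = 2 * (D.card + D'.card) + cnt (L i) (.inr c) (.inl x) := by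
  rw [Lv.cnt_inf]
  have h1 : ∑ z, ind ((LvD k Q Qs D D' Jf td L).I c i x z) = _ := ID_out H.j1 H.j2 c x
  have h2 : ∑ z, ind ((LvD k Q Qs D D' Jf td L).I c (i + 2) z x) = _ := ID_in H.j1 H.j2 c x
  have h3 : ∀ y, ind (x ≠ y ∧ (LvD k Q Qs D D' Jf td L).J c i x y) = (L i).f (.inr c) (.inl x) (.inl y) := by
    intro y
    by_cases h : x = y
    · subst h
      rw [ind_neg (by simp), (L i).d23]
    · rw [ind_congr (show _ ↔ (L i).f (.inl x) (.inl y) (.inr c) = 1 from ⟨fun h => h.2, fun h' => ⟨h, h'⟩⟩), ind_zo1,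
        (L i).s23, (L i).s12]
  have h4 : ∀ d, ind (c ≠ d ∧ (LvD k Q Qs D D' Jf td L).K c d i x) = (L i).f (.inr c) (.inl x) (.inr d) + ind (c ≠ d) * ind (x.1 ∈ Jf) := by
    intro d
    by_cases h : c = d
    · subst h
      rw [ind_neg (by simp), (L i).d13, ind_neg (by simp)]; ring
    · rw [ind_congr (show _ ↔ (x.1 ∈ Jf ∨ (L i).f (.inr c) (.inr d) (.inl x) = 1) from ⟨fun h => h.2, fun h' => ⟨h, h'⟩⟩), ind_or, ind_zo1,
        (L i).s23, ind_pos h]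
      · ring
      · rintro ⟨h1, h2⟩
        refine H.jl i x ?_ h1
        fin_cases c <;> fin_cases d
        · exact absurd rfl h
        · exact h2
        · rw [(L i).s12]; exact h2
        · exact absurd rfl h
  have h5 : ∑ d, ind (c ≠ d) = 1 := by fin_cases c <;> simp [Fin.sum_univ_two, ind]
  rw [h1, h2]
  simp only [h3, h4, Finset.sum_add_distrib, ← Finset.sum_mul, h5, cnt, Fintype.sum_sum_type]
  rw [ind_not]
  ring

lemma HypD.infs (H : HypD k Q D D' Jf td L) :
    cnt (LvD k Q Qs D D' Jf td L).sys (.inr 0) (.inr 1) = 6 * Jf.card + ∑ i, cnt (L i) (.inr 0) (.inr 1) := by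
  rw [Lv.cnt_infs _ (by decide)]
  have h1 : ∀ i x, ind ((LvD k Q Qs D D' Jf td L).K 0 1 i x) = ind (x.1 ∈ Jf) + (L i).f (.inr 0) (.inr 1) (.inl x) := by
    intro i x
    show ind (_ ∨ _) = _
    rw [ind_or, ind_zo1]
    rintro ⟨h1, h2⟩; exact H.jl i x h2 h1
  have h2 : ∑ x : ZMod k × Bool, ind (x.1 ∈ Jf) = 2 * (Jf.card : ℤ) := by
    have := sumU_l Jf (0 : ZMod k)
    simpa using this
  simp only [h1, Finset.sum_add_distrib, h2, cnt, Fintype.sum_sum_type, (L _).d13, (L _).d23, Fin.sum_univ_two]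
  simp; ring

lemma LvD_fsame (i : Fin 3) (x y : ZMod k × Bool) (c : Fin 2) :
    (LvD k Q Qs D D' Jf td L).sys.f (.inl (i, x)) (.inl (i, y)) (.inr c) = (L i).f (.inl x) (.inl y) (.inr c) := by
  show (LvD k Q Qs D D' Jf td L).l2 c i i x y = _
  unfold Lv.l2
  rw [if_pos rfl]
  by_cases h : x = y
  · subst h; rw [ind_neg (by simp), (L i).dg]
  · rw [ind_congr (show _ ↔ (L i).f (.inl x) (.inl y) (.inr c) = 1 from ⟨fun h => h.2, fun h' => ⟨h, h'⟩⟩), ind_zo1]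

lemma LvD_fsame3 (i : Fin 3) (x y z : ZMod k × Bool) :
    (LvD k Q Qs D D' Jf td L).sys.f (.inl (i, x)) (.inl (i, y)) (.inl (i, z)) = (L i).f (.inl x) (.inl y) (.inl z) := by
  show (LvD k Q Qs D D' Jf td L).l3 i i i x y z = _
  unfold Lv.l3
  rw [if_pos rfl, if_pos rfl]; rfl

end glue
end DataPlacement

namespace DataPlacement
open Finset
set_option linter.unusedVariables false
set_option linter.unusedSimpArgs false
set_option linter.unusedSectionVars false
set_option linter.unnecessarySeqFocus false

lemma sys_all {U ι : Type} [Fintype U] [Fintype ι] (S : Sys ((Fin 3 × U) ⊕ ι))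
    (g : (Fin 3 × U) ⊕ ι → (Fin 3 × U) ⊕ ι → ℤ) (gs : ∀ x y, g x y = g y x)
    (h1 : ∀ i x y, x ≠ y → cnt S (.inl (i, x)) (.inl (i, y)) = g (.inl (i, x)) (.inl (i, y)))
    (h2 : ∀ i x z, cnt S (.inl (i, x)) (.inl (i + 1, z)) = g (.inl (i, x)) (.inl (i + 1, z)))
    (h3 : ∀ c i x, cnt S (.inr c) (.inl (i, x)) = g (.inr c) (.inl (i, x)))
    (h4 : ∀ c d, c ≠ d → cnt S (.inr c) (.inr d) = g (.inr c) (.inr d)) :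
    ∀ x y, x ≠ y → cnt S x y = g x y := by
  have key : ∀ i j : Fin 3, i = j ∨ j = i + 1 ∨ i = j + 1 := by decide
  rintro (⟨i, x⟩ | c) (⟨j, y⟩ | d) hne
  · rcases key i j with rfl | rfl | rfl
    · exact h1 _ _ _ (by rintro rfl; exact hne rfl)
    · exact h2 _ _ _
    · rw [cnt_comm, gs]; exact h2 _ _ _
  · rw [cnt_comm, gs]; exact h3 _ _ _
  · exact h3 _ _ _
  · exact h4 _ _ (by rintro rfl; exact hne rfl)

/-- the finite part of a level -/
abbrev UU (k : ℕ) : Type := ZMod k × Bool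
/-- a level with two infinite points -/
abbrev VL (k : ℕ) : Type := UU k ⊕ Fin 2
/-- the glued point set -/
abbrev VG (k : ℕ) : Type := (Fin 3 × UU k) ⊕ Fin 2

/-- a glued system -/
structure Glu (k : ℕ) [NeZero k] (μ n : ℕ) (td : Prop) (L : Fin 3 → Sys (VL k)) (S : Sys (VG k)) : Prop where
  same : ∀ i x y, x ≠ y → cnt S (.inl (i, x)) (.inl (i, y)) = 2 * μ + cnt (L i) (.inl x) (.inl y)
  cross : ∀ i x z, cnt S (.inl (i, x)) (.inl (i + 1, z)) = 2 * μ + ind td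
  inf : ∀ c i x, cnt S (.inr c) (.inl (i, x)) = 2 * μ + cnt (L i) (.inr c) (.inl x)
  infs : cnt S (.inr 0) (.inr 1) = 6 * n + ∑ i, cnt (L i) (.inr 0) (.inr 1)
  fs : ∀ i x y c, S.f (.inl (i, x)) (.inl (i, y)) (.inr c) = (L i).f (.inl x) (.inl y) (.inr c)
  fs3 : ∀ i x y z, S.f (.inl (i, x)) (.inl (i, y)) (.inl (i, z)) = (L i).f (.inl x) (.inl y) (.inl z)
  fi : ∀ i x, x.1 = 0 → S.f (.inr 0) (.inr 1) (.inl (i, x)) = (L i).f (.inr 0) (.inr 1) (.inl x)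

lemma glue_exists (k : ℕ) [NeZero k] (μ n : ℕ) (td : Prop) (L : Fin 3 → Sys (VL k))
    (hμ : μ + 1 ≤ 2 * k) (hn : n + 1 ≤ k) (hnμ : 0 < n → 0 < μ)
    (hL : ∀ i x, (L i).f (.inr 0) (.inr 1) (.inl x) = 1 → x.1 = 0) : ∃ S, Glu k μ n td L S := by
  obtain ⟨Q, Qs, hQ, hQx⟩ := exists_Q k
  obtain ⟨D, hD, hD0, -⟩ := pick_set (G := ZMod k) (min μ k) 0 ∅ (by simp) (by simp [ZMod.card])
  obtain ⟨D', hD', -, hD'0⟩ := pick_set (G := ZMod k) (μ - min μ k) 1 {0} (by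
      intro h0 h; rw [mem_singleton] at h
      have := zmod_ne (u := k) 1 (by omega) (by omega)
      apply this; push_cast; exact h) (by simp [ZMod.card]; omega)
  obtain ⟨J, hJ, -, hJ0⟩ := pick_set (G := ZMod k) n 1 {0} (by
      intro h0 h; rw [mem_singleton] at h
      have := zmod_ne (u := k) 1 (by omega) (by omega)
      apply this; push_cast; exact h) (by simp [ZMod.card]; omega)
  have hJ0 := hJ0 0 (by simp)
  have hD'0 := hD'0 0 (by simp)
  have H : HypD k Q D D' J td L := by
    refine ⟨hQ, hQx, ?_, hD'0, fun _ => hJ0, ?_⟩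
    · intro x hx
      have : 0 < J.card := card_pos.mpr ⟨x, hx⟩
      exact hD0 (by omega)
    · intro i x h h'
      rw [hL i x h] at h'
      exact hJ0 h'
  have hc : (2 * ((D.card : ℤ) + D'.card)) = 2 * μ := by rw [hD, hD']; push_cast; omega
  refine ⟨(LvD k Q Qs D D' J td L).sys, ?_, ?_, ?_, ?_, fun _ _ _ _ => LvD_fsame _ _ _ _, fun _ _ _ _ => LvD_fsame3 _ _ _ _, ?_⟩
  · intro i x y h; rw [H.same i h, hc]
  · intro i x z; rw [H.cross, hc]
  · intro c i x; rw [H.inf, hc]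
  · rw [H.infs, hJ]
  · intro i x hx
    show ind ((0 : Fin 2) ≠ 1 ∧ (x.1 ∈ J ∨ _)) = _
    refine Eq.trans ?_ (ind_zo1 _ _ _ _)
    apply ind_congr
    rw [hx]
    simp [hJ0]

lemma exists_label {m : ℕ} {V W : Type} [Fintype V] [Fintype W] (hc : Fintype.card V = Fintype.card W)
    (a : Fin m → V) (ha : Function.Injective a) (b : Fin m → W) (hb : Function.Injective b) :
    ∃ e : W ≃ V, ∀ j, e (b j) = a j := by
  classical
  obtain ⟨e0⟩ : Nonempty (W ≃ V) := ⟨Fintype.equivOfCardEq hc.symm⟩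
  obtain ⟨g, hg⟩ := Equiv.Perm.exists_extending_pair (fun j => e0 (b j)) a (e0.injective.comp hb) ha
  exact ⟨e0.trans g, fun j => by simp [hg]⟩

/-- a level -/
structure IsLvl {k : ℕ} [NeZero k] (L : Sys (VL k)) (τ : VL k → VL k) (σ : VL k → ℤ) (s : ℤ) : Prop where
  md : IsMD L 1 τ σ
  t0 : τ (.inr 0) = .inr 1
  s0 : σ (.inr 0) = s
  hz : ∀ x, L.f (.inr 0) (.inr 1) (.inl x) = 1 → x.1 = 0

lemma card_VL (k : ℕ) [NeZero k] : Fintype.card (VL k) = 2 * k + 2 := by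
  simp [ZMod.card]; ring
lemma card_VG (k : ℕ) [NeZero k] : Fintype.card (VG k) = 6 * k + 2 := by
  simp [ZMod.card]; ring

lemma exists_sign {V : Type} [Fintype V] {σ : V → ℤ} (pm : ∀ x, σ x = 1 ∨ σ x = -1) {s : ℤ} (hs : s = 1 ∨ s = -1)
    (h : s * ∑ x, σ x + Fintype.card V > 0) : ∃ x, σ x = s := by
  by_contra hn
  push Not at hn
  have : ∀ x, σ x = -s := by
    intro x
    have := hn x
    rcases pm x with h | h <;> rcases hs with h' | h'
    · exact absurd (h.trans h'.symm) this
    · rw [h, h']; rfl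
    · rw [h, h']
    · exact absurd (h.trans h'.symm) this
  simp only [this, Finset.sum_const, card_univ] at h
  rcases hs with h' | h' <;> subst h' <;> simp at h

lemma cnt_two {V : Type} [Fintype V] {S : Sys V} {x y : V} (h : cnt S x y = 2) :
    ∃ a b, a ≠ b ∧ ∀ z, S.f x y z = 1 → z = a ∨ z = b := by
  classical
  have h1 : ∑ z, ind (S.f x y z = 1) = 2 := by simp only [ind_zo1]; exact h
  rw [sum_ind_card] at h1
  have h2 := card_eq_two.mp (by exact_mod_cast h1)
  obtain ⟨a, b, hab, h3⟩ := h2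
  refine ⟨a, b, hab, fun z hz => ?_⟩
  have : z ∈ ({a, b} : Finset V) := by rw [← h3]; simpa using hz
  simpa using this

lemma exists_lvl (k : ℕ) [NeZero k] {E s : ℤ} (hs : s = 1 ∨ s = -1) (h : HasMD (2 * k + 2) 1 E)
    (hE : s * E + (2 * k + 2) > 0) : ∃ L τ σ, IsLvl (k := k) L τ σ s ∧ ∑ x, σ x = E := by
  obtain ⟨S, τ, σ, hm, ht⟩ := h
  rw [hm.tot] at ht
  obtain ⟨x, hx⟩ := exists_sign hm.pm hs (by rw [ht]; simp; linarith)
  have hc : Fintype.card (Fin (2 * k + 2)) = Fintype.card (VL k) := by rw [card_VL]; simp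
  have hxt := (hm.ne x).symm
  rcases hs with rfl | rfl
  · have h2 : cnt S x (τ x) = 2 := by rw [hm.ct _ _ hxt, ind_pos rfl, hx]; ring
    obtain ⟨a, b, hab, h3⟩ := cnt_two h2
    -- replace a, b by points outside
    have h4 : ∃ a b, a ≠ b ∧ a ≠ x ∧ a ≠ τ x ∧ b ≠ x ∧ b ≠ τ x ∧ ∀ z, S.f x (τ x) z = 1 → z = a ∨ z = b := by
      have hA : S.f x (τ x) a = 1 ∧ S.f x (τ x) b = 1 := by
        have h5 : ∑ z, S.f x (τ x) z = S.f x (τ x) a + S.f x (τ x) b := by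
          rw [← Finset.sum_pair hab]
          symm
          apply Finset.sum_subset (subset_univ _)
          intro z _ hz
          rcases S.zo x (τ x) z with h | h
          · exact h
          · exfalso; apply hz; simpa using h3 z h
        have h6 : ∑ z, S.f x (τ x) z = 2 := h2
        rcases S.zo x (τ x) a with h | h <;> rcases S.zo x (τ x) b with h' | h' <;> rw [h, h'] at h5 <;> constructor <;> omega
      refine ⟨a, b, hab, ?_, ?_, ?_, ?_, h3⟩
      · rintro rfl; rw [S.d13] at hA; exact absurd hA.1 (by norm_num)
      · rintro rfl; rw [S.d23] at hA; exact absurd hA.1 (by norm_num)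
      · rintro rfl; rw [S.d13] at hA; exact absurd hA.2 (by norm_num)
      · rintro rfl; rw [S.d23] at hA; exact absurd hA.2 (by norm_num)
    obtain ⟨a, b, hab, ha1, ha2, hb1, hb2, h3⟩ := h4
    obtain ⟨e, he⟩ := exists_label hc ![x, τ x, a, b] (by
        intro i j; fin_cases i <;> fin_cases j <;> simp_all [eq_comm]) ![.inr 0, .inr 1, .inl (0, false), .inl (0, true)] (by
        intro i j; fin_cases i <;> fin_cases j <;> simp)
    have e0 : e (.inr 0) = x := he 0
    have e1 : e (.inr 1) = τ x := he 1
    have e2 : e (.inl (0, false)) = a := he 2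
    have e3 : e (.inl (0, true)) = b := he 3
    refine ⟨_, _, _, ⟨hm.map e, ?_, ?_, ?_⟩, ?_⟩
    · rw [Equiv.symm_apply_eq, e0, e1]
    · rw [e0, hx]
    · intro y hy
      change S.f (e _) (e _) (e _) = 1 at hy
      rw [e0, e1] at hy
      rcases h3 _ hy with h | h
      · rw [← e2] at h; have := e.injective h; simp at this; rw [this]
      · rw [← e3] at h; have := e.injective h; simp at this; rw [this]
    · rw [← ht]; exact Equiv.sum_comp e σ
  · have h2 : cnt S x (τ x) = 0 := by rw [hm.ct _ _ hxt, ind_pos rfl, hx]; ring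
    obtain ⟨e, he⟩ := exists_label hc ![x, τ x] (by
        intro i j; fin_cases i <;> fin_cases j <;> simp_all [eq_comm]) ![.inr 0, .inr 1] (by
        intro i j; fin_cases i <;> fin_cases j <;> simp)
    have e0 : e (.inr 0) = x := he 0
    have e1 : e (.inr 1) = τ x := he 1
    refine ⟨_, _, _, ⟨hm.map e, ?_, ?_, ?_⟩, ?_⟩
    · rw [Equiv.symm_apply_eq, e0, e1]
    · rw [e0, hx]
    · intro y hy
      change S.f (e _) (e _) (e _) = 1 at hy
      rw [e0, e1, f_of_cnt_zero h2] at hy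
      exact absurd hy (by norm_num)
    · rw [← ht]; exact Equiv.sum_comp e σ
end DataPlacement

namespace DataPlacement
open Finset
set_option linter.unusedVariables false
set_option linter.unusedSimpArgs false
set_option linter.unusedSectionVars false
set_option linter.unnecessarySeqFocus false

section
variable {k : ℕ} [NeZero k]

/-- glued partner -/
def tG (t : Fin 3 → UU k → UU k) : VG k → VG k := Sum.elim (fun p => .inl (p.1, t p.1 p.2)) (fun c => .inr (c + 1))
/-- glued sign -/
def sG (σ : Fin 3 → VL k → ℤ) (σ0 : ℤ) : VG k → ℤ := Sum.elim (fun p => σ p.1 (.inl p.2)) (fun _ => σ0)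

lemma IsLvl.t1 {L : Sys (VL k)} {τ : VL k → VL k} {σ : VL k → ℤ} {s : ℤ} (h : IsLvl L τ σ s) : τ (.inr 1) = .inr 0 := by
  rw [← h.t0, h.md.inv]
lemma IsLvl.s1 {L : Sys (VL k)} {τ : VL k → VL k} {σ : VL k → ℤ} {s : ℤ} (h : IsLvl L τ σ s) : σ (.inr 1) = s := by
  rw [← h.t0, h.md.sg, h.s0]

lemma IsLvl.fin {L : Sys (VL k)} {τ : VL k → VL k} {σ : VL k → ℤ} {s : ℤ} (h : IsLvl L τ σ s) (x : UU k) :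
    ∃ y, τ (.inl x) = .inl y := by
  rcases hx : τ (.inl x) with y | c
  · exact ⟨y, rfl⟩
  · have h1 := h.md.inv (.inl x)
    rw [hx] at h1
    fin_cases c
    · have := h.t0.symm.trans h1; exact absurd this (by simp)
    · have := h.t1.symm.trans h1; exact absurd this (by simp)

lemma glue_isMD {μ n : ℕ} {L : Fin 3 → Sys (VL k)} {S : Sys (VG k)} (G : Glu k μ n True L S)
    {τ : Fin 3 → VL k → VL k} {σ : Fin 3 → VL k → ℤ} {s : Fin 3 → ℤ} (hl : ∀ i, IsLvl (L i) (τ i) (σ i) (s i))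
    {t : Fin 3 → UU k → UU k} (ht : ∀ i x, τ i (.inl x) = .inl (t i x)) {σ0 : ℤ} (hσ : σ0 = 1 ∨ σ0 = -1)
    (hs : 6 * n + ∑ i, (1 + s i) = 2 * μ + 1 + σ0) : IsMD S (2 * μ + 1) (tG t) (sG σ σ0) := by
  have tinv : ∀ i x, t i (t i x) = x := by
    intro i x
    have := (hl i).md.inv (.inl x)
    rw [ht, ht] at this
    exact Sum.inl_injective this
  have inv : ∀ x, tG t (tG t x) = x := by
    rintro (⟨i, x⟩ | c)
    · simp [tG, tinv]
    · fin_cases c <;> rfl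
  have sg : ∀ x, sG σ σ0 (tG t x) = sG σ σ0 x := by
    rintro (⟨i, x⟩ | c)
    · simp only [tG, sG, Sum.elim_inl]
      rw [← ht, (hl i).md.sg]
    · rfl
  refine ⟨inv, ?_, sg, ?_, ?_⟩
  · rintro (⟨i, x⟩ | c)
    · simp only [tG, Sum.elim_inl]
      intro h
      simp only [Sum.inl.injEq, Prod.mk.injEq, true_and] at h
      apply (hl i).md.ne (.inl x)
      rw [ht, h]
    · fin_cases c <;> simp [tG]
  · rintro (⟨i, x⟩ | c)
    · exact (hl i).md.pm _
    · exact hσ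
  · apply sys_all
    · intro x y; rw [md_symm inv sg]
    · intro i x y hxy
      rw [G.same i x y hxy, (hl i).md.ct _ _ (by simpa using hxy), ht]
      simp only [tG, sG, Sum.elim_inl, Sum.inl.injEq, Prod.mk.injEq, true_and]
      ring
    · intro i x z
      rw [G.cross, ind_neg (P := (_ = _))]
      · simp [ind]
      · simp [tG]
    · intro c i x
      rw [G.inf, (hl i).md.ct _ _ (by simp)]
      rw [ind_neg, ind_neg]
      · ring
      · simp [tG]
      · fin_cases c
        · have := (hl i).t0; simp only [Fin.zero_eta]; rw [this]; simp
        · have := (hl i).t1; simp only [Fin.mk_one]; rw [this]; simp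
    · have h01 : cnt S (.inr 0) (.inr 1) = 2 * μ + 1 + σ0 := by
        rw [G.infs, ← hs]
        congr 1
        refine Finset.sum_congr rfl fun i _ => ?_
        rw [(hl i).md.ct _ _ (by simp), ind_pos (hl i).t0.symm, (hl i).s0]; ring
      intro c d hcd
      have : ind ((Sum.inr d : VG k) = tG t (.inr c)) = 1 := by
        apply ind_pos
        fin_cases c <;> fin_cases d <;> first | exact absurd rfl hcd | rfl
      rw [this]
      simp only [sG, Sum.elim_inr, one_mul]
      rw [← h01]
      fin_cases c <;> fin_cases d <;> first | exact absurd rfl hcd | rfl | exact cnt_comm _ _ _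

lemma IsLvl.fsum {L : Sys (VL k)} {τ : VL k → VL k} {σ : VL k → ℤ} {s : ℤ} (h : IsLvl L τ σ s) :
    ∑ x, σ (.inl x) = ∑ x, σ x - 2 * s := by
  rw [Fintype.sum_sum_type, Fin.sum_univ_two, h.s0, h.s1]; ring

lemma two_minus {V : Type} [Fintype V] {σ : V → ℤ} {t : V → V} (pm : ∀ x, σ x = 1 ∨ σ x = -1)
    (h : ∑ x, σ x < Fintype.card V - 4) : ∃ x y, σ x = -1 ∧ σ y = -1 ∧ y ≠ x ∧ y ≠ t x := by
  classical
  obtain ⟨x, hx⟩ := exists_sign pm (s := -1) (Or.inr rfl) (by linarith)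
  by_contra hn
  push Not at hn
  have h1 : ∀ y, σ y ≥ 1 - 2 * ind (y = x) - 2 * ind (y = t x) := by
    intro y
    by_cases hy : y = x
    · rw [ind_pos hy]; rcases ind_zo (y = t x) with h | h <;> rw [h] <;> rcases pm y with h' | h' <;> rw [h'] <;> norm_num
    · by_cases hy' : y = t x
      · rw [ind_pos hy', ind_neg hy]; rcases pm y with h' | h' <;> rw [h'] <;> norm_num
      · rw [ind_neg hy, ind_neg hy']
        rcases pm y with h' | h'
        · rw [h']; norm_num
        · exact absurd (hn x y hx h' hy) hy'
  have h2 := Finset.sum_le_sum (s := univ) fun y _ => h1 y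
  rw [Finset.sum_sub_distrib, Finset.sum_sub_distrib, ← Finset.mul_sum, ← Finset.mul_sum, sum_ind_eq, sum_ind_eq] at h2
  simp at h2
  linarith

lemma glue_main (k μ n : ℕ) (hk : 0 < k) (hμ : μ + 1 ≤ 2 * k) (hn : n + 1 ≤ k) (hnμ : 0 < n → 0 < μ)
    (s : Fin 3 → ℤ) (f : Fin 3 → ℕ) (σ0 : ℤ) (hs1 : ∀ i, s i = 1 ∨ s i = -1) (hf : ∀ i, f i ≤ k) (hσ : σ0 = 1 ∨ σ0 = -1)
    (hm : ∀ i, HasMD (2 * k + 2) 1 (4 * f i - 2 * k + 2 * s i))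
    (hs : 6 * n + ∑ i, (1 + s i) = 2 * μ + 1 + σ0) :
    HasMD (6 * k + 2) (2 * μ + 1) (4 * (f 0 + f 1 + f 2) - 6 * k + 2 * σ0) ∧
    ((σ0 = -1 ∧ f 0 + f 1 + f 2 < 3 * k) ∨ (∃ i, f i + 2 ≤ k) →
      HasStar (6 * k + 2) (2 * μ + 1) (4 * (f 0 + f 1 + f 2) - 6 * k + 2 * σ0 + 6)) := by
  have : NeZero k := ⟨by omega⟩
  have h1 : ∀ i, ∃ L τ σ, IsLvl (k := k) L τ σ (s i) ∧ ∑ x, σ x = (4 * f i - 2 * k + 2 * s i : ℤ) := by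
    intro i
    have := hf i
    refine exists_lvl k (hs1 i) (hm i) ?_
    rcases hs1 i with h | h <;> rw [h] <;> omega
  choose L τ σ hl hE using h1
  choose t ht using fun i => (hl i).fin
  obtain ⟨S, G⟩ := glue_exists k μ n True L hμ hn hnμ (fun i => (hl i).hz)
  have H := glue_isMD G hl ht hσ hs
  have hfin : ∀ i, ∑ x, σ i (.inl x) = 4 * f i - 2 * k := by
    intro i; rw [(hl i).fsum, hE]; ring
  have hU : Fintype.card (UU k) = 2 * k := by simp [ZMod.card]; ring
  have htot : totDef S (2 * μ + 1) = 4 * (f 0 + f 1 + f 2) - 6 * k + 2 * σ0 := by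
    rw [H.tot]
    have : ∑ x, sG σ σ0 x = ∑ i, ∑ x, σ i (.inl x) + ∑ c : Fin 2, σ0 := by
      rw [Fintype.sum_sum_type, Fintype.sum_prod_type]; rfl
    rw [this]
    simp only [hfin, Fin.sum_univ_three, Fin.sum_univ_two]
    ring
  refine ⟨H.has (card_VG k) htot, ?_⟩
  have hc0 : ∀ i x, σ i (.inl x) = -1 → cnt (L i) (.inl x) (.inl (t i x)) = 0 := by
    intro i x hx
    have h1 := (hl i).md.ne (.inl x)
    rw [ht] at h1
    rw [(hl i).md.ct _ _ h1.symm, ind_pos (ht i x).symm, hx]; ring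
  rintro (⟨h0, hF⟩ | ⟨i, hi⟩)
  · have : ∃ i, f i < k := by
      by_contra hcon
      push Not at hcon
      have h0 := hcon 0
      have h1 := hcon 1
      have h2 := hcon 2
      omega
    obtain ⟨i, hi⟩ := this
    obtain ⟨x, hx⟩ := exists_sign (fun x => (hl i).md.pm (.inl x)) (s := -1) (Or.inr rfl) (by rw [hfin, hU]; push_cast; omega)
    have hfz : S.f (.inl (i, x)) (tG t (.inl (i, x))) (.inr 0) = 0 := by
      show S.f (.inl (i, x)) (.inl (i, t i x)) (.inr 0) = 0
      rw [G.fs, f_of_cnt_zero (hc0 i x hx)]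
    have := H.toggle_star (p := .inl (i, x)) (r := .inr 0) (s := 1) (Or.inl rfl) hx (by exact h0) (by simp) (by simp [tG]) (by rw [hfz]; ring)
    refine this.has (card_VG k) ?_
    rw [totDef_toggle, hfz, htot]; ring
  · obtain ⟨x, y, hx, hy, hyx, hyt⟩ := two_minus (σ := fun x => σ i (.inl x)) (t := t i) (fun x => (hl i).md.pm (.inl x)) (by rw [hfin, hU]; push_cast; omega)
    have hfz : S.f (.inl (i, x)) (tG t (.inl (i, x))) (.inl (i, y)) = 0 := by
      show S.f (.inl (i, x)) (.inl (i, t i x)) (.inl (i, y)) = 0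
      rw [G.fs3, f_of_cnt_zero (hc0 i x hx)]
    have := H.toggle_star (p := .inl (i, x)) (r := .inl (i, y)) (s := 1) (Or.inl rfl) hx hy (by simpa using hyx) (by simpa [tG] using hyt) (by rw [hfz]; ring)
    refine this.has (card_VG k) ?_
    rw [totDef_toggle, hfz, htot]; ring
end

/-- triangles for v = 2 mod 6 -/
lemma claimC2 (k μ : ℕ) (s : ℤ) (h0 : 0 < μ) (hμ : 2 * μ + 1 ≤ 6 * k)
    (hs : ((2 * μ) % 3 = 1 ∧ s = -1) ∨ ((2 * μ) % 3 = 2 ∧ s = 1)) : HasTri (6 * k + 2) (2 * μ) s := by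
  have low : ∀ μ : ℕ, ∀ s : ℤ, 0 < μ → 2 * μ ≤ 3 * k → ((2 * μ) % 3 = 1 ∧ s = -1) ∨ ((2 * μ) % 3 = 2 ∧ s = 1) →
      HasTri (6 * k + 2) (2 * μ) s := by
    intro μ s h0 hμ hs
    have : NeZero k := ⟨by omega⟩
    obtain ⟨n, hn⟩ : ∃ n : ℕ, (6 * n : ℤ) = 2 * μ - 2 * s := by
      rcases hs with ⟨h, rfl⟩ | ⟨h, rfl⟩
      · exact ⟨(2 * μ + 2) / 6, by omega⟩
      · exact ⟨(2 * μ - 2) / 6, by omega⟩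
    obtain ⟨S, G⟩ := glue_exists k μ n False (fun _ => Sys.nil _) (by omega) (by omega) (by omega) (by
      intro i x h; exact absurd h (by simp [Sys.nil]))
    have hc : ∀ x y, cnt (Sys.nil (VL k)) x y = 0 := by intro x y; simp [cnt, Sys.nil]
    refine tri_of_single (card_VG k) (S := S) (a := .inr 0) (b := .inr 1) (by tauto) (by simp) ?_ (by omega) (by push_cast; omega)
    apply sys_all
    · intro x y; rw [pr_symm]
    · intro i x y h
      rw [G.same i x y h, hc]; simp [pr, ind]
    · intro i x z
      rw [G.cross]; simp [pr, ind]
    · intro c i x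
      rw [G.inf, hc]; simp [pr, ind]
    · have h01 : cnt S (.inr 0) (.inr 1) = 2 * μ - 2 * s := by
        rw [G.infs]; simp only [hc]; simp [hn]
      intro c d hcd
      fin_cases c <;> fin_cases d
      · exact absurd rfl hcd
      · refine h01.trans ?_; simp [pr, ind]
      · refine ((cnt_comm _ _ _).trans h01).trans ?_; simp [pr, ind]
      · exact absurd rfl hcd
  by_cases h : 2 * μ ≤ 3 * k
  · exact low μ s h0 h hs
  · have := (low (3 * k - μ) (-s) (by omega) (by omega) (by omega)).compl
    rw [neg_neg] at this
    convert this using 1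
    rw [Nat.cast_sub (by omega)]; push_cast; ring
end DataPlacement

namespace DataPlacement
open Finset
set_option linter.unusedVariables false
set_option linter.unusedSimpArgs false
set_option linter.unusedSectionVars false
set_option linter.unnecessarySeqFocus false

section
variable (k : ℕ) [NeZero k]

/-- the construction with as many positive edges as possible -/
noncomputable def LvT (Q : UU k → UU k → UU k) (Qs : ∀ x y, Q x y = Q y x) : Lv (UU k) (Fin 2) where
  Q := Q
  g1 i q z := z = q
  g2 i q z := False
  T x y z := x = y ∧ y = z ∧ x.2 = false
  W i := Sys.nil _
  I c i x z := x.1 = z.1 ∧ x.2 = decide (c = 0) ∧ z.2 = decide (c = 1)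
  J c i x y := False
  K c d i x := False
  Qs := Qs
  Js c i x y := Iff.rfl
  Ks c d i x := Iff.rfl

/-- partner -/
def tT : VG k → VG k
  | .inl (i, (a, false)) => .inl (i + 1, (a, true))
  | .inl (i, (a, true)) => .inl (i + 2, (a, false))
  | .inr c => .inr (c + 1)
/-- sign -/
def sT : VG k → ℤ
  | .inl _ => 1
  | .inr _ => -1

lemma topMD : HasMD (6 * k + 2) 1 (6 * k - 2) := by
  classical
  obtain ⟨Q, Qs, hQ, hQx⟩ := exists_Q k
  have f3 : ∀ i : Fin 3, i + 1 + 2 = i := by decide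
  have f3' : ∀ i : Fin 3, i + 2 + 1 = i := by decide
  have f2 : ∀ i : Fin 2, i + 1 + 1 = i := by decide
  have inv : ∀ x, tT k (tT k x) = x := by
    rintro (⟨i, a, _ | _⟩ | c) <;> simp [tT, f3, f3', f2]
  have sg : ∀ x, sT k (tT k x) = sT k x := by
    rintro (⟨i, a, _ | _⟩ | c) <;> simp [tT, sT]
  have H : IsMD (LvT k Q Qs).sys 1 (tT k) (sT k) := by
    refine ⟨inv, ?_, sg, ?_, ?_⟩
    · rintro (⟨i, a, _ | _⟩ | c) <;> simp [tT]
    · rintro (⟨i, a, _ | _⟩ | c) <;> simp [sT]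
    · apply Lv.all
      · intro x y; rw [md_symm inv sg]
      · intro i x y hxy
        rw [Lv.cnt_same _ _ hxy]
        have : ind ((Sum.inl (i, y) : VG k) = tT k (.inl (i, x))) = 0 := by
          apply ind_neg
          obtain ⟨a, _ | _⟩ := x <;> simp [tT]
        rw [this]
        simp [LvT, Sys.nil, ind_false, sum_ind_eq]
      · intro i x z
        rw [Lv.cnt_cross _ hQ]
        have htc : (LvT k Q Qs).tc i x z = ind (x = z ∧ x.2 = false) := by
          unfold Lv.tc
          simp only [LvT]
          split_ifs
          · rw [sum_unique]
            · apply ind_congr; constructor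
              · rintro ⟨w, h1, h2, h3⟩; exact ⟨h1, h3⟩
              · rintro ⟨h1, h3⟩; exact ⟨_, h1, rfl, h3⟩
            · rintro w w' h h'; exact h.2.1.symm.trans h'.2.1
          · rw [sum_unique]
            · apply ind_congr; constructor
              · rintro ⟨w, h1, h2, h3⟩; exact ⟨h2, h1 ▸ h3⟩
              · rintro ⟨h1, h3⟩; exact ⟨_, rfl, h1, h3⟩
            · rintro w w' h h'; exact h.1.trans h'.1.symm
          · rw [sum_unique]
            · apply ind_congr; constructor
              · rintro ⟨w, h1, h2, h3⟩
                have := h1.trans h2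
                exact ⟨this.symm, this ▸ h3⟩
              · rintro ⟨h1, h3⟩; exact ⟨z, rfl, h1.symm, h1 ▸ h3⟩
            · rintro w w' h h'; exact h.1.symm.trans h'.1
        rw [htc, Fin.sum_univ_two]
        simp only [LvT, hQx, ind_false, sum_ind_eq']
        obtain ⟨a, _ | _⟩ := x <;> obtain ⟨b, _ | _⟩ := z <;> by_cases hab : a = b <;>
          simp [hab, ind, tT, sT, eq_comm]
      · intro c i x
        rw [Lv.cnt_inf]
        have : ind ((Sum.inl (i, x) : VG k) = tT k (.inr c)) = 0 := by
          apply ind_neg; simp [tT]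
        rw [this]
        simp only [LvT, and_false, ind_false, Finset.sum_const_zero]
        rw [sum_unique, sum_unique]
        · obtain ⟨a, _ | _⟩ := x <;> fin_cases c <;> simp [ind, Prod.exists]
        · rintro ⟨w, w1⟩ ⟨w', w1'⟩ ⟨h1, h2, h3⟩ ⟨h1', h2', h3'⟩
          simp only at h1 h2 h3 h1' h2' h3'
          rw [h1, h2, h1', h2']
        · rintro ⟨w, w1⟩ ⟨w', w1'⟩ ⟨h1, h2, h3⟩ ⟨h1', h2', h3'⟩
          simp only at h1 h2 h3 h1' h2' h3'
          rw [← h1, h3, ← h1', h3']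
      · intro c d h
        rw [Lv.cnt_infs _ h]
        have : d = c + 1 := by revert h; revert c d; decide
        simp [LvT, ind_false, tT, this, ind_true, sT]
  refine H.has (card_VG k) ?_
  rw [H.tot, Fintype.sum_sum_type]
  simp [sT, ZMod.card]; ring

end

/-- admissible number of positive edges at index one -/
def okd (w d : ℕ) : Prop := d ≤ w ∧ ((d % 3 = 1 ∧ w % 3 = 2) ∨ (d % 3 = 0 ∧ w % 3 ≠ 2))

/-- index one for all admissible numbers of positive edges -/
def PW (w : ℕ) : Prop := ∀ d, okd w d → HasMD (2 * w) 1 (4 * d - 2 * w)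

lemma glueN {k : ℕ} (hP : PW (k + 1)) (μ n ns : ℕ) (f0 f1 f2 : ℕ) (σ0 : ℤ) (hk : 0 < k) (hμ : μ + 1 ≤ 2 * k)
    (hn : n + 1 ≤ k) (hnμ : 0 < n → 0 < μ) (h0 : f0 ≤ k) (h1 : f1 ≤ k) (h2 : f2 ≤ k) (hns : ns ≤ 3)
    (hσ : σ0 = 1 ∨ σ0 = -1)
    (o0 : okd (k + 1) (f0 + if 0 < ns then 1 else 0)) (o1 : okd (k + 1) (f1 + if 1 < ns then 1 else 0))
    (o2 : okd (k + 1) (f2 + if 2 < ns then 1 else 0)) (hs : (6 * n + 2 * ns : ℤ) = 2 * μ + 1 + σ0) :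
    HasMD (6 * k + 2) (2 * μ + 1) (4 * (f0 + f1 + f2) - 6 * k + 2 * σ0) ∧
    ((σ0 = -1 ∧ f0 + f1 + f2 < 3 * k) ∨ f0 + 2 ≤ k ∨ f1 + 2 ≤ k ∨ f2 + 2 ≤ k →
      HasStar (6 * k + 2) (2 * μ + 1) (4 * (f0 + f1 + f2) - 6 * k + 2 * σ0 + 6)) := by
  have key : ∀ (f j : ℕ), okd (k + 1) (f + if j < ns then 1 else 0) →
      HasMD (2 * k + 2) 1 (4 * f - 2 * k + 2 * (if j < ns then (1 : ℤ) else -1)) := by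
    intro f j h
    have := hP _ h
    convert this using 1
    · ring
    · split_ifs <;> push_cast <;> ring
  have := glue_main k μ n hk hμ hn hnμ ![if 0 < ns then (1 : ℤ) else -1, if 1 < ns then (1 : ℤ) else -1,
    if 2 < ns then (1 : ℤ) else -1] ![f0, f1, f2] σ0 (by
      intro i; fin_cases i <;> simp <;> omega) (by
      intro i; fin_cases i <;> simpa) hσ (by
      intro i; fin_cases i
      · exact key _ _ o0
      · exact key _ _ o1
      · exact key _ _ o2) (by
      rw [← hs, Fin.sum_univ_three]
      simp only [Matrix.cons_val_zero, Matrix.cons_val_one, Matrix.cons_val]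
      interval_cases ns <;> norm_num)
  refine ⟨this.1, fun h => this.2 ?_⟩
  rcases h with h | h | h | h
  · exact Or.inl h
  · exact Or.inr ⟨0, h⟩
  · exact Or.inr ⟨1, h⟩
  · exact Or.inr ⟨2, h⟩

lemma split3 (m a b c : ℕ) (h : m ≤ a + b + c) : ∃ x y z, x ≤ a ∧ y ≤ b ∧ z ≤ c ∧ x + y + z = m :=
  ⟨min m a, min (m - a) b, m - a - b, by omega, by omega, by omega, by omega⟩

lemma glueF {k : ℕ} (hP : PW (k + 1)) (μ n ns F : ℕ) (σ0 : ℤ) (lm lp M N : ℕ) (hk : 0 < k) (hμ : μ + 1 ≤ 2 * k)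
    (hn : n + 1 ≤ k) (hnμ : 0 < n → 0 < μ) (hns : ns ≤ 3)
    (hσ : σ0 = 1 ∨ σ0 = -1) (hs : (6 * n + 2 * ns : ℤ) = 2 * μ + 1 + σ0)
    (om : ns < 3 → ∀ x ≤ M, lm + 3 * x ≤ k ∧ okd (k + 1) (lm + 3 * x))
    (op : 0 < ns → ∀ x ≤ N, lp + 3 * x ≤ k ∧ okd (k + 1) (lp + 3 * x + 1))
    (m : ℕ) (hF : F = ns * lp + (3 - ns) * lm + 3 * m) (hm : m ≤ ns * N + (3 - ns) * M) :
    HasMD (6 * k + 2) (2 * μ + 1) (4 * F - 6 * k + 2 * σ0) ∧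
    ((σ0 = -1 ∧ F < 3 * k) ∨ F + 6 ≤ 3 * k →
      HasStar (6 * k + 2) (2 * μ + 1) (4 * F - 6 * k + 2 * σ0 + 6)) := by
  have fin : ∀ f0 f1 f2 : ℕ, f0 + f1 + f2 = F → f0 ≤ k → f1 ≤ k → f2 ≤ k →
      okd (k + 1) (f0 + if 0 < ns then 1 else 0) → okd (k + 1) (f1 + if 1 < ns then 1 else 0) →
      okd (k + 1) (f2 + if 2 < ns then 1 else 0) → 
      HasMD (6 * k + 2) (2 * μ + 1) (4 * F - 6 * k + 2 * σ0) ∧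
    ((σ0 = -1 ∧ F < 3 * k) ∨ F + 6 ≤ 3 * k →
      HasStar (6 * k + 2) (2 * μ + 1) (4 * F - 6 * k + 2 * σ0 + 6)) := by
    intro f0 f1 f2 hF h0 h1 h2 o0 o1 o2
    have := glueN hP μ n ns f0 f1 f2 σ0 hk hμ hn hnμ h0 h1 h2 hns hσ o0 o1 o2 hs
    rw [← hF]; push_cast
    exact ⟨this.1, fun h => this.2 (by omega)⟩
  interval_cases ns
  · obtain ⟨x, y, z, hx, hy, hz, hxyz⟩ := split3 m M M M (by omega)
    have h := om (by norm_num)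
    exact fin (lm + 3 * x) (lm + 3 * y) (lm + 3 * z) (by omega) (h x hx).1 (h y hy).1 (h z hz).1 (by simpa using (h x hx).2)
      (by simpa using (h y hy).2) (by simpa using (h z hz).2)
  · obtain ⟨x, y, z, hx, hy, hz, hxyz⟩ := split3 m N M M (by omega)
    have h := om (by norm_num)
    have h' := op (by norm_num)
    exact fin (lp + 3 * x) (lm + 3 * y) (lm + 3 * z) (by omega) (h' x hx).1 (h y hy).1 (h z hz).1 (by simpa using (h' x hx).2)
      (by simpa using (h y hy).2) (by simpa using (h z hz).2)
  · obtain ⟨x, y, z, hx, hy, hz, hxyz⟩ := split3 m N N M (by omega)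
    have h := om (by norm_num)
    have h' := op (by norm_num)
    exact fin (lp + 3 * x) (lp + 3 * y) (lm + 3 * z) (by omega) (h' x hx).1 (h' y hy).1 (h z hz).1 (by simpa using (h' x hx).2)
      (by simpa using (h' y hy).2) (by simpa using (h z hz).2)
  · obtain ⟨x, y, z, hx, hy, hz, hxyz⟩ := split3 m N N N (by omega)
    have h' := op (by norm_num)
    exact fin (lp + 3 * x) (lp + 3 * y) (lp + 3 * z) (by omega) (h' x hx).1 (h' y hy).1 (h' z hz).1 (by simpa using (h' x hx).2)
      (by simpa using (h' y hy).2) (by simpa using (h' z hz).2)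

lemma PW_all (w : ℕ) : 2 ≤ w → PW w := by
  induction w using Nat.strong_induction_on with
  | _ w ih =>
  intro hw d hd
  unfold okd at hd
  have h3 : w % 3 = 0 ∨ w % 3 = 1 ∨ w % 3 = 2 := by omega
  rcases h3 with h | h | h
  · obtain ⟨k, rfl⟩ : ∃ k, w = 3 * k := ⟨w / 3, by omega⟩
    obtain ⟨j, rfl⟩ : ∃ j, d = 3 * j := ⟨d / 3, by omega⟩
    have := (claimA_aux k 0 j (by omega) (by omega) (by omega) (by omega)).1
    convert this using 1
    · ring
    · simp
    · push_cast; ring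
  · obtain ⟨k, rfl⟩ : ∃ k, w = 3 * k + 1 := ⟨w / 3, by omega⟩
    have hP := ih (k + 1) (by omega) (by omega)
    have conv : ∀ E : ℤ, HasMD (6 * k + 2) 1 E → E = 4 * d - 2 * (3 * k + 1 : ℕ) → HasMD (2 * (3 * k + 1)) 1 (4 * d - 2 * (3 * k + 1 : ℕ)) := by
      intro E h hE
      rw [← hE]; convert h using 1; ring
    by_cases k0 : d = 0 ∧ k % 3 = 1
    · exact conv _ (sts_md k) (by rw [k0.1]; push_cast; ring)
    by_cases k1 : d = 3 * k
    · have : NeZero k := ⟨by omega⟩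
      exact conv _ (topMD k) (by rw [k1]; push_cast; ring)
    by_cases k2 : d = 3 * k - 3 ∧ k % 3 = 2
    · have := (glueF hP 0 0 1 (3 * k - 4) 1 0 2 ((k - 2) / 3) ((k - 2) / 3) (by omega) (by omega) (by omega) (by omega) (by omega)
        (by omega) (by norm_num) (by intro _ x hx; unfold okd; omega) (by intro _ x hx; unfold okd; omega) (k - 2) (by omega) (by omega)).1
      refine conv _ this ?_
      omega
    have := (glueF hP 0 0 0 d (-1) (if k % 3 = 1 then 1 else 0) 0 (k / 3) 0 (by omega) (by omega) (by omega) (by omega) (by omega)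
        (by omega) (by norm_num) (by intro _ x hx; unfold okd; split_ifs <;> omega) (by omega) ((d - 3 * (if k % 3 = 1 then 1 else 0)) / 3) (by split_ifs <;> omega) (by split_ifs <;> omega)).1
    exact conv _ this (by push_cast; ring)
  · obtain ⟨k, rfl⟩ : ∃ k, w = 3 * k + 2 := ⟨w / 3, by omega⟩
    obtain ⟨j, rfl⟩ : ∃ j, d = 3 * j + 1 := ⟨d / 3, by omega⟩
    have := (claimB_aux k 0 j (by omega) (by omega)).1
    convert this using 1
    · ring
    · simp
    · push_cast; ring
end DataPlacement

namespace DataPlacement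
open Finset
set_option linter.unusedVariables false
set_option linter.unusedSimpArgs false
set_option linter.unusedSectionVars false
set_option linter.unnecessarySeqFocus false

lemma all_minus {V : Type} [Fintype V] {σ : V → ℤ} (pm : ∀ x, σ x = 1 ∨ σ x = -1)
    (h : ∑ x, σ x = -(Fintype.card V : ℤ)) : ∀ x, σ x = -1 := by
  have h1 : ∑ x, (σ x + 1) = 0 := by
    rw [Finset.sum_add_distrib, h]; simp
  rw [Finset.sum_eq_zero_iff_of_nonneg (by intro x _; rcases pm x with h | h <;> rw [h] <;> norm_num)] at h1
  intro x
  have := h1 x (mem_univ _)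
  linarith

/-- stars at index one -/
lemma star_one {v : ℕ} {E : ℤ} (h : HasMD v 1 E) (hE : E < v - 4) : HasStar v 1 (E + 6) := by
  obtain ⟨S, τ, σ, hm, ht⟩ := h
  have h1 := ht
  rw [hm.tot] at h1
  obtain ⟨x, y, hx, hy, hyx, hyt⟩ := two_minus (t := τ) hm.pm (by rw [h1]; simpa using hE)
  have h0 : cnt S x (τ x) = 0 := by rw [hm.ct _ _ (hm.ne x).symm, ind_pos rfl, hx]; ring
  have hf : S.f x (τ x) y = 0 := f_of_cnt_zero h0 y
  have := hm.toggle_star (p := x) (r := y) (s := 1) (Or.inl rfl) hx hy hyx hyt (by rw [hf]; ring)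
  refine this.has (by simp) ?_
  rw [totDef_toggle, hf, ht]; ring

/-- star from a near matching -/
lemma star_almost {V : Type} [Fintype V] {S : Sys V} {l : ℤ} {τ : V → V} {p q : V} (inv : ∀ x, τ (τ x) = x)
    (ne : ∀ x, τ x ≠ x) (hpq : p ≠ q) (hqp : q ≠ τ p)
    (ct : ∀ x y, x ≠ y → cnt S x y = l - 2 * pr p q x y + ind (y = τ x) * (-1)) (hf : S.f p q (τ q) = 0)
    (h1 : p ≠ τ q) : IsStar (S.toggle p q (τ q) hpq h1 (ne q).symm) l p (τ p) q (τ q) (-1) τ (fun _ => -1) := by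
  have inj : ∀ x y, τ x = τ y → x = y := by
    intro x y h; rw [← inv x, h, inv]
  refine ⟨(ne p).symm, hpq, h1, hqp.symm, ?_, (ne q).symm, Or.inr rfl, ?_, fun x _ => inv x, fun x _ => ne x,
    fun _ _ => rfl, fun _ _ => Or.inr rfl, ?_⟩
  · intro h; exact hpq (inj _ _ h)
  · rintro x ⟨h2, h3, h4, h5⟩
    refine ⟨?_, ?_, ?_, ?_⟩
    · intro h; apply h3; rw [← h, inv]
    · intro h; exact h2 (inj _ _ h)
    · intro h; apply h5; rw [← h, inv]
    · intro h; exact h4 (inj _ _ h)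
  · intro x y hxy
    rw [cnt_toggle, hf, ct x y hxy]
    have key : ind (y = τ x) = pr p (τ p) x y + pr q (τ q) x y + ind (nS p (τ p) q (τ q) x ∧ y = τ x) := by
      have hpp := (ne p)
      have hqq := (ne q)
      by_cases hy : y = τ x
      · subst hy
        rw [ind_pos rfl]
        by_cases a1 : x = p
        · subst a1; simp [pr, nS, ind, hpq, h1, hqp, hpp, hpp.symm, hqq, hqq.symm, hqp.symm, hpq.symm, h1.symm]
        by_cases a2 : x = τ p
        · subst a2; simp [pr, nS, ind, hpq, h1, hqp, hpp, hpp.symm, hqq, hqq.symm, hqp.symm, inv, hpq.symm, h1.symm]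
        by_cases a3 : x = q
        · subst a3; simp [pr, nS, ind, hpq, h1, hqp, hpp, hpp.symm, hqq, hqq.symm, hqp.symm, hpq.symm, h1.symm]
        by_cases a4 : x = τ q
        · subst a4; simp [pr, nS, ind, hpq, h1, hqp, hpp, hpp.symm, hqq, hqq.symm, hqp.symm, inv, hpq.symm, h1.symm]
        · simp [pr, nS, ind, a1, a2, a3, a4]
      · rw [ind_neg hy, ind_neg (fun h => hy h.2)]
        have : ∀ r, pr r (τ r) x y = 0 := by
          intro r
          by_cases a1 : x = r
          · subst a1; simp [pr, ind, hy, (ne x).symm]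
          · by_cases a2 : x = τ r
            · subst a2; rw [inv] at hy; simp [pr, ind, hy, ne r]
            · simp [pr, ind, a1, a2]
        rw [this, this]; rfl
    rw [key]
    ring

section
variable {k : ℕ} [NeZero k]

/-- a level with a positive edge whose block meets infinity -/
lemma exists_lvl_plus (h : HasMD (2 * k + 2) 1 (4 - 2 * (k + 1))) :
    ∃ L τ σ, IsLvl (k := k) L τ σ (-1) ∧ ∑ x, σ x = (4 - 2 * (k + 1) : ℤ) ∧
      ∃ p q, τ (.inl p) = .inl q ∧ σ (.inl p) = 1 ∧ L.f (.inl p) (.inl q) (.inr 0) = 1 := by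
  classical
  obtain ⟨S, τ, σ, hm, ht⟩ := h
  rw [hm.tot] at ht
  obtain ⟨p, hp⟩ := exists_sign hm.pm (s := 1) (Or.inl rfl) (by rw [ht]; simp; linarith)
  have hc : Fintype.card (Fin (2 * k + 2)) = Fintype.card (VL k) := by rw [card_VL]; simp
  have hpt := (hm.ne p).symm
  have h2 : cnt S p (τ p) = 2 := by rw [hm.ct _ _ hpt, ind_pos rfl, hp]; ring
  obtain ⟨r, hr⟩ : ∃ r, S.f p (τ p) r = 1 := by
    by_contra hn
    push Not at hn
    have : cnt S p (τ p) = 0 := Finset.sum_eq_zero fun z _ => by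
      rcases S.zo p (τ p) z with h | h
      · exact h
      · exact absurd h (hn z)
    omega
  have r1 : r ≠ p := by rintro rfl; rw [S.d13] at hr; exact absurd hr (by norm_num)
  have r2 : r ≠ τ p := by rintro rfl; rw [S.d23] at hr; exact absurd hr (by norm_num)
  have r3 : τ r ≠ p := by intro h; apply r2; rw [← h, hm.inv]
  have r4 : τ r ≠ τ p := by intro h; apply r1; rw [← hm.inv r, h, hm.inv]
  have hrm : σ r = -1 := by
    rcases hm.pm r with h | h
    · exfalso
      have h1 : ∀ x, -1 + 2 * (ind (x = p) + ind (x = τ p) + ind (x = r) + ind (x = τ r)) ≤ σ x := by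
        intro x
        by_cases a1 : x = p
        · subst a1; simp [ind, hpt, r1.symm, r3.symm, hp]
        by_cases a2 : x = τ p
        · subst a2; simp [ind, hpt.symm, r2.symm, r4.symm, hp, hm.sg]
        by_cases a3 : x = r
        · subst a3; simp [ind, r1, r2, (hm.ne x).symm, h]
        by_cases a4 : x = τ r
        · subst a4; simp [ind, r3, r4, (hm.ne r), h, hm.sg]
        · simp [ind, a1, a2, a3, a4]; rcases hm.pm x with h | h <;> rw [h]; norm_num
      have h2 := Finset.sum_le_sum (s := univ) fun x _ => h1 x
      rw [ht, Finset.sum_add_distrib, ← Finset.mul_sum] at h2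
      simp only [Finset.sum_add_distrib, sum_ind_eq] at h2
      simp at h2
      linarith
    · exact h
  obtain ⟨e, he⟩ := exists_label hc ![r, τ r] (by
        intro i j; fin_cases i <;> fin_cases j <;> simp [hm.ne r, (hm.ne r).symm]) ![.inr 0, .inr 1] (by
        intro i j; fin_cases i <;> fin_cases j <;> simp)
  have e0 : e (.inr 0) = r := he 0
  have e1 : e (.inr 1) = τ r := he 1
  have fin : ∀ x, x ≠ r → x ≠ τ r → ∃ y, e (.inl y) = x := by
    intro x hx hx'
    rcases hy : e.symm x with y | c
    · exact ⟨y, by rw [← hy, e.apply_symm_apply]⟩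
    · rw [Equiv.symm_apply_eq] at hy
      fin_cases c
      · exact absurd (hy.trans e0) hx
      · exact absurd (hy.trans e1) hx'
  obtain ⟨p', hp'⟩ := fin p r1.symm r3.symm
  obtain ⟨q', hq'⟩ := fin (τ p) r2.symm r4.symm
  have h0 : cnt S r (τ r) = 0 := by rw [hm.ct _ _ (hm.ne r).symm, ind_pos rfl, hrm]; ring
  refine ⟨_, _, _, ⟨hm.map e, ?_, ?_, ?_⟩, ?_, p', q', ?_, ?_, ?_⟩
  · rw [Equiv.symm_apply_eq, e0, e1]
  · rw [e0, hrm]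
  · intro y hy
    change S.f (e _) (e _) (e _) = 1 at hy
    rw [e0, e1, f_of_cnt_zero h0] at hy
    exact absurd hy (by norm_num)
  · rw [← ht]; exact Equiv.sum_comp e σ
  · rw [Equiv.symm_apply_eq, hp', hq']
  · rw [hp', hp]
  · show S.f (e _) (e _) (e _) = 1
    rw [hp', hq', e0, hr]

/-- a level with two minus edges meeting infinity -/
lemma exists_lvl_two (h : HasMD (2 * k + 2) 1 (-(2 * k + 2))) (hk : 1 < k) :
    ∃ L τ σ, IsMD (V := VL k) L 1 τ σ ∧ (∀ x, σ x = -1) ∧ (∀ x, L.f (.inr 0) (.inr 1) (.inl x) = 1 → x.1 = 0) ∧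
      ∃ a b, a.1 = 0 ∧ τ (.inr 0) = .inl b ∧ τ (.inr 1) = .inl a := by
  classical
  obtain ⟨S, τ, σ, hm, ht⟩ := h
  rw [hm.tot] at ht
  have hmin : ∀ x, σ x = -1 := all_minus hm.pm (by rw [ht]; simp)
  have hc : Fintype.card (Fin (2 * k + 2)) = Fintype.card (VL k) := by rw [card_VL]; simp
  obtain ⟨x⟩ : Nonempty (Fin (2 * k + 2)) := ⟨0⟩
  obtain ⟨y, hy⟩ : ∃ y, y ∉ ({x, τ x} : Finset (Fin (2 * k + 2))) := by
    by_contra hn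
    push Not at hn
    have h1 : (univ : Finset (Fin (2 * k + 2))) ⊆ {x, τ x} := fun z _ => hn z
    have h2 := Finset.card_le_card h1
    have h3 := Finset.card_le_two (a := x) (b := τ x)
    simp at h2
    omega
  simp only [mem_insert, mem_singleton, not_or] at hy
  obtain ⟨hyx, hyt⟩ := hy
  have h1 : cnt S x y = 1 := by rw [hm.ct _ _ (Ne.symm hyx), ind_neg hyt]; ring
  have h1' : ∑ z, ind (S.f x y z = 1) = 1 := by simp only [ind_zo1]; exact h1
  rw [sum_ind_card] at h1'
  obtain ⟨c0, hc0⟩ := card_eq_one.mp (by exact_mod_cast h1')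
  have hc1 : ∀ z, S.f x y z = 1 → z = c0 := by
    intro z hz
    have : z ∈ ({c0} : Finset _) := by rw [← hc0]; simpa using hz
    simpa using this
  have hc2 : S.f x y c0 = 1 := by
    have : c0 ∈ ({c0} : Finset _) := by simp
    rw [← hc0] at this; simpa using this
  have z0 : ∀ z, cnt S z (τ z) = 0 := by
    intro z; rw [hm.ct _ _ (hm.ne z).symm, ind_pos rfl, hmin]; ring
  have c1 : c0 ≠ x := by rintro rfl; rw [S.d13] at hc2; exact absurd hc2 (by norm_num)
  have c2 : c0 ≠ y := by rintro rfl; rw [S.d23] at hc2; exact absurd hc2 (by norm_num)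
  have c3 : c0 ≠ τ y := by
    rintro rfl; rw [S.s12, S.s23, f_of_cnt_zero (z0 y)] at hc2; exact absurd hc2 (by norm_num)
  have c4 : τ y ≠ x := by intro h; apply hyt; rw [← h, hm.inv]
  have c5 : τ y ≠ y := hm.ne y
  have c6 : τ x ≠ y := fun h => hyt h.symm
  obtain ⟨e, he⟩ := exists_label hc ![x, y, c0, τ y] (by
        intro i j; fin_cases i <;> fin_cases j <;> simp [hyx, c1, c2, c3, c4, c5, Ne.symm hyx, c1.symm, c2.symm, c3.symm, c4.symm, c5.symm]) ![.inr 0, .inr 1, .inl (0, false), .inl (0, true)] (by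
        intro i j; fin_cases i <;> fin_cases j <;> simp)
  have e0 : e (.inr 0) = x := he 0
  have e1 : e (.inr 1) = y := he 1
  have e2 : e (.inl (0, false)) = c0 := he 2
  have e3 : e (.inl (0, true)) = τ y := he 3
  obtain ⟨b, hb⟩ : ∃ b, e.symm (τ x) = .inl b := by
    rcases hb : e.symm (τ x) with b | c
    · exact ⟨b, rfl⟩
    · rw [Equiv.symm_apply_eq] at hb
      fin_cases c
      · exact absurd (hb.trans e0) (hm.ne x)
      · exact absurd (hb.trans e1) c6
  refine ⟨_, _, _, hm.map e, fun _ => hmin _, ?_, (0, true), b, rfl, ?_, ?_⟩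
  · intro z hz
    change S.f (e _) (e _) (e _) = 1 at hz
    rw [e0, e1] at hz
    have h := hc1 _ hz
    rw [← e2] at h; have := e.injective h; simp at this; rw [this]
  · rw [e0, hb]
  · rw [e1, Equiv.symm_apply_eq, e3]
end
end DataPlacement

namespace DataPlacement
open Finset
set_option linter.unusedVariables false
set_option linter.unusedSimpArgs false
set_option linter.unusedSectionVars false
set_option linter.unnecessarySeqFocus false

lemma glue_rm (k μ n : ℕ) (hk : 0 < k) (hμ : μ + 1 ≤ 2 * k) (hn : n + 1 ≤ k) (hnμ : 0 < n → 0 < μ)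
    (s : Fin 3 → ℤ) (f : Fin 3 → ℕ) (hs1 : ∀ i, s i = 1 ∨ s i = -1) (hf : ∀ i, f i ≤ k)
    (hm : ∀ i, HasMD (2 * k + 2) 1 (4 * f i - 2 * k + 2 * s i)) (h2 : s 2 = -1) (h2' : f 2 = 1)
    (hs : 6 * n + ∑ i, (1 + s i) = 2 * μ + 1 + 1) :
    HasStar (6 * k + 2) (2 * μ + 1) (4 * (f 0 + f 1 + f 2) - 6 * k + 2 - 6) := by
  have : NeZero k := ⟨by omega⟩
  have h1 : ∀ i, ∃ L τ σ, IsLvl (k := k) L τ σ (s i) ∧ ∑ x, σ x = (4 * f i - 2 * k + 2 * s i : ℤ) ∧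
      (i = 2 → ∃ p q, τ (.inl p) = .inl q ∧ σ (.inl p) = 1 ∧ L.f (.inl p) (.inl q) (.inr 0) = 1) := by
    intro i
    by_cases hi : i = 2
    · subst hi
      have h := hm 2
      rw [h2, h2'] at h ⊢
      obtain ⟨L, τ, σ, h3, h4, h5⟩ := exists_lvl_plus (k := k) (by convert h using 1; push_cast; ring)
      exact ⟨L, τ, σ, h3, by rw [h4]; push_cast; ring, fun _ => h5⟩
    · have := hf i
      obtain ⟨L, τ, σ, h3, h4⟩ := exists_lvl k (hs1 i) (hm i) (by rcases hs1 i with h | h <;> rw [h] <;> omega)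
      exact ⟨L, τ, σ, h3, h4, fun h => absurd h hi⟩
  choose L τ σ hl hE hp using h1
  choose t ht using fun i => (hl i).fin
  obtain ⟨S, G⟩ := glue_exists k μ n True L hμ hn hnμ (fun i => (hl i).hz)
  have H := glue_isMD G hl ht (Or.inl rfl) hs
  have hfin : ∀ i, ∑ x, σ i (.inl x) = 4 * f i - 2 * k := by
    intro i; rw [(hl i).fsum, hE]; ring
  have htot : totDef S (2 * μ + 1) = 4 * (f 0 + f 1 + f 2) - 6 * k + 2 := by
    rw [H.tot]
    have : ∑ x, sG σ 1 x = ∑ i, ∑ x, σ i (.inl x) + ∑ c : Fin 2, 1 := by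
      rw [Fintype.sum_sum_type, Fintype.sum_prod_type]; rfl
    rw [this]
    simp only [hfin, Fin.sum_univ_three, Fin.sum_univ_two]
    ring
  obtain ⟨p, q, h3, h4, h5⟩ := hp 2 rfl
  have hq : t 2 p = q := by
    have := (ht 2 p).symm.trans h3
    exact Sum.inl_injective this
  have hfz : S.f (.inl (2, p)) (tG t (.inl (2, p))) (.inr 0) = 1 := by
    show S.f (.inl (2, p)) (.inl (2, t 2 p)) (.inr 0) = 1
    rw [G.fs, hq, h5]
  have := H.toggle_star (p := .inl (2, p)) (r := .inr 0) (s := -1) (Or.inr rfl) h4 (by simp [sG]) (by simp) (by simp [tG]) (by rw [hfz]; ring)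
  refine this.has (card_VG k) ?_
  rw [totDef_toggle, hfz, htot]; ring

lemma glue_add (k μ n : ℕ) (hk : 1 < k) (hμ : μ + 1 ≤ 2 * k) (hn : n + 1 ≤ k) (hnμ : 0 < n → 0 < μ)
    (hm : HasMD (2 * k + 2) 1 (-(2 * k + 2))) (hs : 6 * n + 2 = 2 * μ) :
    HasStar (6 * k + 2) (2 * μ + 1) (-(6 * k)) := by
  classical
  have : NeZero k := ⟨by omega⟩
  have h1 : ∀ i : Fin 3, ∃ L τ σ, IsMD (V := VL k) L 1 τ σ ∧ (∀ x, σ x = -1) ∧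
      (∀ x, L.f (.inr 0) (.inr 1) (.inl x) = 1 → x.1 = 0) ∧
      (i = 0 → ∃ a b, a.1 = 0 ∧ τ (.inr 0) = .inl b ∧ τ (.inr 1) = .inl a) ∧ (i ≠ 0 → τ (.inr 0) = .inr 1) := by
    intro i
    by_cases hi : i = 0
    · obtain ⟨L, τ, σ, h1, h2, h3, h4⟩ := exists_lvl_two hm hk
      exact ⟨L, τ, σ, h1, h2, h3, fun _ => h4, fun h => absurd hi h⟩
    · obtain ⟨L, τ, σ, h1, h2⟩ := exists_lvl k (s := -1) (Or.inr rfl) hm (by omega)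
      refine ⟨L, τ, σ, h1.md, all_minus h1.md.pm (by rw [h2, card_VL]; push_cast; ring), h1.hz, fun h => absurd h hi, fun _ => h1.t0⟩
  choose L τ σ hl hσ hz h0 h1 using h1
  obtain ⟨S, G⟩ := glue_exists k μ n True L hμ hn hnμ hz
  obtain ⟨a, b, ha, hb0, ha0⟩ := h0 0 rfl
  have hct : ∀ i x y, x ≠ y → cnt (L i) x y = 1 + ind (y = τ i x) * (-1) := by
    intro i x y h; rw [(hl i).ct x y h, hσ]
  have h1' : ∀ i, i ≠ 0 → ∀ c : Fin 2, τ i (.inr c) = .inr (c + 1) := by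
    intro i hi c
    fin_cases c
    · exact h1 i hi
    · have := (hl i).inv (.inr 0)
      rw [h1 i hi] at this
      exact this
  have hb0' : τ 0 (.inl b) = .inr 0 := by rw [← hb0, (hl 0).inv]
  have ha0' : τ 0 (.inl a) = .inr 1 := by rw [← ha0, (hl 0).inv]
  let em : Fin 3 → VL k → VG k := fun i => Sum.elim (fun y => .inl (i, y)) (fun c => .inr c)
  let T : VG k → VG k := Sum.elim (fun p => em p.1 (τ p.1 (.inl p.2))) (fun c => em 0 (τ 0 (.inr c)))
  have em_inj : ∀ i x y, em i x = em i y → x = y := by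
    rintro i (x | c) (y | d) h <;> simp [em] at h <;> simp [h]
  have hT0 : ∀ x, T (em 0 x) = em 0 (τ 0 x) := by
    rintro (x | c) <;> rfl
  have hTi : ∀ i, i ≠ 0 → ∀ x, ∃ y, τ i (.inl x) = .inl y := by
    intro i hi x
    rcases hx : τ i (.inl x) with y | c
    · exact ⟨y, rfl⟩
    · have := (hl i).inv (.inl x)
      rw [hx, h1' i hi] at this
      exact absurd this (by simp)
  have inv : ∀ x, T (T x) = x := by
    rintro (⟨i, x⟩ | c)
    · by_cases hi : i = 0
      · subst hi
        show T (T (em 0 (.inl x))) = em 0 (.inl x)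
        rw [hT0, hT0, (hl 0).inv]
      · obtain ⟨y, hy⟩ := hTi i hi x
        have : T (.inl (i, x)) = .inl (i, y) := by show em i (τ i (.inl x)) = _; rw [hy]; rfl
        rw [this]
        show em i (τ i (.inl y)) = _
        rw [← hy, (hl i).inv]; rfl
    · show T (T (em 0 (.inr c))) = em 0 (.inr c)
      rw [hT0, hT0, (hl 0).inv]
  have ne : ∀ x, T x ≠ x := by
    rintro (⟨i, x⟩ | c) h
    · exact (hl i).ne (.inl x) (em_inj i _ _ h)
    · exact (hl 0).ne (.inr c) (em_inj 0 _ _ h)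
  have ct : ∀ x y, x ≠ y → cnt S x y = (2 * μ + 1) - 2 * pr (.inr 0) (.inr 1) x y + ind (y = T x) * (-1) := by
    apply sys_all
    · intro x y; rw [pr_symm, md_symm (σ := fun _ => -1) inv (fun _ => rfl) x y]
    · intro i x y hxy
      rw [G.same i x y hxy, hct i _ _ (by simpa using hxy)]
      have : ind ((Sum.inl y : VL k) = τ i (.inl x)) = ind ((Sum.inl (i, y) : VG k) = T (.inl (i, x))) := by
        apply ind_congr
        constructor
        · intro h; show em i (.inl y) = em i (τ i (.inl x)); rw [h]
        · intro h; exact em_inj i _ _ h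
      rw [this]
      have : pr (.inr 0) (.inr 1) (.inl (i, x) : VG k) (.inl (i, y)) = 0 := by simp [pr, ind]
      rw [this]; ring
    · intro i x z
      rw [G.cross, ind_true]
      have : pr (.inr 0) (.inr 1) (.inl (i, x) : VG k) (.inl (i + 1, z)) = 0 := by simp [pr, ind]
      rw [this, ind_neg]
      · ring
      · show ¬ (_ = em i (τ i (.inl x)))
        rcases τ i (.inl x) with y | c <;> simp [em]
    · intro c i x
      rw [G.inf, hct i _ _ (by simp)]
      have : pr (.inr 0) (.inr 1) (.inr c : VG k) (.inl (i, x)) = 0 := by simp [pr, ind]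
      rw [this]
      have : ind ((Sum.inl x : VL k) = τ i (.inr c)) = ind ((Sum.inl (i, x) : VG k) = T (.inr c)) := by
        by_cases hi : i = 0
        · subst hi
          apply ind_congr
          constructor
          · intro h; show em 0 (.inl x) = em 0 (τ 0 (.inr c)); rw [h]
          · intro h; exact em_inj 0 _ _ h
        · rw [ind_neg, ind_neg]
          · show ¬ (_ = em 0 (τ 0 (.inr c)))
            rcases τ 0 (.inr c) with y | c <;> simp [em, hi]
          · rw [h1' i hi]; simp
      rw [this]; ring
    · have h01 : cnt S (.inr 0) (.inr 1) = 2 * μ - 1 := by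
        rw [G.infs, Fin.sum_univ_three, hct 0 _ _ (by simp), hct 1 _ _ (by simp), hct 2 _ _ (by simp), h1 1 (by decide),
          h1 2 (by decide), hb0, ind_neg (by simp), ind_pos rfl]
        omega
      have hz : ∀ c d : Fin 2, ind ((Sum.inr d : VG k) = T (.inr c)) = 0 := by
        intro c d
        apply ind_neg
        show ¬ (_ = em 0 (τ 0 (.inr c)))
        fin_cases c
        · simp only [Fin.zero_eta]; rw [hb0]; simp [em]
        · simp only [Fin.mk_one]; rw [ha0]; simp [em]
      intro c d hcd
      rw [hz]
      fin_cases c <;> fin_cases d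
      · exact absurd rfl hcd
      · refine h01.trans ?_; simp [pr, ind]; ring
      · refine ((cnt_comm _ _ _).trans h01).trans ?_; simp [pr, ind]; ring
      · exact absurd rfl hcd
  have hTp : T (.inr 0) = .inl (0, b) := by show em 0 (τ 0 (.inr 0)) = _; rw [hb0]; rfl
  have hTq : T (.inr 1) = .inl (0, a) := by show em 0 (τ 0 (.inr 1)) = _; rw [ha0]; rfl
  have hf : S.f (.inr 0) (.inr 1) (T (.inr 1)) = 0 := by
    rw [hTq, G.fi 0 a ha, (L 0).s12, (L 0).s23, (L 0).s12]
    have h3 : cnt (L 0) (.inr 1) (.inl a) = 0 := by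
      rw [hct 0 _ _ (by simp), ha0, ind_pos rfl]; ring
    rw [(L 0).s12, f_of_cnt_zero h3]
  have := star_almost inv ne (p := .inr 0) (q := .inr 1) (by simp) (by rw [hTp]; simp) ct hf (by rw [hTq]; simp)
  refine this.has (card_VG k) ?_
  rw [this.tot_minus (fun _ => rfl), card_VG]
  push_cast; ring
end DataPlacement

namespace DataPlacement
open Finset
set_option linter.unusedVariables false
set_option linter.unusedSimpArgs false
set_option linter.unusedSectionVars false
set_option linter.unnecessarySeqFocus false

lemma glue_rmN {k : ℕ} (hP : PW (k + 1)) (h3 : k % 3 = 1) (μ n ns f1 : ℕ) (hμ : μ + 1 ≤ 2 * k)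
    (hn : n + 1 ≤ k) (hnμ : 0 < n → 0 < μ) (hns : (ns = 1 ∧ f1 = 1) ∨ (ns = 2 ∧ f1 = 0)) (hs : 6 * n + 2 * ns = 2 * μ + 2) :
    HasStar (6 * k + 2) (2 * μ + 1) (4 * f1 - 6 * k) := by
  have key : ∀ (f j : ℕ), okd (k + 1) (f + if j < ns then 1 else 0) →
      HasMD (2 * k + 2) 1 (4 * f - 2 * k + 2 * (if j < ns then (1 : ℤ) else -1)) := by
    intro f j h
    have := hP _ h
    convert this using 1
    · ring
    · split_ifs <;> push_cast <;> ring
  have := glue_rm k μ n (by omega) hμ hn hnμ ![if 0 < ns then (1 : ℤ) else -1, if 1 < ns then (1 : ℤ) else -1,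
    if 2 < ns then (1 : ℤ) else -1] ![0, f1, 1] (by
      intro i; fin_cases i <;> simp <;> omega) (by
      intro i; fin_cases i <;> simp <;> omega) (by
      intro i; fin_cases i
      · exact key 0 0 (by unfold okd; split_ifs <;> omega)
      · exact key f1 1 (by unfold okd; split_ifs <;> omega)
      · exact key 1 2 (by unfold okd; split_ifs <;> omega)) (by
      simp; omega) (by simp) (by
      rw [Fin.sum_univ_three]
      simp only [Matrix.cons_val_zero, Matrix.cons_val_one, Matrix.cons_val]
      rcases hns with ⟨rfl, -⟩ | ⟨rfl, -⟩ <;> norm_num <;> omega)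
  convert this using 1
  simp; ring

/-- v = 2 mod 6, odd index, general case -/
lemma claimD (k μ d : ℕ) (hk : 0 < k) (hμ : 2 * μ + 1 ≤ 3 * k) (hd : d % 3 = (2 * μ) % 3) (hd3 : d ≤ 3 * k) :
    (0 < d → HasMD (6 * k + 2) (2 * μ + 1) (4 * d - 6 * k - 2)) ∧
    (d + 1 ≤ 3 * k → HasStar (6 * k + 2) (2 * μ + 1) (4 * d - 6 * k + 4)) := by
  have hP := PW_all (k + 1) (by omega)
  by_cases m0 : μ = 0
  · subst m0
    have h := PW_all (3 * k + 1) (by omega) d (by unfold okd; omega)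
    have h' : HasMD (6 * k + 2) 1 (4 * d - 6 * k - 2) := by
      convert h using 1
      · ring
      · push_cast; ring
    refine ⟨fun _ => by simpa using h', fun hd' => ?_⟩
    have := star_one h' (by push_cast; omega)
    convert this using 1
    · simp
    · ring
  have conv : ∀ (F : ℕ) (σ0 : ℤ) (P : Prop), (HasMD (6 * k + 2) (2 * μ + 1) (4 * F - 6 * k + 2 * σ0) ∧
      (P → HasStar (6 * k + 2) (2 * μ + 1) (4 * F - 6 * k + 2 * σ0 + 6))) →
      (4 * F - 6 * k + 2 * σ0 = (4 * d - 6 * k - 2 : ℤ)) → (d + 1 ≤ 3 * k → P) →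
      (0 < d → HasMD (6 * k + 2) (2 * μ + 1) (4 * d - 6 * k - 2)) ∧
      (d + 1 ≤ 3 * k → HasStar (6 * k + 2) (2 * μ + 1) (4 * d - 6 * k + 4)) := by
    intro F σ0 P h hE hP
    rw [hE] at h
    refine ⟨fun _ => h.1, fun h' => ?_⟩
    convert h.2 (hP h') using 1
    ring
  have m3 : μ % 3 = 0 ∨ μ % 3 = 1 ∨ μ % 3 = 2 := by omega
  have k3 : k % 3 = 0 ∨ k % 3 = 1 ∨ k % 3 = 2 := by omega
  rcases k3 with k3 | k3 | k3 <;> rcases m3 with m3 | m3 | m3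
  · exact conv d (-1) _ (glueF hP μ (μ / 3) 0 d (-1) 0 0 (k / 3) 0 hk (by omega) (by omega) (by omega) (by omega) (by omega)
      (by omega) (by intro _ x hx; unfold okd; omega) (by omega) (d / 3) (by omega) (by omega)) (by ring) (by omega)
  · exact conv d (-1) _ (glueF hP μ (μ / 3) 1 d (-1) 0 2 (k / 3) ((k - 3) / 3) hk (by omega) (by omega) (by omega) (by omega) (by omega)
      (by omega) (by intro _ x hx; unfold okd; omega) (by intro _ x hx; unfold okd; omega) ((d - 2) / 3) (by omega) (by omega)) (by ring) (by omega)
  · by_cases hd1 : d = 1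
    · exact conv 0 1 _ (glueF hP μ ((μ + 1) / 3) 0 0 1 0 0 0 0 hk (by omega) (by omega) (by omega) (by omega) (by omega)
        (by omega) (by intro _ x hx; unfold okd; omega) (by omega) 0 (by omega) (by omega)) (by subst hd1; push_cast; ring) (by omega)
    · exact conv d (-1) _ (glueF hP μ (μ / 3) 2 d (-1) 0 2 (k / 3) ((k - 3) / 3) hk (by omega) (by omega) (by omega) (by omega) (by omega)
        (by omega) (by intro _ x hx; unfold okd; omega) (by intro _ x hx; unfold okd; omega) ((d - 4) / 3) (by omega) (by omega)) (by ring) (by omega)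
  · by_cases hd0 : d = 0
    · subst hd0
      refine ⟨by omega, fun _ => ?_⟩
      have := glue_rmN hP k3 μ (μ / 3) 1 1 (by omega) (by omega) (by omega) (by omega) (by omega)
      convert this using 1
      push_cast; ring
    · exact conv d (-1) _ (glueF hP μ (μ / 3) 0 d (-1) 1 0 (k / 3) 0 hk (by omega) (by omega) (by omega) (by omega) (by omega)
        (by omega) (by intro _ x hx; unfold okd; omega) (by omega) ((d - 3) / 3) (by omega) (by omega)) (by ring) (by omega)
  · exact conv d (-1) _ (glueF hP μ (μ / 3) 1 d (-1) 1 0 (k / 3) (k / 3) hk (by omega) (by omega) (by omega) (by omega) (by omega)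
      (by omega) (by intro _ x hx; unfold okd; omega) (by intro _ x hx; unfold okd; omega) ((d - 2) / 3) (by omega) (by omega)) (by ring) (by omega)
  · exact conv d (-1) _ (glueF hP μ (μ / 3) 2 d (-1) 1 0 (k / 3) (k / 3) hk (by omega) (by omega) (by omega) (by omega) (by omega)
      (by omega) (by intro _ x hx; unfold okd; omega) (by intro _ x hx; unfold okd; omega) ((d - 1) / 3) (by omega) (by omega)) (by ring) (by omega)
  · by_cases hd1 : d + 6 ≤ 3 * k
    · exact conv d (-1) _ (glueF hP μ (μ / 3) 0 d (-1) 0 0 (k / 3) 0 hk (by omega) (by omega) (by omega) (by omega) (by omega)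
        (by omega) (by intro _ x hx; unfold okd; omega) (by omega) (d / 3) (by omega) (by omega)) (by ring) (by omega)
    · exact conv d (-1) _ (glueF hP μ (μ / 3 - 1) 3 d (-1) 0 2 0 (k / 3) hk (by omega) (by omega) (by omega) (by omega) (by omega)
        (by omega) (by omega) (by intro _ x hx; unfold okd; omega) ((d - 6) / 3) (by omega) (by omega)) (by ring) (by omega)
  · by_cases hd1 : d + 1 = 3 * k
    · have := glueN hP μ (μ / 3) 2 k k (k - 2) 1 hk (by omega) (by omega) (by omega) le_rfl le_rfl (by omega) (by omega) (by omega)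
        (by norm_num; unfold okd; omega) (by norm_num; unfold okd; omega) (by norm_num; unfold okd; omega) (by omega)
      refine conv (k + k + (k - 2)) 1 _ (by push_cast at this ⊢; exact this) (by omega) (by omega)
    · exact conv d (-1) _ (glueF hP μ (μ / 3) 1 d (-1) 0 2 (k / 3) (k / 3) hk (by omega) (by omega) (by omega) (by omega) (by omega)
        (by omega) (by intro _ x hx; unfold okd; omega) (by intro _ x hx; unfold okd; omega) ((d - 2) / 3) (by omega) (by omega)) (by ring) (by omega)
  · by_cases hd1 : d = 1
    · exact conv 0 1 _ (glueF hP μ ((μ + 1) / 3) 0 0 1 0 0 0 0 hk (by omega) (by omega) (by omega) (by omega) (by omega)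
        (by omega) (by intro _ x hx; unfold okd; omega) (by omega) 0 (by omega) (by omega)) (by subst hd1; push_cast; ring) (by omega)
    · exact conv d (-1) _ (glueF hP μ (μ / 3) 2 d (-1) 0 2 (k / 3) (k / 3) hk (by omega) (by omega) (by omega) (by omega) (by omega)
        (by omega) (by intro _ x hx; unfold okd; omega) (by intro _ x hx; unfold okd; omega) ((d - 4) / 3) (by omega) (by omega)) (by ring) (by omega)

/-- v = 2 mod 6, the extreme star -/
lemma claimD0 (k μ : ℕ) (hk : 0 < k) (hμ : 2 * μ + 1 ≤ 3 * k) (m3 : μ % 3 = 1) :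
    HasStar (6 * k + 2) (2 * μ + 1) (-(6 * k)) := by
  have hP := PW_all (k + 1) (by omega)
  by_cases k3 : k % 3 = 1
  · have := glue_rmN hP k3 μ (μ / 3) 2 0 (by omega) (by omega) (by omega) (by omega) (by omega)
    convert this using 1
    push_cast; ring
  · have h := hP 0 (by unfold okd; omega)
    refine glue_add k μ (μ / 3) (by omega) (by omega) (by omega) (by omega) ?_ (by omega)
    convert h using 1
    · ring
    · push_cast; ring
end DataPlacement

namespace DataPlacement
open Finset
set_option linter.unusedVariables false
set_option linter.unusedSimpArgs false
set_option linter.unusedSectionVars false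
set_option linter.unnecessarySeqFocus false

/-- the assertion needed for condition (C2) -/
def GoodC2 (v : ℕ) (l e : ℤ) : Prop :=
  (((v : ℤ) - 2 * e) % 4 = 0 → HasMD v l (2 * e)) ∧ (((v : ℤ) - 2 * e) % 4 ≠ 0 → HasStar v l (2 * e))

lemma GoodC2.compl {v : ℕ} {l e : ℤ} (hv : v % 2 = 0) (h : GoodC2 v l e) : GoodC2 v (v - 2 - l) (-e) := by
  constructor
  · intro h4
    have := (h.1 (by omega)).compl
    convert this using 1
    ring
  · intro h4
    have := (h.2 (by omega)).compl
    convert this using 1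
    ring

lemma goodA (k μ : ℕ) (f : ℤ) (hk : 0 < k) (hμ : 2 * μ + 2 ≤ 3 * k) (h1 : -(k : ℤ) < f) (h2 : f < k) :
    GoodC2 (6 * k) (2 * μ + 1) (3 * f) := by
  by_cases hx : k = 2 ∧ μ = 2
  · obtain ⟨rfl, rfl⟩ := hx
    have h12 := has12
    constructor
    · intro h4
      have : f = 0 := by omega
      subst this
      exact h12.1
    · intro h4
      have : f = 1 ∨ f = -1 := by omega
      rcases this with rfl | rfl
      · exact h12.2
      · have := h12.2.compl
        norm_num at this ⊢
        exact this
  · constructor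
    · intro h4
      have := (claimA_aux k μ ((f + k) / 2).toNat hk (by omega) hμ hx).1
      convert this using 1
      omega
    · intro h4
      have := (claimA_aux k μ ((f + k - 1) / 2).toNat hk (by omega) hμ hx).2 (by omega)
      convert this using 1
      omega

lemma goodB (k μ : ℕ) (f : ℤ) (hμ : μ ≤ 2 * k) (h1 : -(k : ℤ) ≤ f) (h2 : f ≤ k) :
    GoodC2 (6 * k + 4) (2 * μ + 1) (3 * f) := by
  constructor
  · intro h4
    have := (claimB_aux k μ ((f + k) / 2).toNat (by omega) hμ).1
    convert this using 1
    omega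
  · intro h4
    have := (claimB_aux k μ ((f + k - 1) / 2).toNat (by omega) hμ).2 (by omega)
    convert this using 1
    omega

lemma goodD (k μ : ℕ) (e : ℤ) (hk : 0 < k) (hμ : 2 * μ + 1 ≤ 3 * k) (h1 : -(3 * k : ℤ) ≤ e) (h2 : e ≤ 3 * k)
    (h3 : (e + 2 * μ + 1) % 3 = 0) : GoodC2 (6 * k + 2) (2 * μ + 1) e := by
  constructor
  · intro h4
    have := (claimD k μ ((e + 3 * k + 1) / 2).toNat hk hμ (by omega) (by omega)).1 (by omega)
    convert this using 1
    omega
  · intro h4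
    by_cases he : e = -(3 * k)
    · have := claimD0 k μ hk hμ (by omega)
      convert this using 1
      omega
    · have := (claimD k μ ((e + 3 * k - 2) / 2).toNat hk hμ (by omega) (by omega)).2 (by omega)
      convert this using 1
      omega

lemma goodC2_low (v μ : ℕ) (e : ℤ) (hv : v % 2 = 0) (hv4 : 4 ≤ v) (hμ : 2 * (2 * μ + 1) ≤ v - 2)
    (h1 : -(v : ℤ) < 2 * e) (h2 : 2 * e < v)
    (h3 : (3 : ℤ) ∣ (2 * μ + 1) * v * (v - 1) + 2 * e) : GoodC2 v (2 * μ + 1) e := by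
  obtain ⟨c, hc⟩ := h3
  have : v % 6 = 0 ∨ v % 6 = 2 ∨ v % 6 = 4 := by omega
  rcases this with h | h | h
  · obtain ⟨k, rfl⟩ : ∃ k, v = 6 * k := ⟨v / 6, by omega⟩
    have : ∃ g : ℤ, 2 * e = 3 * g := by
      refine ⟨c - (2 * μ + 1) * 2 * k * (6 * k - 1), ?_⟩
      push_cast at hc
      linear_combination hc
    obtain ⟨g, hg⟩ := this
    obtain ⟨f, rfl⟩ : ∃ f, e = 3 * f := ⟨e / 3, by omega⟩
    exact goodA k μ f (by omega) (by omega) (by omega) (by omega)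
  · obtain ⟨k, rfl⟩ : ∃ k, v = 6 * k + 2 := ⟨v / 6, by omega⟩
    have : ∃ g : ℤ, 2 * (2 * μ + 1) + 2 * e = 3 * g := by
      refine ⟨c - (2 * μ + 1) * (12 * k ^ 2 + 6 * k), ?_⟩
      push_cast at hc
      linear_combination hc
    obtain ⟨g, hg⟩ := this
    exact goodD k μ e (by omega) (by omega) (by omega) (by omega) (by omega)
  · obtain ⟨k, rfl⟩ : ∃ k, v = 6 * k + 4 := ⟨v / 6, by omega⟩
    have : ∃ g : ℤ, 2 * e = 3 * g := by
      refine ⟨c - (2 * μ + 1) * (6 * k + 4) * (2 * k + 1), ?_⟩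
      push_cast at hc
      linear_combination hc
    obtain ⟨g, hg⟩ := this
    obtain ⟨f, rfl⟩ : ∃ f, e = 3 * f := ⟨e / 3, by omega⟩
    exact goodB k μ f (by omega) (by omega) (by omega)

lemma three_dvd_prod (n : ℤ) : (3 : ℤ) ∣ n * (n - 1) * (n - 2) := by
  rcases (by omega : n % 3 = 0 ∨ n % 3 = 1 ∨ n % 3 = 2) with h | h | h
  · exact Dvd.dvd.mul_right (Dvd.dvd.mul_right (by omega) _) _
  · exact Dvd.dvd.mul_right (Dvd.dvd.mul_left (by omega) _) _
  · exact Dvd.dvd.mul_left (by omega) _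

lemma goodC2_all (v μ : ℕ) (e : ℤ) (hv : v % 2 = 0) (hv4 : 4 ≤ v) (hμ : 2 * μ + 1 + 3 ≤ v)
    (h1 : -(v : ℤ) < 2 * e) (h2 : 2 * e < v)
    (h3 : (3 : ℤ) ∣ (2 * μ + 1) * v * (v - 1) + 2 * e) : GoodC2 v (2 * μ + 1) e := by
  by_cases hlow : 2 * (2 * μ + 1) ≤ v - 2
  · exact goodC2_low v μ e hv hv4 hlow h1 h2 h3
  · obtain ⟨w, rfl⟩ : ∃ w, v = 2 * w := ⟨v / 2, by omega⟩
    obtain ⟨ν, hν⟩ : ∃ ν, w = ν + μ + 2 := ⟨w - μ - 2, by omega⟩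
    have := (goodC2_low (2 * w) ν (-e) hv hv4 (by omega) (by omega) (by omega) (by
      obtain ⟨c, hc⟩ := h3
      obtain ⟨d, hd⟩ := three_dvd_prod ((2 * w : ℕ) : ℤ)
      refine ⟨d - c, ?_⟩
      have : (w : ℤ) = ν + μ + 2 := by exact_mod_cast hν
      push_cast at hc hd ⊢
      rw [this] at hc hd ⊢
      linear_combination hd - hc)).compl hv
    convert this using 1
    · push_cast [hν]; ring
    · ring

theorem main_C2 (v b : ℕ) (hv : 3 ≤ v) (hc : CondC2 v b) :
    ∃ F : Multiset (Finset (Fin v)), IsNWBTSOn Finset.univ v b F := by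
  have hc' := hc
  obtain ⟨hv2, l, hl0, hlo, hb1, hb2⟩ := hc'
  obtain ⟨w, rfl⟩ : ∃ w, v = 2 * w := ⟨v / 2, by omega⟩
  obtain ⟨e, he⟩ : ∃ e : ℤ, 6 * (b : ℤ) = (l : ℤ) * ((2 * w : ℕ) : ℤ) * (((2 * w : ℕ) : ℤ) - 1) + 2 * e :=
    ⟨3 * b - l * w * (2 * w - 1), by push_cast; ring⟩
  obtain ⟨n, rfl⟩ : ∃ n, w = n + 2 := ⟨w - 2, by omega⟩
  set l0 := l % (2 * (n + 1)) with hl0d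
  set t := l / (2 * (n + 1)) with htd
  have hdm : 2 * (n + 1) * t + l0 = l := Nat.div_add_mod l (2 * (n + 1))
  have hlt : l0 < 2 * (n + 1) := Nat.mod_lt _ (by omega)
  have hodd : l0 % 2 = 1 := by
    have : 2 * (n + 1) * t = 2 * ((n + 1) * t) := by ring
    omega
  obtain ⟨μ, hμ⟩ : ∃ μ, l0 = 2 * μ + 1 := ⟨l0 / 2, by omega⟩
  have hl : (l : ℤ) = ((l0 : ℕ) : ℤ) + t * (((2 * (n + 2) : ℕ) : ℤ) - 2) := by
    rw [← hdm]; push_cast; ring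
  have hE1 : -(((2 * (n + 2) : ℕ) : ℤ)) < 2 * e := by linarith
  have hE2 : 2 * e < ((2 * (n + 2) : ℕ) : ℤ) := by linarith
  have good := goodC2_all (2 * (n + 2)) μ e hv2 (by omega) (by omega) hE1 hE2 (by
    obtain ⟨d, hd⟩ := three_dvd_prod ((2 * (n + 2) : ℕ) : ℤ)
    refine ⟨2 * b - t * d, ?_⟩
    have h0 : (l0 : ℤ) = 2 * μ + 1 := by exact_mod_cast hμ
    rw [hl, h0] at he
    linear_combination (-(t : ℤ)) * hd - he)
  have h0 : ((2 * μ + 1 : ℤ)) = (l0 : ℤ) := by exact_mod_cast hμ.symm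
  rw [h0] at good
  by_cases h4 : (((2 * (n + 2) : ℕ) : ℤ) - 2 * e) % 4 = 0
  · obtain ⟨S, τ, σ, hM, ht⟩ := good.1 h4
    exact ⟨_, final_MD S t l0 l e τ σ hl hl0 he hE1 hE2 ht hc hM⟩
  · obtain ⟨S, c, a, b', d, s, τ, σ, hM, ht⟩ := good.2 h4
    exact ⟨_, final_star S t l0 l e τ σ c a b' d s hl hl0 he hE1 hE2 ht hc hM⟩

lemma hasTri_all (v l : ℕ) (hv : 3 ≤ v) (hl0 : 0 < l) (hlv : l + 3 ≤ v)
    (h : (v % 6 = 5 ∧ (l % 3 = 1 ∨ l % 3 = 2)) ∨ (v % 6 = 2 ∧ (l % 6 = 2 ∨ l % 6 = 4)))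
    (s : ℤ) (hs : (l % 3 = 1 ∧ s = -1) ∨ (l % 3 = 2 ∧ s = 1)) : HasTri v l s := by
  rcases h with ⟨h1, h2⟩ | ⟨h1, h2⟩
  · obtain ⟨u, rfl⟩ : ∃ u, v = 3 * u + 2 := ⟨v / 3, by omega⟩
    exact claimC (by omega) s hl0 (by omega) hs
  · obtain ⟨k, rfl⟩ : ∃ k, v = 6 * k + 2 := ⟨v / 6, by omega⟩
    obtain ⟨μ, rfl⟩ : ∃ μ, l = 2 * μ := ⟨l / 2, by omega⟩
    have := claimC2 k μ s (by omega) (by omega) hs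
    exact_mod_cast this

theorem main_C1 (v b : ℕ) (hv : 3 ≤ v) (hc : CondC1 v b) :
    ∃ F : Multiset (Finset (Fin v)), IsNWBTSOn Finset.univ v b F := by
  have hc' := hc
  obtain ⟨hv3, l, hl0, hlv, hb⟩ := hc'
  obtain ⟨q, rfl⟩ : ∃ q, v = 3 * q + 2 := ⟨v / 3, by omega⟩
  set l0 := l % (3 * q) with hl0d
  set t := l / (3 * q) with htd
  have hdm : 3 * q * t + l0 = l := Nat.div_add_mod l (3 * q)
  have hlt : l0 < 3 * q := Nat.mod_lt _ (by omega)
  have hl : (l : ℤ) = ((l0 : ℕ) : ℤ) + t * (((3 * q + 2 : ℕ) : ℤ) - 2) := by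
    rw [← hdm]; push_cast; ring
  have m3 : l0 % 3 = l % 3 := by
    have : 3 * q * t = 3 * (q * t) := by ring
    omega
  have m6 : (3 * q + 2) % 6 = 2 → l0 % 6 = l % 6 := by
    intro h
    obtain ⟨r, rfl⟩ : ∃ r, q = 2 * r := ⟨q / 2, by omega⟩
    have : 3 * (2 * r) * t = 6 * (r * t) := by ring
    omega
  have htri : ∀ s : ℤ, ((l0 % 3 = 1 ∧ s = -1) ∨ (l0 % 3 = 2 ∧ s = 1)) → HasTri (3 * q + 2) l0 s := by
    intro s hs
    refine hasTri_all (3 * q + 2) l0 hv (by omega) (by omega) (by omega) s hs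
  -- the product modulo six
  have hprod : (l * (3 * q + 2) * (3 * q + 2 - 1)) % 6 = (2 * l) % 6 := by
    have e1 : 3 * q + 2 - 1 = 3 * q + 1 := by omega
    rw [e1]
    obtain ⟨c, hcc⟩ := Nat.even_mul_succ_self q
    have : l * (3 * q + 2) * (3 * q + 1) = 2 * l + 6 * (l * (3 * c)) := by
      have : q * q + q = 2 * c := by linarith
      calc l * (3 * q + 2) * (3 * q + 1) = 2 * l + l * (9 * (q * q + q)) := by ring
        _ = _ := by rw [this]; ring
    omega
  have hpz : ((l * (3 * q + 2) * (3 * q + 2 - 1) : ℕ) : ℤ) = (l : ℤ) * ((3 * q + 2 : ℕ) : ℤ) * (((3 * q + 2 : ℕ) : ℤ) - 1) := by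
    rw [Nat.cast_mul, Nat.cast_mul, Nat.cast_sub (by omega)]; push_cast; ring
  generalize hP : l * (3 * q + 2) * (3 * q + 2 - 1) = P at hprod hpz hb
  have h3 : l % 3 = 1 ∨ l % 3 = 2 := by omega
  have tri : ∀ s : ℤ, ((l0 % 3 = 1 ∧ s = -1) ∨ (l0 % 3 = 2 ∧ s = 1)) → 6 * (b : ℤ) = P + 2 * s →
      ∃ F : Multiset (Finset (Fin (3 * q + 2))), IsNWBTSOn Finset.univ (3 * q + 2) b F := by
    intro s hs h6
    obtain ⟨S, x, y, z, hM⟩ := htri s hs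
    exact ⟨_, final_tri S t l0 l x y z s hl hl0 hv (by rw [← hpz]; exact h6) hM.tot hc hM⟩
  have four : ∀ s : ℤ, ((l0 % 3 = 1 ∧ s = -1) ∨ (l0 % 3 = 2 ∧ s = 1)) → 6 * (b : ℤ) = P + 2 * (2 * (-s)) →
      ∃ F : Multiset (Finset (Fin (3 * q + 2))), IsNWBTSOn Finset.univ (3 * q + 2) b F := by
    intro s hs h6
    obtain ⟨S, x, y, z, w, hM⟩ := (htri s hs).four (by omega) (by push_cast; omega)
    exact ⟨_, final_four S t l0 l x y z w (-s) hl hl0 (by omega) (by rw [← hpz]; exact h6) hM.tot hc hM⟩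
  rcases h3 with h3 | h3
  · rcases hb with hb | hb
    · exact tri (-1) (by omega) (by omega)
    · exact four (-1) (by omega) (by omega)
  · rcases hb with hb | hb
    · exact four 1 (by omega) (by omega)
    · exact tri 1 (by omega) (by omega)
end DataPlacement

namespace DataPlacement

open Finset

/-- main existence theorem for NWBTSs. -/
theorem stmt_18 (v b : ℕ) (hv : 3 ≤ v)
    (hcond : CondC1 v b ∨ CondC2 v b)
    (hexc : ¬ (CondC2 v b ∧ (v % 24 = 4 ∨ v = 50 ∨ v = 74))) :
    ∃ F : Multiset (Finset (Fin v)), IsNWBTSOn Finset.univ v b F := by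
  rcases hcond with h | h
  · exact main_C1 v b hv h
  · exact main_C2 v b hv h

end DataPlacement
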